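/- Every cube tiling [0,1)^7 + T of ℝ^7 with r^+(T) ≥ 6 contains a twin pair. -/

import Mathlib

/-- The half-open unit cube `[0,1)^d` translated by `t`. -/
def cube {d : ℕ} (t : Fin d → ℝ) : Set (Fin d → ℝ) :=
  {x | ∀ i, t i ≤ x i ∧ x i < t i + 1}

/-- `[0,1)^d + T` is a cube tiling of `ℝ^d`: the translated cubes are pairwise
disjoint and their union is all of `ℝ^d`. -/
def IsCubeTiling {d : ℕ} (T : Set (Fin d → ℝ)) : Prop :=
  (⋃ t ∈ T, cube t) = Set.univ ∧
    T.Pairwise fun t s => Disjoint (cube t) (cube s)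

/-- The cubes `[0,1)^d + t` and `[0,1)^d + s` form a twin pair. -/
def IsTwinPair {d : ℕ} (t s : Fin d → ℝ) : Prop :=
  ∃ j, |t j - s j| = 1 ∧ ∀ i, i ≠ j → t i = s i

/-- `L T x i` is the set of `i`-th coordinates `t i` of vectors `t ∈ T` such that
`([0,1)^d + t) ∩ ([0,1)^d + x) ≠ ∅` and `t i ≤ x i`. -/
def L {d : ℕ} (T : Set (Fin d → ℝ)) (x : Fin d → ℝ) (i : Fin d) : Set ℝ :=
  {r | ∃ t ∈ T, t i = r ∧ (cube t ∩ cube x).Nonempty ∧ t i ≤ x i}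

/-- `r⁺(T) = max_{x ∈ ℝ^d} max_{1 ≤ i ≤ d} |L(T,x,i)|`. -/
noncomputable def rplus {d : ℕ} (T : Set (Fin d → ℝ)) : ℕ :=
  ⨆ x : Fin d → ℝ, ⨆ i : Fin d, (L T x i).ncard

namespace KD7

/-- Code words: six letters, a letter is `2 * pair + sign`. -/
structure W6 where
  a0 : ℕ
  a1 : ℕ
  a2 : ℕ
  a3 : ℕ
  a4 : ℕ
  a5 : ℕ

def W6.get (w : W6) (i : Fin 6) : ℕ :=
  match i with
  | 0 => w.a0 | 1 => w.a1 | 2 => w.a2 | 3 => w.a3 | 4 => w.a4 | 5 => w.a5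

def W6.toList (w : W6) : List ℕ := [w.a0, w.a1, w.a2, w.a3, w.a4, w.a5]

/-- evaluation forcing -/
def force {α : Type} (n : ℕ) (k : ℕ → α) : α := Nat.rec (k 0) (fun m _ => k (Nat.succ m)) n

def oppB (a b : ℕ) : Bool := Nat.beq (Nat.xor a 1) b

def nt (b : Bool) : Bool := Bool.rec true false b

def an (a b : Bool) : Bool := Bool.rec false b a

def orr (a b : Bool) : Bool := Bool.rec b true a

def tn (b : Bool) : ℕ := Bool.rec 0 1 b

def eqb (a b : Bool) : Bool := Bool.rec (Bool.rec true false b) b a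

def allL {α : Type} (p : α → Bool) (l : List α) : Bool :=
  List.rec true (fun a _ ih => Bool.rec false ih (p a)) l

def anyL {α : Type} (p : α → Bool) (l : List α) : Bool :=
  List.rec false (fun a _ ih => Bool.rec ih true (p a)) l

def all6 (f : ℕ → ℕ → ℕ → Bool) (u v : W6) : Bool :=
  an (f 0 u.a0 v.a0) (an (f 1 u.a1 v.a1) (an (f 2 u.a2 v.a2) (an (f 3 u.a3 v.a3)
    (an (f 4 u.a4 v.a4) (f 5 u.a5 v.a5)))))

def sum6 (f : ℕ → ℕ → Bool) (u v : W6) : ℕ :=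
  Nat.add (tn (f u.a0 v.a0)) (Nat.add (tn (f u.a1 v.a1)) (Nat.add (tn (f u.a2 v.a2))
    (Nat.add (tn (f u.a3 v.a3)) (Nat.add (tn (f u.a4 v.a4)) (tn (f u.a5 v.a5))))))

def sepB (u v : W6) : Bool := nt (all6 (fun _ a b => nt (oppB a b)) u v)

def distB (u v : W6) : ℕ := sum6 (fun a b => nt (Nat.beq a b)) u v

def sepCnt (u v : W6) : ℕ := sum6 oppB u v

/-- separated exactly at position `i` -/
def exSep (i : ℕ) (u v : W6) : Bool := all6 (fun j a b => eqb (Nat.beq j i) (oppB a b)) u v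

/-- differ at position `i` -/
def difAt (i : ℕ) (u v : W6) : Bool := nt (all6 (fun j a b => orr (nt (Nat.beq j i)) (Nat.beq a b)) u v)

structure Cap where
  s : Bool
  v : W6
  i : ℕ
  u : W6

structure Dbl where
  s : Bool
  v : W6
  i : ℕ

structure St where
  V : List W6
  W : List W6
  cap : List Cap
  dbl : List Dbl
  np : W6

def St.side (st : St) (s : Bool) : List W6 := match s with
  | true => st.W
  | false => st.V

def mx (a b : ℕ) : ℕ := Bool.rec a b (Nat.ble a b)

def bump1 (n k : ℕ) : ℕ := mx n (Nat.succ (Nat.div k 2))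

def bump (n k : W6) : W6 :=
  ⟨bump1 n.a0 k.a0, bump1 n.a1 k.a1, bump1 n.a2 k.a2, bump1 n.a3 k.a3, bump1 n.a4 k.a4,
    bump1 n.a5 k.a5⟩

def W6.force {α : Type} (w : W6) (k : W6 → α) : α :=
  KD7.force w.a0 fun a0 => KD7.force w.a1 fun a1 => KD7.force w.a2 fun a2 =>
  KD7.force w.a3 fun a3 => KD7.force w.a4 fun a4 => KD7.force w.a5 fun a5 =>
    k ⟨a0, a1, a2, a3, a4, a5⟩

def St.add (st : St) (s : Bool) (k : W6) : St := match s with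
  | true => ⟨st.V, k :: st.W, st.cap, st.dbl, bump st.np k⟩
  | false => ⟨k :: st.V, st.W, st.cap, st.dbl, bump st.np k⟩

/-- `u_j ∈ {v_j, x_j}` for all `j ≠ i` -/
def between (i : ℕ) (v x u : W6) : Bool :=
  an (orr (Nat.beq 0 i) (orr (Nat.beq u.a0 v.a0) (Nat.beq u.a0 x.a0)))
  (an (orr (Nat.beq 1 i) (orr (Nat.beq u.a1 v.a1) (Nat.beq u.a1 x.a1)))
  (an (orr (Nat.beq 2 i) (orr (Nat.beq u.a2 v.a2) (Nat.beq u.a2 x.a2)))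
  (an (orr (Nat.beq 3 i) (orr (Nat.beq u.a3 v.a3) (Nat.beq u.a3 x.a3)))
  (an (orr (Nat.beq 4 i) (orr (Nat.beq u.a4 v.a4) (Nat.beq u.a4 x.a4)))
  (orr (Nat.beq 5 i) (orr (Nat.beq u.a5 v.a5) (Nat.beq u.a5 x.a5)))))))

def capOk (s : Bool) (k : W6) (c : Cap) : Bool :=
  match eqb s c.s with
  | true => nt (exSep c.i c.v k)
  | false => orr (nt (difAt c.i c.v k)) (orr (sepB c.v k) (between c.i c.v k c.u))

/-- filter for new words on side `s` (separation from the same side is not tested here) -/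
def okB (d : ℕ) (st : St) (s : Bool) (k : W6) : Bool :=
  an (allL (fun u => Nat.ble 2 (distB u k)) (st.side s))
  (an (allL (fun u => orr (sepB u k) (an (Nat.ble 1 (distB u k)) (Nat.ble (distB u k) d)))
    (st.side (nt s))) (allL (capOk s k) st.cap))

/-- The letters (one per coordinate) which separate from `u`, truncated after the last coordinate
where separation is possible. -/
def trim : List (List ℕ) → List ℕ → List ℕ
  | o :: os, a :: u => match trim os u with
    | [] => match anyL (oppB a) o with
      | true => force (Nat.xor a 1) fun c => [c]
      | false => []
    | b :: r => force (Nat.xor a 1) fun c => c :: b :: r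
  | _, _ => []

/-- `none` if some word can no longer be separated -/
def stepTd (c : ℕ) (td : List (List ℕ)) : Option (List (List ℕ)) :=
  List.rec (some []) (fun u _ ih => List.rec none (fun a u' _ =>
    Bool.rec
      (Option.rec none (fun t => List.rec none (fun b r _ => some ((b :: r) :: t)) u') ih)
      ih (Nat.beq a c)) u) td

def isNil (td : List (List ℕ)) : Bool := List.rec true (fun _ _ _ => false) td

def gen (opts : List (List ℕ)) : List (List ℕ) → List (List ℕ) :=
  List.rec (fun td => Bool.rec [] [[]] (isNil td))
    (fun o _ ih td => List.rec [] (fun c _ ih' => List.append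
      (Option.rec [] (fun td' => (ih td').map (fun r => c :: r)) (stepTd c td)) ih') o) opts

def genW (opts : List (List ℕ)) (l : List W6) : List (List ℕ) :=
  gen opts (l.map (fun u => trim opts u.toList))

def ofL : List ℕ → W6
  | [a, b, c, d, e, f] => ⟨a, b, c, d, e, f⟩
  | _ => ⟨0, 0, 0, 0, 0, 0⟩

def tb (m p : ℕ) : Bool := Nat.beq (Nat.land (Nat.shiftRight m p) 1) 1

/-- letters through the point at one coordinate -/
def ptOpts (m n : ℕ) : List ℕ → ℕ → List ℕ
  | acc, 0 => acc
  | acc, p + 1 => force (Nat.add (Nat.mul 2 p) (tn (tb m p))) fun c => ptOpts m n (c :: acc) p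

def inPt1 (m a : ℕ) : Bool := eqb (tb m (Nat.div a 2)) (tb a 0)

/-- point contained in word -/
def inPt (m w : W6) : Bool := all6 (fun _ m a => inPt1 m a) m w

def ptO (m n : ℕ) : List ℕ := force (Nat.mul 2 n) fun c => ptOpts m n [c] n

def sgO (i j : ℕ) (v x : ℕ) (X : List ℕ) : List ℕ :=
  match Nat.beq j i with
  | true => force (Nat.xor v 1) fun c => [c]
  | false => match an (nt (Nat.beq x v)) (allL (fun y => Nat.beq y x) X) with
    | true => [v, x]
    | false => [v]

def sgOpts (i : ℕ) (v x : W6) (X : List W6) : List (List ℕ) :=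
  [sgO i 0 v.a0 x.a0 (X.map W6.a0), sgO i 1 v.a1 x.a1 (X.map W6.a1),
   sgO i 2 v.a2 x.a2 (X.map W6.a2), sgO i 3 v.a3 x.a3 (X.map W6.a3),
   sgO i 4 v.a4 x.a4 (X.map W6.a4), sgO i 5 v.a5 x.a5 (X.map W6.a5)]

def eqW (u v : W6) : Bool := all6 (fun _ a b => Nat.beq a b) u v

def dblAt (st : St) (s : Bool) (v : W6) (i : ℕ) : Bool :=
  anyL (fun f => an (eqb f.s s) (an (Nat.beq f.i i) (eqW f.v v))) st.dbl

def filterL (p : W6 → Bool) (l : List W6) : List W6 :=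
  List.rec [] (fun a _ ih => Bool.rec ih (a :: ih) (p a)) l

def Xof (st : St) (s : Bool) (v : W6) (i : ℕ) : List W6 :=
  filterL (fun w => an (difAt i v w) (nt (sepB v w))) (st.side (nt s))

def cnt (p : W6 → Bool) (l : List W6) : ℕ :=
  List.rec 0 (fun a _ ih => Nat.add (tn (p a)) ih) l

def gBound (st : St) (s : Bool) (v : W6) (i : ℕ) : ℕ :=
  mx (cnt (exSep i v) (st.side s)) (match dblAt st s v i with
    | true => 2
    | false => match Xof st s v i with
      | [] => 0
      | _ => 1)

def leafB (st : St) (s : Bool) (v : W6) : Bool :=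
  Nat.ble 10 (Nat.add (cnt (fun u => Nat.ble 2 (sepCnt v u)) (st.side s))
   (Nat.add (gBound st s v 0) (Nat.add (gBound st s v 1) (Nat.add (gBound st s v 2)
   (Nat.add (gBound st s v 3) (Nat.add (gBound st s v 4) (gBound st s v 5)))))))

/-- call the continuation on the (evaluated) state with a word added -/
def addK {α : Type} (st : St) (s : Bool) (k : W6) (f : St → α) : α :=
  k.force fun k => (bump st.np k).force fun n => match s with
    | true => f ⟨st.V, k :: st.W, st.cap, st.dbl, n⟩
    | false => f ⟨k :: st.V, st.W, st.cap, st.dbl, n⟩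

/-- children of a branching node -/
def runKids (d : ℕ) (st : St) (s : Bool) (f : W6 → St → List ℕ → Option (List ℕ)) :
    List (List ℕ) → List ℕ → Option (List ℕ)
  | [], c => some c
  | l :: ls, c => match okB d st s (ofL l) with
    | true => match addK st s (ofL l) (fun st' => f (ofL l) st' c) with
      | none => none
      | some c' => runKids d st s f ls c'
    | false => runKids d st s f ls c

def leafR (st : St) (s : Bool) (k : ℕ) (c : List ℕ) : Option (List ℕ) :=
  match (st.side s)[k]? with
  | none => none
  | some v => match leafB st s v with
    | true => some c
    | false => none

def ptOpts6 (m n : W6) : List (List ℕ) :=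
  [ptO m.a0 n.a0, ptO m.a1 n.a1, ptO m.a2 n.a2, ptO m.a3 n.a3, ptO m.a4 n.a4, ptO m.a5 n.a5]

def pointR (d : ℕ) (f : St → List ℕ → Option (List ℕ)) (st : St) (s : Bool) (k : ℕ)
    (c : List ℕ) : Option (List ℕ) :=
  match (st.side (nt s))[k]? with
  | none => none
  | some w => match c with
    | m0 :: m1 :: m2 :: m3 :: m4 :: m5 :: c =>
      match an (inPt ⟨m0, m1, m2, m3, m4, m5⟩ w)
          (allL (fun u => nt (inPt ⟨m0, m1, m2, m3, m4, m5⟩ u)) (st.side s)) with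
      | true => runKids d st s (fun _ => f)
          (genW (ptOpts6 ⟨m0, m1, m2, m3, m4, m5⟩ st.np) (st.side s)) c
      | false => none
    | _ => none

def singleR (d : ℕ) (f : St → List ℕ → Option (List ℕ)) (st : St) (s : Bool) (k : ℕ)
    (c : List ℕ) : Option (List ℕ) :=
  match (st.side s)[k]? with
  | none => none
  | some v => match c with
    | [] => none
    | i :: c => match an (Nat.ble i 5) (allL (fun u => nt (exSep i v u)) (st.side s)) with
      | true => match Xof st s v i with
        | [] => none
        | x :: X => match runKids d st s
            (fun u st' => f ⟨st'.V, st'.W, ⟨s, v, i, u⟩ :: st'.cap, st'.dbl, st'.np⟩)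
            (genW (sgOpts i v x X) (st.side s)) c with
          | none => none
          | some c => f ⟨st.V, st.W, st.cap, ⟨s, v, i⟩ :: st.dbl, st.np⟩ c
      | false => none

def check (d : ℕ) : ℕ → St → List ℕ → Option (List ℕ)
  | 0, _, _ => none
  | fuel + 1, st, code :: k :: c => match code with
    | 0 => leafR st false k c
    | 1 => leafR st true k c
    | 2 => pointR d (check d fuel) st false k c
    | 3 => pointR d (check d fuel) st true k c
    | 4 => singleR d (check d fuel) st false k c
    | 5 => singleR d (check d fuel) st true k c
    | _ => none
  | _, _, _ => none

def isSomeB (o : Option (List ℕ)) : Bool := match o with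
  | none => false
  | some _ => true

/-- root letters in terms of the class of the coordinate -/
def rV (g : ℕ) : ℕ := bif Nat.ble g 3 then 2 else 0

def rV' (g : ℕ) : ℕ := bif Nat.ble g 1 then 3 else bif Nat.ble g 3 then 2 else 0

def rW' (g : ℕ) : ℕ := bif Nat.beq g 1 then 1 else bif Nat.beq g 2 then 1 else 0

def rN (g : ℕ) : ℕ := bif Nat.ble g 3 then 2 else 1

def W6.map (f : ℕ → ℕ) (g : W6) : W6 := ⟨f g.a0, f g.a1, f g.a2, f g.a3, f g.a4, f g.a5⟩

/-- root state -/
def rootSt (g : W6) : St :=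
  ⟨[g.map rV', g.map rV], [g.map rW', ⟨0, 0, 0, 0, 0, 0⟩], [], [], g.map rN⟩

def rootOk (d : ℕ) (g : W6) (cert : List ℕ) : Bool :=
  (g.map rV').force fun v' => (g.map rV).force fun v => (g.map rW').force fun w' =>
  (g.map rN).force fun n => isSomeB (check d 60
    ⟨[v', v], [w', ⟨0, 0, 0, 0, 0, 0⟩], [], [], n⟩ cert)

end KD7

namespace KD7

theorem force_eq {α : Type} (n : ℕ) (k : ℕ → α) : force n k = k n := by
  cases n <;> rfl

theorem W6.force_eq {α : Type} (w : W6) (k : W6 → α) : w.force k = k w := by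
  simp only [W6.force, KD7.force_eq]

theorem nt_eq (b : Bool) : nt b = !b := by cases b <;> rfl
theorem an_eq (a b : Bool) : an a b = (a && b) := by cases a <;> rfl
theorem orr_eq (a b : Bool) : orr a b = (a || b) := by cases a <;> rfl
theorem eqb_eq (a b : Bool) : (eqb a b = true) ↔ (a = b) := by cases a <;> cases b <;> decide
theorem tn_eq (b : Bool) : tn b = if b = true then 1 else 0 := by cases b <;> rfl

theorem allL_iff {α : Type} (p : α → Bool) (l : List α) :
    allL p l = true ↔ ∀ a ∈ l, p a = true := by
  induction l with
  | nil => simp [allL]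
  | cons a l ih =>
    have : allL p (a :: l) = an (p a) (allL p l) := rfl
    rw [this, an_eq]; simp [ih]

theorem anyL_iff {α : Type} (p : α → Bool) (l : List α) :
    anyL p l = true ↔ ∃ a ∈ l, p a = true := by
  induction l with
  | nil => simp [anyL]
  | cons a l ih =>
    have : anyL p (a :: l) = orr (p a) (anyL p l) := rfl
    rw [this, orr_eq]; simp [ih]

theorem mem_filterL (p : W6 → Bool) (l : List W6) (w : W6) :
    w ∈ filterL p l ↔ w ∈ l ∧ p w = true := by
  induction l with
  | nil => simp [filterL]
  | cons a l ih =>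
    have : filterL p (a :: l) = Bool.rec (filterL p l) (a :: filterL p l) (p a) := rfl
    rw [this]
    rcases h : p a with _ | _
    · simp only [ih, List.mem_cons]
      constructor
      · rintro ⟨h1, h2⟩; exact ⟨Or.inr h1, h2⟩
      · rintro ⟨rfl | h1, h2⟩
        · rw [h] at h2; cases h2
        · exact ⟨h1, h2⟩
    · simp only [ih, List.mem_cons]
      constructor
      · rintro (rfl | ⟨h1, h2⟩)
        · exact ⟨Or.inl rfl, h⟩
        · exact ⟨Or.inr h1, h2⟩
      · rintro ⟨rfl | h1, h2⟩
        · exact Or.inl rfl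
        · exact Or.inr ⟨h1, h2⟩

theorem cnt_eq (p : W6 → Bool) (l : List W6) : cnt p l = (l.filter p).length := by
  induction l with
  | nil => rfl
  | cons a l ih =>
    have : cnt p (a :: l) = Nat.add (tn (p a)) (cnt p l) := rfl
    rw [this, ih, tn_eq, List.filter_cons]
    change (_ + _ : ℕ) = _
    split <;> simp [Nat.add_comm]

theorem mx_eq (a b : ℕ) : mx a b = max a b := by
  unfold mx
  rcases h : Nat.ble a b with _ | _
  · have : ¬ a ≤ b := fun h' => by rw [Nat.ble_eq_true_of_le h'] at h; cases h
    simp; omega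
  · have := Nat.le_of_ble_eq_true h
    simp; omega

theorem beq_iff (a b : ℕ) : Nat.beq a b = true ↔ a = b := by simp
theorem ble_iff (a b : ℕ) : Nat.ble a b = true ↔ a ≤ b := by simp

theorem all6_iff (f : ℕ → ℕ → ℕ → Bool) (u v : W6) :
    all6 f u v = true ↔ ∀ i : Fin 6, f i.1 (u.get i) (v.get i) = true := by
  simp only [all6, an_eq, Bool.and_eq_true, Fin.forall_fin_succ]
  simp [W6.get]

theorem sum6_eq (f : ℕ → ℕ → Bool) (u v : W6) :
    sum6 f u v = (Finset.univ.filter (fun i : Fin 6 => f (u.get i) (v.get i) = true)).card := by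
  rw [Finset.card_filter, Fin.sum_univ_six]
  simp only [sum6, tn_eq]
  change (_ + (_ + (_ + (_ + (_ + _)))) : ℕ) = _
  simp only [W6.get, Nat.add_assoc]
  rfl

theorem xor_one_div (a : ℕ) : (Nat.xor a 1) / 2 = a / 2 := by
  change (a ^^^ 1) / 2 = _
  have := Nat.xor_div_two (a := a) (b := 1)
  simpa using this

theorem xor_one_mod (a : ℕ) : (Nat.xor a 1) % 2 = 1 - a % 2 := by
  change (a ^^^ 1) % 2 = _
  rcases Nat.mod_two_eq_zero_or_one a with h | h <;>
  · have := Nat.xor_mod_two_eq (m := a) (n := 1)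
    omega

/-- actual letters and words -/
abbrev Lt := ℝ × Bool
abbrev Wd := Fin 6 → Lt

def opp (a b : Lt) : Prop := a.1 = b.1 ∧ a.2 ≠ b.2
def fl (a : Lt) : Lt := (a.1, !a.2)

theorem opp_iff (a b : Lt) : opp a b ↔ b = fl a := by
  rcases a with ⟨a, s⟩; rcases b with ⟨b, t⟩
  cases s <;> cases t <;> simp [opp, fl, eq_comm]

def rho (φ : Fin 6 → ℕ → Lt) (i : Fin 6) (c : ℕ) : Lt :=
  if c % 2 = 0 then φ i (c / 2) else fl (φ i (c / 2))

def rhoW (φ : Fin 6 → ℕ → Lt) (k : W6) : Wd := fun i => rho φ i (k.get i)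

theorem rho_fst (φ : Fin 6 → ℕ → Lt) (i : Fin 6) (c : ℕ) : (rho φ i c).1 = (φ i (c / 2)).1 := by
  unfold rho; split <;> rfl

theorem rho_xor (φ : Fin 6 → ℕ → Lt) (i : Fin 6) (c : ℕ) :
    rho φ i (Nat.xor c 1) = fl (rho φ i c) := by
  unfold rho
  rw [xor_one_div, xor_one_mod]
  rcases Nat.mod_two_eq_zero_or_one c with h | h <;> simp [h, fl]

def Inj (φ : Fin 6 → ℕ → Lt) (n : W6) : Prop :=
  ∀ i p q, p < n.get i → q < n.get i → (φ i p).1 = (φ i q).1 → p = q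

theorem rho_inj {φ : Fin 6 → ℕ → Lt} {n : W6} (h : Inj φ n) {i : Fin 6} {a b : ℕ}
    (ha : a / 2 < n.get i) (hb : b / 2 < n.get i) : rho φ i a = rho φ i b ↔ a = b := by
  constructor
  · intro e
    have e1 : a / 2 = b / 2 := h i _ _ ha hb (by rw [← rho_fst, ← rho_fst, e])
    have e2 : a % 2 = b % 2 := by
      unfold rho at e
      rw [e1] at e
      rcases Nat.mod_two_eq_zero_or_one a with h1 | h1 <;>
      rcases Nat.mod_two_eq_zero_or_one b with h2 | h2 <;> simp [h1, h2, fl, Prod.ext_iff] at e ⊢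
    omega
  · rintro rfl; rfl

theorem rho_opp {φ : Fin 6 → ℕ → Lt} {n : W6} (h : Inj φ n) {i : Fin 6} {a b : ℕ}
    (ha : a / 2 < n.get i) (hb : b / 2 < n.get i) :
    oppB a b = true ↔ opp (rho φ i a) (rho φ i b) := by
  rw [opp_iff, ← rho_xor, oppB, beq_iff, rho_inj h hb (by rwa [xor_one_div])]
  exact eq_comm

def Sep (u v : Wd) : Prop := ∃ i, opp (u i) (v i)
def G (i : Fin 6) (v x : Wd) : Prop := ∀ j, opp (v j) (x j) ↔ j = i
def inW (Y : Fin 6 → ℝ → Bool) (u : Wd) : Prop := ∀ i, Y i (u i).1 = (u i).2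

/-- all letters of `k` are known -/
def Lo (n k : W6) : Prop := ∀ i, k.get i / 2 < n.get i

theorem sepB_iff {φ : Fin 6 → ℕ → Lt} {n : W6} (h : Inj φ n) {u v : W6} (hu : Lo n u) (hv : Lo n v) :
    sepB u v = true ↔ Sep (rhoW φ u) (rhoW φ v) := by
  unfold sepB Sep
  rw [nt_eq, Bool.not_eq_true', ← Bool.not_eq_true, all6_iff]
  push Not
  refine exists_congr fun i => ?_
  have := rho_opp h (hu i) (hv i)
  simp only [rhoW]
  rw [nt_eq, ← this]
  simp

theorem exSep_iff {φ : Fin 6 → ℕ → Lt} {n : W6} (h : Inj φ n) {u v : W6} (hu : Lo n u) (hv : Lo n v)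
    (i : Fin 6) : exSep i.1 u v = true ↔ G i (rhoW φ u) (rhoW φ v) := by
  unfold exSep G
  rw [all6_iff]
  refine forall_congr' fun j => ?_
  rw [eqb_eq, Bool.eq_iff_iff, beq_iff, rho_opp h (hu j) (hv j), Fin.ext_iff]
  exact iff_comm

theorem difAt_iff {φ : Fin 6 → ℕ → Lt} {n : W6} (h : Inj φ n) {u v : W6} (hu : Lo n u) (hv : Lo n v)
    (i : Fin 6) : difAt i.1 u v = true ↔ rhoW φ u i ≠ rhoW φ v i := by
  unfold difAt
  rw [nt_eq, Bool.not_eq_true', ← Bool.not_eq_true, all6_iff, not_iff_not]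
  simp only [orr_eq, nt_eq, Bool.or_eq_true, Bool.not_eq_true', ← Bool.not_eq_true, beq_iff, rhoW]
  rw [rho_inj h (hu i) (hv i)]
  constructor
  · intro h
    rcases h i with h | h
    · exact absurd rfl h
    · exact h
  · intro h j
    by_cases e : j.1 = i.1
    · right
      have : j = i := Fin.ext e
      rw [this, h]
    · exact Or.inl e

theorem distB_eq {φ : Fin 6 → ℕ → Lt} {n : W6} (h : Inj φ n) {u v : W6} (hu : Lo n u) (hv : Lo n v) :
    distB u v = (Finset.univ.filter (fun i => rhoW φ u i ≠ rhoW φ v i)).card := by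
  unfold distB
  rw [sum6_eq]
  congr 1
  ext i
  rw [Finset.mem_filter, Finset.mem_filter]
  simp only [nt_eq, Bool.not_eq_true', ← Bool.not_eq_true, beq_iff, rhoW, ne_eq,
    rho_inj h (hu i) (hv i)]

theorem sepCnt_eq {φ : Fin 6 → ℕ → Lt} {n : W6} (h : Inj φ n) {u v : W6} (hu : Lo n u)
    (hv : Lo n v) [∀ i, Decidable (opp (rhoW φ u i) (rhoW φ v i))] :
    sepCnt u v = (Finset.univ.filter (fun i => opp (rhoW φ u i) (rhoW φ v i))).card := by
  unfold sepCnt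
  rw [sum6_eq]
  congr 1
  ext i
  rw [Finset.mem_filter, Finset.mem_filter]
  simp only [rhoW, rho_opp h (hu i) (hv i)]

theorem W6.ext' {u v : W6} (h : ∀ i, u.get i = v.get i) : u = v := by
  rcases u with ⟨a, b, c, d, e, f⟩; rcases v with ⟨a', b', c', d', e', f'⟩
  have h0 := h 0
  have h1 := h 1
  have h2 := h 2
  have h3 := h 3
  have h4 := h 4
  have h5 := h 5
  simp only [W6.get] at h0 h1 h2 h3 h4 h5
  subst h0 h1 h2 h3 h4 h5
  rfl

theorem rhoW_inj {φ : Fin 6 → ℕ → Lt} {n : W6} (h : Inj φ n) {u v : W6} (hu : Lo n u) (hv : Lo n v)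
    (e : rhoW φ u = rhoW φ v) : u = v :=
  W6.ext' fun i => (rho_inj h (hu i) (hv i)).1 (congrFun e i)

theorem eqW_iff (u v : W6) : eqW u v = true ↔ u = v := by
  unfold eqW
  rw [all6_iff]
  constructor
  · intro h; exact W6.ext' fun i => (beq_iff _ _).1 (h i)
  · rintro rfl i; exact (beq_iff _ _).2 rfl

theorem between_iff {φ : Fin 6 → ℕ → Lt} {n : W6} (h : Inj φ n) {v x u : W6} (hv : Lo n v)
    (hx : Lo n x) (hu : Lo n u) (i : Fin 6) :
    between i.1 v x u = true ↔
      ∀ j, j ≠ i → rhoW φ u j = rhoW φ v j ∨ rhoW φ u j = rhoW φ x j := by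
  have h1 : ∀ j, (rhoW φ u j = rhoW φ v j ∨ rhoW φ u j = rhoW φ x j) ↔
      (u.get j = v.get j ∨ u.get j = x.get j) := fun j => by
    simp only [rhoW]; rw [rho_inj h (hu j) (hv j), rho_inj h (hu j) (hx j)]
  simp only [h1]
  have h2 : ∀ j : Fin 6, (j ≠ i → (u.get j = v.get j ∨ u.get j = x.get j)) ↔
      (j.1 = i.1 ∨ (u.get j = v.get j ∨ u.get j = x.get j)) := fun j => by
    rw [ne_eq, Fin.ext_iff]; tauto
  simp only [h2]
  unfold between
  simp only [an_eq, orr_eq, Bool.and_eq_true, Bool.or_eq_true, beq_iff]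
  rw [Fin.forall_fin_succ, Fin.forall_fin_succ, Fin.forall_fin_succ, Fin.forall_fin_succ,
    Fin.forall_fin_succ, Fin.forall_fin_succ]
  simp [W6.get]

end KD7

namespace KD7

def Hit : List ℕ → List ℕ → Prop
  | a :: u, c :: v => a = c ∨ Hit u v
  | _, _ => False

def SepL : List ℕ → List ℕ → Prop
  | a :: u, c :: v => oppB a c = true ∨ SepL u v
  | _, _ => False

theorem stepTd_spec (c : ℕ) (v : List ℕ) (td : List (List ℕ)) (h : ∀ u ∈ td, Hit u (c :: v)) :
    ∃ td', stepTd c td = some td' ∧ ∀ u ∈ td', Hit u v := by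
  induction td with
  | nil => exact ⟨[], rfl, by simp⟩
  | cons u td ih =>
    obtain ⟨t, ht, ht'⟩ := ih fun u hu => h u (List.mem_cons_of_mem _ hu)
    have hu := h u List.mem_cons_self
    cases u with
    | nil => exact hu.elim
    | cons a u =>
      have e : stepTd c ((a :: u) :: td) = Bool.rec
        (Option.rec none (fun t => List.rec none (fun b r _ => some ((b :: r) :: t)) u) (stepTd c td))
        (stepTd c td) (Nat.beq a c) := rfl
      rw [e, ht]
      rcases hb : Nat.beq a c with _ | _
      · have hne : a ≠ c := fun h' => by rw [(beq_iff a c).2 h'] at hb; cases hb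
        rcases hu with hu | hu
        · exact absurd hu hne
        · cases u with
          | nil => exact hu.elim
          | cons b r =>
            refine ⟨(b :: r) :: t, rfl, ?_⟩
            intro u' hu'
            rcases List.mem_cons.1 hu' with rfl | h'
            · exact hu
            · exact ht' _ h'
      · exact ⟨t, rfl, ht'⟩

theorem mem_gen (opts : List (List ℕ)) : ∀ (td : List (List ℕ)) (v : List ℕ),
    List.Forall₂ (fun c o => c ∈ o) v opts → (∀ u ∈ td, Hit u v) → v ∈ gen opts td := by
  induction opts with
  | nil =>
    intro td v hv h
    cases hv
    cases td with
    | nil => exact List.mem_singleton.2 rfl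
    | cons u td =>
      have := h u List.mem_cons_self
      cases u <;> exact this.elim
  | cons o os ih =>
    intro td v hv h
    cases hv with
    | @cons c _ r _ hc hr =>
      obtain ⟨td', h1, h2⟩ := stepTd_spec c r td h
      have key := ih td' r hr h2
      have e : gen (o :: os) td = List.rec [] (fun c _ ih' => List.append
        (Option.rec [] (fun td' => (gen os td').map (fun r => c :: r)) (stepTd c td)) ih') o := rfl
      rw [e]
      clear e ih
      induction o with
      | nil => cases hc
      | cons b o iho =>
        change _ ∈ (_ ++ _ : List (List ℕ))
        rw [List.mem_append]
        rcases List.mem_cons.1 hc with rfl | hc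
        · left
          rw [h1]
          exact List.mem_map.2 ⟨r, key, rfl⟩
        · right
          exact iho hc

theorem hit_trim : ∀ (opts : List (List ℕ)) (u v : List ℕ),
    List.Forall₂ (fun c o => c ∈ o) v opts → SepL u v → Hit (trim opts u) v
  | [], u, v, hv, h => by
    cases hv
    cases u <;> exact h.elim
  | o :: os, [], v, hv, h => h.elim
  | o :: os, a :: u, v, hv, h => by
    cases hv with
    | @cons c _ r _ hc hr =>
      have ih := hit_trim os u r hr
      unfold trim
      simp only [force_eq]
      rcases h with h | h
      · have hx : Nat.xor a 1 = c := (beq_iff _ _).1 h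
        have hany : anyL (oppB a) o = true := (anyL_iff _ _).2 ⟨c, hc, h⟩
        rw [hany]
        cases trim os u with
        | nil => exact Or.inl hx
        | cons b r => exact Or.inl hx
      · have := ih h
        cases ht : trim os u with
        | nil => rw [ht] at this; cases r <;> exact this.elim
        | cons b r => rw [ht] at this; exact Or.inr this

theorem mem_genW (o0 o1 o2 o3 o4 o5 : List ℕ) (l : List W6) (k : W6)
    (h0 : k.a0 ∈ o0) (h1 : k.a1 ∈ o1) (h2 : k.a2 ∈ o2) (h3 : k.a3 ∈ o3) (h4 : k.a4 ∈ o4)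
    (h5 : k.a5 ∈ o5) (hs : ∀ u ∈ l, sepB u k = true) :
    k.toList ∈ genW [o0, o1, o2, o3, o4, o5] l := by
  have hF : List.Forall₂ (fun c o => c ∈ o) k.toList [o0, o1, o2, o3, o4, o5] :=
    .cons h0 (.cons h1 (.cons h2 (.cons h3 (.cons h4 (.cons h5 .nil)))))
  refine mem_gen _ _ _ hF ?_
  intro u hu
  obtain ⟨x, hx, rfl⟩ := List.mem_map.1 hu
  refine hit_trim _ _ _ hF ?_
  have := hs x hx
  simp only [sepB, all6, an_eq, nt_eq, Bool.not_eq_true', Bool.and_eq_false_iff,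
    Bool.not_eq_false'] at this
  simp only [W6.toList, SepL]
  tauto

theorem ofL_toList (k : W6) : ofL k.toList = k := rfl

theorem addK_eq {α : Type} (st : St) (s : Bool) (k : W6) (f : St → α) :
    addK st s k f = f (st.add s k) := by
  unfold addK
  simp only [W6.force_eq]
  cases s <;> rfl

theorem bump1_eq (n k : ℕ) : bump1 n k = max n (k / 2 + 1) := by
  unfold bump1; rw [mx_eq]; rfl

theorem bump_get (n k : W6) (i : Fin 6) : (bump n k).get i = max (n.get i) (k.get i / 2 + 1) := by
  fin_cases i <;> exact bump1_eq _ _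

/-- if all children succeed then each admissible child succeeds -/
theorem runKids_spec (d : ℕ) (st : St) (s : Bool) (f : W6 → St → List ℕ → Option (List ℕ))
    (ls : List (List ℕ)) (k : W6) (hk : k.toList ∈ ls) (hok : okB d st s k = true) :
    ∀ (c c' : List ℕ), runKids d st s f ls c = some c' →
      ∃ e e', f k (st.add s k) e = some e' := by
  induction ls with
  | nil => cases hk
  | cons l ls ih =>
    intro c c' h
    unfold runKids at h
    rcases List.mem_cons.1 hk with rfl | hk
    · rw [ofL_toList, hok, addK_eq] at h
      cases hf : f k (st.add s k) c with
      | none => simp [hf] at h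
      | some c1 => exact ⟨c, c1, hf⟩
    · cases ho : okB d st s (ofL l) with
      | true =>
        simp only [ho, addK_eq] at h
        cases hf : f (ofL l) (st.add s (ofL l)) c with
        | none => simp [hf] at h
        | some c1 => simp only [hf] at h; exact ih hk _ _ h
      | false =>
        simp only [ho] at h; exact ih hk _ _ h

theorem tb_eq (m p : ℕ) : tb m p = m.testBit p := by
  unfold tb Nat.testBit
  rw [Bool.eq_iff_iff, beq_iff]
  change (m >>> p) &&& 1 = 1 ↔ _
  rw [Nat.and_comm]
  have : 1 &&& (m >>> p) = 0 ∨ 1 &&& (m >>> p) = 1 := by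
    rw [Nat.one_and_eq_mod_two]; omega
  rcases this with h | h <;> simp [h]

theorem mem_ptOpts (m n : ℕ) : ∀ (p : ℕ) (acc : List ℕ) (c : ℕ),
    (c ∈ acc ∨ ∃ q < p, c = 2 * q + tn (tb m q)) → c ∈ ptOpts m n acc p
  | 0, acc, c, h => by
    rcases h with h | ⟨q, hq, _⟩
    · exact h
    · omega
  | p + 1, acc, c, h => by
    unfold ptOpts
    rw [force_eq]
    apply mem_ptOpts m n p
    rcases h with h | ⟨q, hq, h⟩
    · exact Or.inl (List.mem_cons_of_mem _ h)
    · by_cases e : q = p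
      · subst e; left; rw [h]; exact List.mem_cons_self
      · right; exact ⟨q, by omega, h⟩

theorem mem_ptO (m n c : ℕ) (h : c = 2 * n ∨ ∃ q < n, c = 2 * q + tn (tb m q)) : c ∈ ptO m n := by
  unfold ptO
  rw [force_eq]
  apply mem_ptOpts
  rcases h with h | h
  · left; rw [h]; exact List.mem_singleton.2 rfl
  · exact Or.inr h

theorem mem_sgO (i j v x : ℕ) (X : List ℕ) (c : ℕ) (h1 : j = i → c = Nat.xor v 1)
    (h2 : j ≠ i → c = v ∨ (c = x ∧ ∀ y ∈ X, c = y)) : c ∈ sgO i j v x X := by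
  unfold sgO
  by_cases e : j = i
  · rw [(beq_iff j i).2 e]
    simp only [force_eq]
    rw [h1 e]; exact List.mem_singleton.2 rfl
  · have : Nat.beq j i = false := by
      rw [← Bool.not_eq_true, beq_iff]; exact e
    rw [this]
    rcases h2 e with h | ⟨h, hX⟩
    · subst h
      simp only
      split <;> simp
    · subst h
      by_cases hv : c = v
      · subst hv
        simp only
        split <;> simp
      · have : an (nt (Nat.beq c v)) (allL (fun y => Nat.beq y c) X) = true := by
          rw [an_eq, nt_eq, Bool.and_eq_true, allL_iff]
          refine ⟨?_, fun y hy => (beq_iff _ _).2 (hX y hy).symm⟩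
          rw [Bool.not_eq_true', ← Bool.not_eq_true, beq_iff]; exact hv
        simp [this]

end KD7

namespace KD7

structure Hyp (F : Bool → Finset Wd) (d : ℕ) : Prop where
  sep : ∀ s, ∀ u ∈ F s, ∀ v ∈ F s, u ≠ v → Sep u v
  notwin : ∀ s, ∀ u ∈ F s, ∀ v ∈ F s, ∀ i, opp (u i) (v i) → ∃ j, j ≠ i ∧ u j ≠ v j
  disj : ∀ s, ∀ u ∈ F s, u ∉ F (!s)
  cov : ∀ s, ∀ u ∈ F (!s), ∀ Y, inW Y u → ∃ v ∈ F s, inW Y v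
  dist : ∀ s, ∀ u ∈ F (!s), ∀ v ∈ F s, ¬ Sep u v →
    (Finset.univ.filter fun i => u i ≠ v i).card ≤ d
  card : ∀ s, (F s).card ≤ 10

structure Rlz (F : Bool → Finset Wd) (st : St) (φ : Fin 6 → ℕ → Lt) : Prop where
  inj : Inj φ st.np
  lo : ∀ s, ∀ k ∈ st.side s, Lo st.np k
  mem : ∀ s, ∀ k ∈ st.side s, rhoW φ k ∈ F s
  nodup : ∀ s, (st.side s).Nodup
  cap : ∀ c ∈ st.cap, c.v ∈ st.side c.s ∧ c.u ∈ st.side c.s ∧ ∃ i : Fin 6, i.1 = c.i ∧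
    ∀ x ∈ F c.s, G i (rhoW φ c.v) x → x = rhoW φ c.u
  dbl : ∀ c ∈ st.dbl, c.v ∈ st.side c.s ∧ ∃ i : Fin 6, i.1 = c.i ∧
    ∃ x ∈ F c.s, ∃ y ∈ F c.s, x ≠ y ∧ G i (rhoW φ c.v) x ∧ G i (rhoW φ c.v) y

theorem opp_ne {a b : Lt} (h : opp a b) : a ≠ b := fun e => h.2 (by rw [e])

theorem opp_symm {a b : Lt} (h : opp a b) : opp b a := ⟨h.1.symm, h.2.symm⟩

theorem Sep.symm {u v : Wd} (h : Sep u v) : Sep v u := by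
  obtain ⟨i, hi⟩ := h; exact ⟨i, opp_symm hi⟩

theorem cover_G {F : Bool → Finset Wd} {d : ℕ} (H : Hyp F d) {s : Bool} {v x : Wd} (hv : v ∈ F s)
    (hx : x ∈ F (!s)) {i : Fin 6} (Y : Fin 6 → ℝ → Bool)
    (hY : inW Y x) (h1 : ∀ j, j ≠ i → Y j (v j).1 = (v j).2) (h2 : Y i (v i).1 ≠ (v i).2) :
    ∃ y ∈ F s, G i v y ∧ inW Y y := by
  obtain ⟨y, hy, hYy⟩ := H.cov s x hx Y hY
  refine ⟨y, hy, ?_, hYy⟩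
  have hne : v ≠ y := by
    rintro rfl; exact h2 (hYy i)
  obtain ⟨j, hj⟩ := H.sep s v hv y hy hne
  have key : ∀ j, opp (v j) (y j) → j = i := by
    intro j hj
    by_contra hji
    have e1 := h1 j hji
    have e2 := hYy j
    rw [← hj.1, e1] at e2
    exact hj.2 e2
  intro j'
  refine ⟨key j', ?_⟩
  rintro rfl
  rw [← key j hj]; exact hj

theorem exists_Y {v x : Wd} {i : Fin 6} (hs : ¬ Sep v x) (hi : v i ≠ x i) (u : Wd) :
    ∃ Y : Fin 6 → ℝ → Bool, inW Y x ∧ (∀ j, j ≠ i → Y j (v j).1 = (v j).2) ∧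
      Y i (v i).1 ≠ (v i).2 ∧
      ∀ j, j ≠ i → u j ≠ v j → u j ≠ x j → Y j (u j).1 ≠ (u j).2 := by
  classical
  refine ⟨fun j q => if q = (x j).1 then (x j).2 else if q = (v j).1 then
    (if j = i then !(v j).2 else (v j).2) else !(u j).2, ?_, ?_, ?_, ?_⟩
  · intro j; simp
  · intro j hj
    by_cases e : (v j).1 = (x j).1
    · simp only [e, if_true]
      by_contra h
      exact hs ⟨j, e, fun h' => h h'.symm⟩
    · simp [e, hj]
  · by_cases e : (v i).1 = (x i).1
    · simp only [e, if_true]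
      intro h
      exact hi (Prod.ext e h.symm)
    · simp [e]
  · intro j hj h1 h2
    by_cases e : (u j).1 = (x j).1
    · simp only [e, if_true]
      intro h
      exact h2 (Prod.ext e h.symm)
    · by_cases e' : (u j).1 = (v j).1
      · simp only [e', if_true]
        rw [if_neg (by rwa [← e']), if_neg hj]
        intro h
        exact h1 (Prod.ext e' h.symm)
      · simp [e, e']

theorem G_nonempty {F : Bool → Finset Wd} {d : ℕ} (H : Hyp F d) {s : Bool} {v x : Wd}
    (hv : v ∈ F s) (hx : x ∈ F (!s)) {i : Fin 6} (hs : ¬ Sep v x) (hi : v i ≠ x i) :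
    ∃ y ∈ F s, G i v y := by
  obtain ⟨Y, h1, h2, h3, _⟩ := exists_Y hs hi v
  obtain ⟨y, hy, hG, _⟩ := cover_G H hv hx Y h1 h2 h3
  exact ⟨y, hy, hG⟩

theorem G_unique {F : Bool → Finset Wd} {d : ℕ} (H : Hyp F d) {s : Bool} {v x : Wd}
    (hv : v ∈ F s) (hx : x ∈ F (!s)) {i : Fin 6} (hs : ¬ Sep v x) (hi : v i ≠ x i) {u : Wd}
    (hu : ∀ y ∈ F s, G i v y → y = u) (j : Fin 6) (hj : j ≠ i) : u j = v j ∨ u j = x j := by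
  obtain ⟨Y, h1, h2, h3, h4⟩ := exists_Y hs hi u
  obtain ⟨y, hy, hG, hYy⟩ := cover_G H hv hx Y h1 h2 h3
  obtain rfl := hu y hy hG
  by_contra h
  push Not at h
  exact h4 j hj h.1 h.2 (hYy j)

def ofFn (f : Fin 6 → ℕ) : W6 := ⟨f 0, f 1, f 2, f 3, f 4, f 5⟩

theorem get_ofFn (f : Fin 6 → ℕ) (i : Fin 6) : (ofFn f).get i = f i := by
  fin_cases i <;> rfl

theorem ext_one (n : ℕ) (φ : ℕ → Lt) (h : ∀ p q, p < n → q < n → (φ p).1 = (φ q).1 → p = q)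
    (a : Lt) : ∃ (ψ : ℕ → Lt) (c : ℕ), (∀ p < n, ψ p = φ p) ∧
      (∀ p q, p < max n (c / 2 + 1) → q < max n (c / 2 + 1) → (ψ p).1 = (ψ q).1 → p = q) ∧
      (if c % 2 = 0 then ψ (c / 2) else fl (ψ (c / 2))) = a ∧ (c / 2 < n ∨ c = 2 * n) := by
  classical
  by_cases hp : ∃ p < n, (φ p).1 = a.1
  · obtain ⟨p, hp, e⟩ := hp
    by_cases e2 : (φ p).2 = a.2
    · refine ⟨φ, 2 * p, fun _ _ => rfl, ?_, ?_, ?_⟩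
      · have : max n (2 * p / 2 + 1) = n := by omega
        rw [this]; exact h
      · have : 2 * p / 2 = p := by omega
        rw [this, if_pos (by omega)]
        exact Prod.ext e e2
      · left; omega
    · refine ⟨φ, 2 * p + 1, fun _ _ => rfl, ?_, ?_, ?_⟩
      · have : max n ((2 * p + 1) / 2 + 1) = n := by omega
        rw [this]; exact h
      · have : (2 * p + 1) / 2 = p := by omega
        rw [this, if_neg (by omega)]
        refine Prod.ext e ?_
        change (!(φ p).2) = a.2
        cases h1 : (φ p).2 <;> cases h2 : a.2 <;> simp_all
      · left; omega
  · push Not at hp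
    refine ⟨Function.update φ n a, 2 * n, ?_, ?_, ?_, Or.inr rfl⟩
    · intro p hp
      exact Function.update_of_ne (by omega) _ _
    · have : max n (2 * n / 2 + 1) = n + 1 := by omega
      rw [this]
      intro p q hp' hq' e
      by_cases h1 : p = n <;> by_cases h2 : q = n
      · omega
      · subst h1
        rw [Function.update_self, Function.update_of_ne h2] at e
        exact absurd e.symm (hp q (by omega))
      · subst h2
        rw [Function.update_self, Function.update_of_ne h1] at e
        exact absurd e (hp p (by omega))
      · rw [Function.update_of_ne h2, Function.update_of_ne h1] at e
        exact h p q (by omega) (by omega) e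
    · have : 2 * n / 2 = n := by omega
      rw [this, if_pos (by omega), Function.update_self]

theorem ext_word {φ : Fin 6 → ℕ → Lt} {n : W6} (h : Inj φ n) (u : Wd) :
    ∃ (φ' : Fin 6 → ℕ → Lt) (k : W6), (∀ i, ∀ p < n.get i, φ' i p = φ i p) ∧
      Inj φ' (bump n k) ∧ rhoW φ' k = u ∧ ∀ i, k.get i / 2 < n.get i ∨ k.get i = 2 * n.get i := by
  choose ψ c h1 h2 h3 h4 using fun i => ext_one (n.get i) (φ i) (h i) (u i)
  refine ⟨ψ, ofFn c, h1, ?_, ?_, ?_⟩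
  · intro i p q
    rw [bump_get, get_ofFn]
    exact h2 i p q
  · funext i
    unfold rhoW rho
    rw [get_ofFn]
    exact h3 i
  · intro i
    rw [get_ofFn]; exact h4 i

theorem rhoW_congr {φ φ' : Fin 6 → ℕ → Lt} {n k : W6} (h : ∀ i, ∀ p < n.get i, φ' i p = φ i p)
    (hk : Lo n k) : rhoW φ' k = rhoW φ k := by
  funext i
  unfold rhoW rho
  rw [h i _ (hk i)]

theorem Lo_bump {n k x : W6} (h : Lo n x) : Lo (bump n k) x := fun i => by
  rw [bump_get]; exact lt_of_lt_of_le (h i) (le_max_left _ _)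

theorem Lo_bump_self (n k : W6) : Lo (bump n k) k := fun i => by
  rw [bump_get]; exact lt_of_lt_of_le (Nat.lt_succ_self _) (le_max_right _ _)

theorem mem_add_side {st : St} {s t : Bool} {k x : W6} :
    x ∈ (st.add s k).side t ↔ (t = s ∧ x = k) ∨ x ∈ st.side t := by
  cases s <;> cases t <;> simp [St.add, St.side]

theorem add_np (st : St) (s : Bool) (k : W6) : (st.add s k).np = bump st.np k := by
  cases s <;> rfl
theorem add_cap (st : St) (s : Bool) (k : W6) : (st.add s k).cap = st.cap := by
  cases s <;> rfl
theorem add_dbl (st : St) (s : Bool) (k : W6) : (st.add s k).dbl = st.dbl := by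
  cases s <;> rfl
theorem add_nodup {st : St} {s t : Bool} {k : W6} (h : (st.side t).Nodup)
    (hk : k ∉ st.side s) : ((st.add s k).side t).Nodup := by
  cases s <;> cases t <;> simp_all [St.add, St.side]

/-- Adding an unknown actual word to a realized state. -/
theorem Rlz.new {F : Bool → Finset Wd} {d : ℕ} (H : Hyp F d) {st : St} {φ : Fin 6 → ℕ → Lt}
    (R : Rlz F st φ) {s : Bool} {u : Wd} (hu : u ∈ F s) (hnew : ∀ k ∈ st.side s, rhoW φ k ≠ u) :
    ∃ (φ' : Fin 6 → ℕ → Lt) (k : W6), (∀ i, ∀ p < st.np.get i, φ' i p = φ i p) ∧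
      Inj φ' (bump st.np k) ∧ rhoW φ' k = u ∧
      (∀ i, k.get i / 2 < st.np.get i ∨ k.get i = 2 * st.np.get i) ∧
      Rlz F (st.add s k) φ' ∧ (∀ x ∈ st.side s, sepB x k = true) ∧ okB d st s k = true := by
  obtain ⟨φ', k, h1, h2, h3, h4⟩ := ext_word R.inj u
  have hc : ∀ t, ∀ x ∈ st.side t, rhoW φ' x = rhoW φ x := fun t x hx => rhoW_congr h1 (R.lo t x hx)
  have hl : ∀ t, ∀ x ∈ st.side t, Lo (bump st.np k) x := fun t x hx => Lo_bump (R.lo t x hx)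
  have hk : Lo (bump st.np k) k := Lo_bump_self _ _
  have hkn : k ∉ st.side s := fun h => hnew k h (by rw [← hc s k h, h3])
  refine ⟨φ', k, h1, h2, h3, h4, ?_, ?_, ?_⟩
  · refine ⟨by rwa [add_np], ?_, ?_, fun t => add_nodup (R.nodup t) hkn, ?_, ?_⟩
    · intro t x hx
      rw [add_np]
      rcases mem_add_side.1 hx with ⟨_, rfl⟩ | hx
      · exact hk
      · exact hl t x hx
    · intro t x hx
      rcases mem_add_side.1 hx with ⟨rfl, rfl⟩ | hx
      · rw [h3]; exact hu
      · rw [hc t x hx]; exact R.mem t x hx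
    · intro c hcc
      rw [add_cap] at hcc
      obtain ⟨a1, a2, i, a3, a4⟩ := R.cap c hcc
      refine ⟨mem_add_side.2 (Or.inr a1), mem_add_side.2 (Or.inr a2), i, a3, ?_⟩
      rw [hc _ _ a1, hc _ _ a2]; exact a4
    · intro c hcc
      rw [add_dbl] at hcc
      obtain ⟨a1, i, a3, a4⟩ := R.dbl c hcc
      refine ⟨mem_add_side.2 (Or.inr a1), i, a3, ?_⟩
      rw [hc _ _ a1]; exact a4
  · intro x hx
    rw [sepB_iff h2 (hl s x hx) hk, h3, hc s x hx]
    exact H.sep s _ (R.mem s x hx) _ hu (hnew x hx)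
  · unfold okB
    simp only [an_eq, orr_eq, nt_eq, Bool.and_eq_true, Bool.or_eq_true, allL_iff, ble_iff]
    refine ⟨?_, ?_, ?_⟩
    · intro x hx
      rw [distB_eq h2 (hl s x hx) hk, h3, hc s x hx]
      obtain ⟨i, hi⟩ := H.sep s _ (R.mem s x hx) _ hu (hnew x hx)
      obtain ⟨j, hj, hj'⟩ := H.notwin s _ (R.mem s x hx) _ hu i hi
      apply Finset.one_lt_card.2
      exact ⟨j, by simpa using hj', i, by simpa using opp_ne hi, hj⟩
    · intro x hx
      rw [sepB_iff h2 (hl _ x hx) hk, distB_eq h2 (hl _ x hx) hk, h3, hc _ x hx]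
      by_cases hs : Sep (rhoW φ x) u
      · exact Or.inl hs
      · refine Or.inr ⟨?_, H.dist s _ (R.mem _ x hx) _ hu hs⟩
        have hne : rhoW φ x ≠ u := fun e => H.disj s u hu (e ▸ R.mem _ x hx)
        obtain ⟨i, hi⟩ := Function.ne_iff.1 hne
        apply Finset.card_pos.2
        exact ⟨i, by simpa using hi⟩
    · intro c hcc
      obtain ⟨a1, a2, i, a3, a4⟩ := R.cap c hcc
      unfold capOk
      rw [← a3]
      cases e : eqb s c.s with
      | true =>
        have e' : s = c.s := (eqb_eq _ _).1 e
        simp only [nt_eq, Bool.not_eq_true', ← Bool.not_eq_true]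
        rw [exSep_iff h2 (hl _ _ a1) hk, h3, hc _ _ a1]
        intro hG
        rw [e'] at hu hnew
        exact hnew _ a2 (a4 u hu hG).symm
      | false =>
        have e' : (!c.s) = s := by
          have : ¬ s = c.s := fun h => by rw [(eqb_eq _ _).2 h] at e; cases e
          revert this
          cases s <;> cases c.s <;> simp
        simp only [nt_eq, orr_eq, Bool.or_eq_true, Bool.not_eq_true', ← Bool.not_eq_true]
        rw [difAt_iff h2 (hl _ _ a1) hk, sepB_iff h2 (hl _ _ a1) hk,
          between_iff h2 (hl _ _ a1) hk (hl _ _ a2), h3, hc _ _ a1, hc _ _ a2]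
        by_cases hd : rhoW φ c.v i = u i
        · left; simpa using hd
        · right
          by_cases hs : Sep (rhoW φ c.v) u
          · exact Or.inl hs
          · right
            intro j hj
            exact G_unique H (R.mem _ _ a1) (by rw [e']; exact hu) hs hd a4 j hj

end KD7

namespace KD7

theorem rho_snd_iff (φ : Fin 6 → ℕ → Lt) (i : Fin 6) {a b : ℕ} (h : a / 2 = b / 2) :
    (rho φ i a).2 = (rho φ i b).2 ↔ a % 2 = b % 2 := by
  unfold rho
  rw [h]
  rcases Nat.mod_two_eq_zero_or_one a with h1 | h1 <;>
  rcases Nat.mod_two_eq_zero_or_one b with h2 | h2 <;> simp [h1, h2, fl]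

theorem exists_pt {φ : Fin 6 → ℕ → Lt} {n : W6} (h : Inj φ n) (m : W6) :
    ∃ Y : Fin 6 → ℝ → Bool, ∀ i c, c / 2 < n.get i →
      (Y i (rho φ i c).1 = (rho φ i c).2 ↔ c = 2 * (c / 2) + tn (tb (m.get i) (c / 2))) := by
  classical
  refine ⟨fun i q => if h : ∃ p, p < n.get i ∧ (φ i p).1 = q then
    (rho φ i (2 * h.choose + tn (tb (m.get i) h.choose))).2 else false, ?_⟩
  intro i c hc
  have hex : ∃ p, p < n.get i ∧ (φ i p).1 = (rho φ i c).1 := ⟨c / 2, hc, (rho_fst _ _ _).symm⟩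
  simp only [hex, dif_pos]
  have hp := hex.choose_spec
  generalize hex.choose = p at hp
  have hpe : p = c / 2 := h i _ _ hp.1 hc (by rw [hp.2, rho_fst])
  have ht : tn (tb (m.get i) (c / 2)) = 0 ∨ tn (tb (m.get i) (c / 2)) = 1 := by
    rw [tn_eq]; split <;> simp
  rw [hpe, rho_snd_iff]
  · omega
  · omega

theorem inPt_iff {φ : Fin 6 → ℕ → Lt} {n m : W6} {Y : Fin 6 → ℝ → Bool}
    (hY : ∀ i c, c / 2 < n.get i →
      (Y i (rho φ i c).1 = (rho φ i c).2 ↔ c = 2 * (c / 2) + tn (tb (m.get i) (c / 2))))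
    {k : W6} (hk : Lo n k) : inPt m k = true ↔ inW Y (rhoW φ k) := by
  unfold inPt inW rhoW
  rw [all6_iff]
  refine forall_congr' fun i => ?_
  rw [hY i _ (hk i), inPt1, eqb_eq]
  have h0 : tb (k.get i) 0 = decide (k.get i % 2 = 1) := by
    rw [tb_eq, Nat.testBit_zero]
  rw [h0]
  change tb (m.get i) (k.get i / 2) = _ ↔ _
  cases tb (m.get i) (k.get i / 2) <;> simp [tn] <;> omega

theorem pointR_sound {F : Bool → Finset Wd} {d : ℕ} (H : Hyp F d)
    {f : St → List ℕ → Option (List ℕ)}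
    (hf : ∀ st c c', f st c = some c' → ∀ φ, ¬ Rlz F st φ) (st : St) (s : Bool) (k : ℕ)
    (c c' : List ℕ) (h : pointR d f st s k c = some c') (φ : Fin 6 → ℕ → Lt) : ¬ Rlz F st φ := by
  intro R
  unfold pointR at h
  split at h
  · cases h
  rename_i w hw
  have hw := List.mem_of_getElem? hw
  split at h
  swap
  · cases h
  rename_i m0 m1 m2 m3 m4 m5 c
  split at h
  swap
  · cases h
  rename_i hc
  rw [an_eq, Bool.and_eq_true, allL_iff] at hc
  rw [nt_eq] at hw
  obtain ⟨hc1, hc2⟩ := hc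
  obtain ⟨Y, hY⟩ := exists_pt R.inj ⟨m0, m1, m2, m3, m4, m5⟩
  have hwY := (inPt_iff hY (R.lo _ _ hw)).1 hc1
  obtain ⟨u, hu, huY⟩ := H.cov s _ (R.mem _ _ hw) Y hwY
  have hnew : ∀ k ∈ st.side s, rhoW φ k ≠ u := by
    rintro k hk rfl
    have := hc2 k hk
    rw [(inPt_iff hY (R.lo _ _ hk)).2 huY] at this
    cases this
  obtain ⟨φ', k, h1, h2, h3, h4, h5, h6, h7⟩ := R.new H hu hnew
  have hk : ∀ i : Fin 6, k.get i ∈ ptO (W6.get ⟨m0, m1, m2, m3, m4, m5⟩ i) (st.np.get i) := by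
    intro i
    apply mem_ptO
    rcases h4 i with h | h
    · right
      refine ⟨k.get i / 2, h, ?_⟩
      rw [← hY i _ h]
      have e : rho φ i (k.get i) = u i := by
        rw [← h3]
        unfold rhoW rho
        rw [h1 i _ h]
      rw [e]; exact huY i
    · exact Or.inl h
  obtain ⟨e, e', he⟩ := runKids_spec d st s (fun _ => f) _ k
    (mem_genW _ _ _ _ _ _ (st.side s) k (hk 0) (hk 1) (hk 2) (hk 3) (hk 4) (hk 5) h6) h7 c c' h
  exact hf _ _ _ he φ' h5

theorem mem_Xof {F : Bool → Finset Wd} {st : St} {φ : Fin 6 → ℕ → Lt} (R : Rlz F st φ)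
    {s : Bool} {v : W6} (hv : v ∈ st.side s) (i : Fin 6) (x : W6) :
    x ∈ Xof st s v i.1 ↔ x ∈ st.side (!s) ∧ rhoW φ v i ≠ rhoW φ x i ∧
      ¬ Sep (rhoW φ v) (rhoW φ x) := by
  unfold Xof
  rw [mem_filterL, nt_eq, an_eq, Bool.and_eq_true]
  refine and_congr_right fun hx => ?_
  rw [difAt_iff R.inj (R.lo _ _ hv) (R.lo _ _ hx), nt_eq, Bool.not_eq_true', ← Bool.not_eq_true,
    sepB_iff R.inj (R.lo _ _ hv) (R.lo _ _ hx)]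

theorem singleR_sound {F : Bool → Finset Wd} {d : ℕ} (H : Hyp F d)
    {f : St → List ℕ → Option (List ℕ)}
    (hf : ∀ st c c', f st c = some c' → ∀ φ, ¬ Rlz F st φ) (st : St) (s : Bool) (k : ℕ)
    (c c' : List ℕ) (h : singleR d f st s k c = some c') (φ : Fin 6 → ℕ → Lt) : ¬ Rlz F st φ := by
  intro R
  unfold singleR at h
  split at h
  · cases h
  rename_i v hv
  have hv := List.mem_of_getElem? hv
  split at h
  · cases h
  rename_i i0 c
  split at h
  swap
  · cases h
  rename_i hc
  rw [an_eq, Bool.and_eq_true, allL_iff, ble_iff] at hc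
  obtain ⟨hi0, hc2⟩ := hc
  obtain ⟨i, rfl⟩ : ∃ i : Fin 6, i.1 = i0 := ⟨⟨i0, by omega⟩, rfl⟩
  split at h
  · cases h
  rename_i x X hX
  split at h
  · cases h
  rename_i c2 hkids
  have hXm : ∀ y ∈ x :: X, y ∈ st.side (!s) ∧ rhoW φ v i ≠ rhoW φ y i ∧
      ¬ Sep (rhoW φ v) (rhoW φ y) := fun y hy => (mem_Xof R hv i y).1 (by rw [hX]; exact hy)
  have hvF := R.mem _ _ hv
  obtain ⟨hx1, hx2, hx3⟩ := hXm x List.mem_cons_self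
  obtain ⟨u, hu, hG⟩ := G_nonempty H hvF (R.mem _ _ hx1) hx3 hx2
  by_cases huniq : ∀ y ∈ F s, G i (rhoW φ v) y → y = u
  · have hnew : ∀ k ∈ st.side s, rhoW φ k ≠ u := by
      rintro k hk rfl
      have := hc2 k hk
      rw [(exSep_iff R.inj (R.lo _ _ hv) (R.lo _ _ hk) i).2 hG] at this
      cases this
    obtain ⟨φ', k, h1, h2, h3, h4, h5, h6, h7⟩ := R.new H hu hnew
    have hlk : Lo (bump st.np k) k := Lo_bump_self _ _
    have hlv : Lo (bump st.np k) v := Lo_bump (R.lo _ _ hv)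
    have hcv : rhoW φ' v = rhoW φ v := rhoW_congr h1 (R.lo _ _ hv)
    have hk : ∀ j : Fin 6, k.get j ∈ sgO i.1 j.1 (v.get j) (x.get j) (X.map fun w => w.get j) := by
      intro j
      apply mem_sgO
      · intro e
        have e : j = i := Fin.ext e
        subst e
        have := (hG j).2 rfl
        rw [opp_iff, ← h3, ← hcv] at this
        change rho φ' j _ = fl (rho φ' j _) at this
        rw [← rho_xor] at this
        exact (rho_inj h2 (hlk j) (by rw [xor_one_div]; exact hlv j)).1 this
      · intro e
        have e : j ≠ i := fun h => e (congrArg Fin.val h)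
        by_cases hkv : k.get j = v.get j
        · exact Or.inl hkv
        · right
          have key : ∀ y ∈ x :: X, k.get j = y.get j := by
            intro y hy
            obtain ⟨hy1, hy2, hy3⟩ := hXm y hy
            rcases G_unique H hvF (R.mem _ _ hy1) hy3 hy2 huniq j e with h | h
            · rw [← h3, ← hcv] at h
              exact absurd ((rho_inj h2 (hlk j) (hlv j)).1 h) hkv
            · rw [← h3, ← rhoW_congr h1 (R.lo _ _ hy1)] at h
              exact (rho_inj h2 (hlk j) (Lo_bump (R.lo _ _ hy1) j)).1 h
          refine ⟨key x List.mem_cons_self, ?_⟩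
          intro y hy
          obtain ⟨w, hw, rfl⟩ := List.mem_map.1 hy
          exact key w (List.mem_cons_of_mem _ hw)
    obtain ⟨e, e', he⟩ := runKids_spec d st s _ _ k
      (mem_genW _ _ _ _ _ _ (st.side s) k (hk 0) (hk 1) (hk 2) (hk 3) (hk 4) (hk 5) h6) h7 _ _ hkids
    refine hf _ _ _ he φ' ?_
    refine ⟨h5.inj, fun t => ?_, fun t => ?_, fun t => ?_, ?_, ?_⟩
    · have := h5.lo t; cases t <;> exact this
    · have := h5.mem t; cases t <;> exact this
    · have := h5.nodup t; cases t <;> exact this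
    · intro cc hcc
      rcases List.mem_cons.1 hcc with rfl | hcc
      · have a1 : v ∈ (st.add s k).side s := mem_add_side.2 (Or.inr hv)
        have a2 : k ∈ (st.add s k).side s := mem_add_side.2 (Or.inl ⟨rfl, rfl⟩)
        refine ⟨by cases s <;> exact a1, by cases s <;> exact a2, i, rfl, ?_⟩
        simp only
        rw [hcv, h3]; exact huniq
      · obtain ⟨a1, a2, a3⟩ := h5.cap cc hcc
        refine ⟨?_, ?_, a3⟩
        · cases h : cc.s <;> rw [h] at a1 <;> exact a1
        · cases h : cc.s <;> rw [h] at a2 <;> exact a2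
    · intro cc hcc
      obtain ⟨a1, a3⟩ := h5.dbl cc hcc
      refine ⟨?_, a3⟩
      cases h : cc.s <;> rw [h] at a1 <;> exact a1
  · push Not at huniq
    obtain ⟨y, hy, hGy, hyu⟩ := huniq
    refine hf _ _ _ h φ ?_
    refine ⟨R.inj, fun t => ?_, fun t => ?_, fun t => ?_, ?_, ?_⟩
    · have := R.lo t; cases t <;> exact this
    · have := R.mem t; cases t <;> exact this
    · have := R.nodup t; cases t <;> exact this
    · intro cc hcc
      obtain ⟨a1, a2, a3⟩ := R.cap cc hcc
      refine ⟨?_, ?_, a3⟩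
      · cases h : cc.s <;> rw [h] at a1 <;> exact a1
      · cases h : cc.s <;> rw [h] at a2 <;> exact a2
    · intro cc hcc
      rcases List.mem_cons.1 hcc with rfl | hcc
      · exact ⟨by cases s <;> exact hv, i, rfl, y, hy, u, hu, hyu, hGy, hG⟩
      · obtain ⟨a1, a3⟩ := R.dbl cc hcc
        refine ⟨?_, a3⟩
        cases h : cc.s <;> rw [h] at a1 <;> exact a1

open Classical in
theorem card_ge (A : Finset Wd) (v : Wd) (hv : v ∈ A) :
    1 + ((A.filter fun x => 2 ≤ (Finset.univ.filter fun i => opp (v i) (x i)).card).card +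
      ∑ i, (A.filter fun x => G i v x).card) ≤ A.card := by
  have h1 : (A.filter fun x => x = v).card = 1 := by
    rw [Finset.filter_eq' A v, if_pos hv]; simp
  rw [← h1]
  rw [Finset.card_filter (fun x => x = v) A,
    Finset.card_filter (fun x => 2 ≤ (Finset.univ.filter fun i => opp (v i) (x i)).card) A,
    Finset.card_eq_sum_ones A]
  have h2 : ∑ i, (A.filter fun x => G i v x).card =
      ∑ x ∈ A, ∑ i, (if G i v x then 1 else 0) := by
    rw [Finset.sum_comm]
    apply Finset.sum_congr rfl
    intro i _
    rw [Finset.card_filter]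
  rw [h2, ← Finset.sum_add_distrib, ← Finset.sum_add_distrib]
  apply Finset.sum_le_sum
  intro x _
  have hG : ∀ i, G i v x → (Finset.univ.filter fun i => opp (v i) (x i)) = {i} := by
    intro i hi; ext j; simp [hi j]
  by_cases hex : ∃ i, G i v x
  · obtain ⟨i, hi⟩ := hex
    have e1 : x ≠ v := by
      rintro rfl
      exact opp_ne ((hi i).2 rfl) rfl
    have e2 : ¬ 2 ≤ (Finset.univ.filter fun i => opp (v i) (x i)).card := by
      rw [hG i hi]; simp
    rw [if_neg e1, if_neg e2]
    have : ∀ j, G j v x ↔ j = i := by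
      intro j
      constructor
      · intro hj
        have := (hG i hi).symm.trans (hG j hj)
        exact (Finset.singleton_injective this).symm
      · rintro rfl; exact hi
    simp [this]
  · push Not at hex
    have : ∑ i, (if G i v x then 1 else 0) = 0 := by
      apply Finset.sum_eq_zero
      intro i _; rw [if_neg (hex i)]
    rw [this]
    by_cases e1 : x = v
    · subst e1
      have : (Finset.univ.filter fun i => opp (x i) (x i)) = ∅ := by
        ext j; simp [opp]
      rw [this]; simp
    · rw [if_neg e1]; split <;> simp

open Classical in
theorem cnt_le {F : Bool → Finset Wd} {st : St} {φ : Fin 6 → ℕ → Lt} (R : Rlz F st φ)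
    (s : Bool) (p : W6 → Bool) (Q : Wd → Prop)
    (h : ∀ k ∈ st.side s, p k = true → Q (rhoW φ k)) :
    cnt p (st.side s) ≤ ((F s).filter Q).card := by
  rw [cnt_eq]
  have hn : (((st.side s).filter p).map (rhoW φ)).Nodup := by
    apply List.Nodup.map_on
    · intro a ha b hb e
      exact rhoW_inj R.inj (R.lo s _ (List.mem_filter.1 ha).1) (R.lo s _ (List.mem_filter.1 hb).1) e
    · exact (R.nodup s).filter p
  rw [← List.length_map (rhoW φ), ← List.toFinset_card_of_nodup hn]
  apply Finset.card_le_card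
  intro y hy
  rw [List.mem_toFinset, List.mem_map] at hy
  obtain ⟨k, hk, rfl⟩ := hy
  have := List.mem_filter.1 hk
  exact Finset.mem_filter.2 ⟨R.mem s k this.1, h k this.1 this.2⟩

open Classical in
theorem gBound_le {F : Bool → Finset Wd} {d : ℕ} (H : Hyp F d) {st : St} {φ : Fin 6 → ℕ → Lt}
    (R : Rlz F st φ) {s : Bool} {v : W6} (hv : v ∈ st.side s) (i : Fin 6) :
    gBound st s v i.1 ≤ ((F s).filter fun x => G i (rhoW φ v) x).card := by
  unfold gBound
  rw [mx_eq]
  apply max_le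
  · exact cnt_le R s _ _ fun k hk h => (exSep_iff R.inj (R.lo _ _ hv) (R.lo _ _ hk) i).1 h
  · split
    · rename_i hd
      unfold dblAt at hd
      rw [anyL_iff] at hd
      obtain ⟨c, hc, hc'⟩ := hd
      simp only [an_eq, Bool.and_eq_true, eqb_eq, beq_iff, eqW_iff] at hc'
      obtain ⟨e1, e2, e3⟩ := hc'
      obtain ⟨_, j, hj, x, hx, y, hy, hxy, hGx, hGy⟩ := R.dbl c hc
      have hji : j = i := Fin.ext (by omega)
      subst hji
      rw [e1] at hx hy
      rw [e3] at hGx hGy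
      apply Finset.one_lt_card.2
      exact ⟨x, Finset.mem_filter.2 ⟨hx, hGx⟩, y, Finset.mem_filter.2 ⟨hy, hGy⟩, hxy⟩
    · split
      · exact Nat.zero_le _
      · rename_i hX
        obtain ⟨x, hx⟩ := List.exists_mem_of_ne_nil _ hX
        obtain ⟨h1, h2, h3⟩ := (mem_Xof R hv i x).1 hx
        obtain ⟨y, hy, hG⟩ := G_nonempty H (R.mem _ _ hv) (R.mem _ _ h1) h3 h2
        exact Finset.card_pos.2 ⟨y, Finset.mem_filter.2 ⟨hy, hG⟩⟩

theorem leafR_sound {F : Bool → Finset Wd} {d : ℕ} (H : Hyp F d) (st : St) (s : Bool) (k : ℕ)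
    (c c' : List ℕ) (h : leafR st s k c = some c') (φ : Fin 6 → ℕ → Lt) : ¬ Rlz F st φ := by
  classical
  intro R
  unfold leafR at h
  split at h
  · cases h
  rename_i v hv
  have hv := List.mem_of_getElem? hv
  split at h
  swap
  · cases h
  rename_i hl
  unfold leafB at hl
  rw [ble_iff] at hl
  change 10 ≤ (_ + (_ + (_ + (_ + (_ + (_ + _))))) : ℕ) at hl
  have h1 := card_ge (F s) (rhoW φ v) (R.mem _ _ hv)
  have h2 := H.card s
  have h3 := cnt_le R s (fun u => Nat.ble 2 (sepCnt v u))
    (fun x => 2 ≤ (Finset.univ.filter fun i => opp (rhoW φ v i) (x i)).card) (by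
      intro k hk hh
      rw [ble_iff, sepCnt_eq R.inj (R.lo _ _ hv) (R.lo _ _ hk)] at hh
      exact hh)
  rw [Fin.sum_univ_six] at h1
  rw [Finset.filter_congr_decidable] at h3
  have g := fun i => gBound_le H R hv i
  have g0 := g 0
  have g1 := g 1
  have g2 := g 2
  have g3 := g 3
  have g4 := g 4
  have g5 := g 5
  change gBound st s v 0 ≤ _ at g0
  change gBound st s v 1 ≤ _ at g1
  change gBound st s v 2 ≤ _ at g2
  change gBound st s v 3 ≤ _ at g3
  change gBound st s v 4 ≤ _ at g4
  change gBound st s v 5 ≤ _ at g5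
  omega

theorem check_sound {F : Bool → Finset Wd} {d : ℕ} (H : Hyp F d) (fuel : ℕ) :
    ∀ (st : St) (c c' : List ℕ), check d fuel st c = some c' → ∀ φ, ¬ Rlz F st φ := by
  induction fuel with
  | zero => intro st c c' h; simp [check] at h
  | succ n ih =>
    intro st c c' h φ
    match c with
    | [] => simp [check] at h
    | [_] => simp [check] at h
    | code :: k :: c =>
      unfold check at h
      split at h
      · exact leafR_sound H _ _ _ _ _ h φ
      · exact leafR_sound H _ _ _ _ _ h φ
      · exact pointR_sound H ih _ _ _ _ _ h φ
      · exact pointR_sound H ih _ _ _ _ _ h φ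
      · exact singleR_sound H ih _ _ _ _ _ h φ
      · exact singleR_sound H ih _ _ _ _ _ h φ
      · cases h

theorem rootOk_sound {F : Bool → Finset Wd} {d : ℕ} (H : Hyp F d) (g : W6) (cert : List ℕ)
    (h : rootOk d g cert = true) (φ : Fin 6 → ℕ → Lt) : ¬ Rlz F (rootSt g) φ := by
  unfold rootOk at h
  simp only [W6.force_eq] at h
  cases hc : check d 60 (rootSt g) cert with
  | none =>
    have : isSomeB (check d 60 (rootSt g) cert) = true := h
    rw [hc] at this; cases this
  | some c => exact check_sound H 60 _ _ _ hc φ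

end KD7

namespace KD7

theorem exists_odd {F : Bool → Finset Wd} {d : ℕ} (H : Hyp F d) {s : Bool} {v w : Wd}
    (hv : v ∈ F s) (hw : w ∈ F (!s)) (hs : ¬ Sep w v)
    (hd : (Finset.univ.filter fun i => w i ≠ v i).card = d) :
    ∃ v' ∈ F s, ∃ e : Finset (Fin 6), (∀ i ∈ e, w i ≠ v i) ∧ Odd e.card ∧ 3 ≤ e.card ∧
      ∀ i, v' i = if i ∈ e then fl (v i) else v i := by
  classical
  set D := Finset.univ.filter fun i => w i ≠ v i with hD
  have memD : ∀ i, i ∈ D ↔ w i ≠ v i := fun i => by simp [hD]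
  have hpair : ∀ i, w i ≠ v i → (w i).1 ≠ (v i).1 := by
    intro i hi h
    apply hs
    refine ⟨i, h, fun h2 => hi (Prod.ext h h2)⟩
  let Y : Finset (Fin 6) → Fin 6 → ℝ → Bool := fun e i q =>
    if q = (w i).1 then (w i).2 else if q = (v i).1 then (if i ∈ e then !(v i).2 else (v i).2)
      else true
  have hYw : ∀ e, inW (Y e) w := fun e i => by simp [Y]
  have hcov : ∀ e, ∃ u ∈ F s, inW (Y e) u := fun e => H.cov s w hw _ (hYw e)
  choose u hu hYu using hcov
  have huniq : ∀ e, ∀ x ∈ F s, inW (Y e) x → x = u e := by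
    intro e x hx hxY
    by_contra hne
    obtain ⟨i, h1, h2⟩ := H.sep s x hx (u e) (hu e) hne
    apply h2
    rw [← hxY i, ← hYu e i, h1]
  have hYv : ∀ e, ∀ i, w i ≠ v i → Y e i (v i).1 = if i ∈ e then !(v i).2 else (v i).2 := by
    intro e i hi
    have := hpair i hi
    simp [Y, this.symm]
  have hoff : ∀ i, ¬ w i ≠ v i → w i = v i := fun i h => not_not.1 h
  have hu0 : u ∅ = v := by
    refine (huniq ∅ v hv fun i => ?_).symm
    by_cases hi : w i ≠ v i
    · rw [hYv _ i hi]; simp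
    · rw [← hoff i hi]; exact hYw ∅ i
  have hne : D.Nonempty := by
    by_contra h
    have : w = v := by
      funext i
      by_contra hi
      exact h ⟨i, (memD i).2 hi⟩
    rw [this] at hw
    exact H.disj s v hv hw
  have hsum := Finset.sum_powerset_neg_one_pow_card_of_nonempty hne
  let good : Finset (Fin 6) → Prop := fun e => ∀ i ∈ D, (u e i).1 = (v i).1
  rw [← Finset.sum_filter_add_sum_filter_not D.powerset good] at hsum
  have hbad : ∑ e ∈ D.powerset with ¬ good e, (-1 : ℤ) ^ e.card = 0 := by
    have hex : ∀ e, ∃ i, ¬ good e → i ∈ D ∧ (u e i).1 ≠ (v i).1 := by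
      intro e
      by_cases h : good e
      · exact ⟨0, fun h' => absurd h h'⟩
      · have h' := h
        simp only [good] at h'
        push Not at h'
        obtain ⟨i, h1, h2⟩ := h'
        exact ⟨i, fun _ => ⟨h1, h2⟩⟩
    have key : ∀ e i, i ∈ D → (u e i).1 ≠ (v i).1 → u (symmDiff e {i}) = u e := by
      intro e i hi hne
      refine (huniq _ _ (hu e) fun j => ?_).symm
      rw [← hYu e j]
      simp only [Y]
      split
      · rfl
      split
      · rename_i h1 h2
        have : j ≠ i := by rintro rfl; exact hne h2
        simp [Finset.mem_symmDiff, this]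
      · rfl
    -- a choice of coordinate that only depends on the covering word
    let c : Wd → Fin 6 := fun x => if h : ∃ i, i ∈ D ∧ (x i).1 ≠ (v i).1 then h.choose else 0
    have hc : ∀ e, ¬ good e → c (u e) ∈ D ∧ (u e (c (u e))).1 ≠ (v (c (u e))).1 := by
      intro e he
      have : ∃ i, i ∈ D ∧ (u e i).1 ≠ (v i).1 := by
        obtain ⟨i, hi⟩ := hex e
        exact ⟨i, hi he⟩
      simp only [c, dif_pos this]
      exact this.choose_spec
    have hinv : ∀ e, ¬ good e → u (symmDiff e {c (u e)}) = u e := fun e he =>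
      key e _ (hc e he).1 (hc e he).2
    refine Finset.sum_involution (fun e _ => symmDiff e {c (u e)}) ?_ ?_ ?_ ?_
    · intro e he
      have he := (Finset.mem_filter.1 he).2
      by_cases hm : c (u e) ∈ e
      · have : symmDiff e {c (u e)} = e.erase (c (u e)) := by
          ext j; simp [Finset.mem_symmDiff]
          by_cases h : j = c (u e) <;> simp [h, hm]
        rw [this, ← Finset.insert_erase hm, Finset.card_insert_of_notMem (Finset.notMem_erase _ _),
          Finset.insert_erase hm]
        ring
      · have : symmDiff e {c (u e)} = insert (c (u e)) e := by
          ext j; simp [Finset.mem_symmDiff]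
          by_cases h : j = c (u e) <;> simp [h, hm]
        rw [this, Finset.card_insert_of_notMem hm]
        ring
    · intro e he _ h
      have := congrArg (fun z => symmDiff e z) h
      simp at this
    · intro e he
      obtain ⟨h1, h2⟩ := Finset.mem_filter.1 he
      refine Finset.mem_filter.2 ⟨?_, ?_⟩
      · rw [Finset.mem_powerset] at h1 ⊢
        intro j hj
        rw [Finset.mem_symmDiff] at hj
        rcases hj with hj | hj
        · exact h1 hj.1
        · rw [Finset.mem_singleton.1 hj.1]; exact (hc e h2).1
      · simp only [good] at h2 ⊢
        rw [hinv e h2]; exact h2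
    · intro e he
      have he := (Finset.mem_filter.1 he).2
      simp only [hinv e he]
      simp
  rw [hbad, add_zero] at hsum
  have hodd : ∃ e ∈ D.powerset, good e ∧ Odd e.card := by
    by_contra hcon
    push Not at hcon
    have : (0 : ℤ) < ∑ e ∈ D.powerset with good e, (-1 : ℤ) ^ e.card := by
      apply Finset.sum_pos
      · intro e he
        obtain ⟨h1, h2⟩ := Finset.mem_filter.1 he
        have := Nat.not_odd_iff_even.1 (hcon e h1 h2)
        rw [this.neg_one_pow]; norm_num
      · refine ⟨∅, Finset.mem_filter.2 ⟨by simp, ?_⟩⟩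
        intro i _
        rw [hu0]
    omega
  obtain ⟨e, heD, hg, ho⟩ := hodd
  rw [Finset.mem_powerset] at heD
  have hns : ¬ Sep w (u e) := by
    rintro ⟨i, h1, h2⟩
    apply h2
    rw [← hYw e i, ← hYu e i, h1]
  have hsub : D ⊆ Finset.univ.filter fun i => w i ≠ u e i := by
    intro i hi
    rw [Finset.mem_filter]
    refine ⟨Finset.mem_univ _, fun h => ?_⟩
    apply hpair i ((memD i).1 hi)
    rw [h]; exact hg i hi
  have heq := Finset.eq_of_subset_of_card_le hsub (by rw [hd]; exact H.dist s w hw _ (hu e) hns)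
  have hform : ∀ i, u e i = if i ∈ e then fl (v i) else v i := by
    intro i
    by_cases hi : i ∈ D
    · have h1 := hYu e i
      rw [hg i hi, hYv e i ((memD i).1 hi)] at h1
      have h0 := hg i hi
      split at h1
      · rename_i hie
        rw [if_pos hie]
        exact Prod.ext h0 h1.symm
      · rename_i hie
        rw [if_neg hie]
        exact Prod.ext h0 h1.symm
    · have h1 : i ∉ e := fun h => hi (heD h)
      rw [if_neg h1]
      have h2 := hi
      rw [heq] at h2
      simp only [Finset.mem_filter, Finset.mem_univ, true_and, not_not] at h2
      rw [← h2]
      exact hoff i (fun h => hi ((memD i).2 h))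
  refine ⟨u e, hu e, e, fun i hi => (memD i).1 (heD hi), ho, ?_, hform⟩
  by_contra hlt
  have h1 : e.card = 1 := by
    obtain ⟨k, hk⟩ := ho; omega
  obtain ⟨i, rfl⟩ := Finset.card_eq_one.1 h1
  have hop : opp (v i) (u {i} i) := by
    rw [hform i, opp_iff]; simp
  obtain ⟨j, hj1, hj2⟩ := H.notwin s v hv _ (hu {i}) i hop
  apply hj2
  rw [hform j, if_neg (by simpa using hj1)]

theorem Hyp.swap {F : Bool → Finset Wd} {d : ℕ} (H : Hyp F d) (s : Bool) :
    Hyp (fun b => F (xor b s)) d := by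
  have e : ∀ b, xor (!b) s = !(xor b s) := by cases s <;> decide
  refine ⟨fun b => H.sep _, fun b => H.notwin _, fun b => ?_, fun b => ?_, fun b => ?_,
    fun b => H.card _⟩
  · simp only [e]; exact H.disj _
  · simp only [e]; exact H.cov _
  · simp only [e]; exact H.dist _

open Classical in
theorem Hyp.perm {F : Bool → Finset Wd} {d : ℕ} (H : Hyp F d) (σ : Equiv.Perm (Fin 6)) :
    Hyp (fun b => (F b).image fun u => u ∘ σ) d := by
  have hin : ∀ (Y : Fin 6 → ℝ → Bool) (u : Wd), inW Y (u ∘ σ) ↔ inW (Y ∘ σ.symm) u := by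
    intro Y u
    constructor
    · intro h i
      have := h (σ.symm i)
      simpa using this
    · intro h i
      have := h (σ i)
      simpa using this
  have hinj : ∀ u v : Wd, u ∘ σ = v ∘ σ → u = v := by
    intro u v h
    funext i
    have := congrFun h (σ.symm i)
    simpa using this
  have hsep : ∀ u v : Wd, Sep (u ∘ σ) (v ∘ σ) ↔ Sep u v := by
    intro u v
    constructor
    · rintro ⟨i, h⟩; exact ⟨σ i, h⟩
    · rintro ⟨i, h⟩; exact ⟨σ.symm i, by simpa using h⟩
  refine ⟨?_, ?_, ?_, ?_, ?_, ?_⟩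
  · intro s u hu0 v hv0 hne
    obtain ⟨u, hu, rfl⟩ := Finset.mem_image.1 hu0
    obtain ⟨v, hv, rfl⟩ := Finset.mem_image.1 hv0
    rw [hsep]
    exact H.sep s u hu v hv (by rintro rfl; exact hne rfl)
  · intro s u hu0 v hv0 i hi
    obtain ⟨u, hu, rfl⟩ := Finset.mem_image.1 hu0
    obtain ⟨v, hv, rfl⟩ := Finset.mem_image.1 hv0
    obtain ⟨j, h1, h2⟩ := H.notwin s u hu v hv (σ i) hi
    refine ⟨σ.symm j, ?_, by simpa using h2⟩
    rintro rfl; simp at h1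
  · intro s u hu0 hu'
    obtain ⟨u, hu, rfl⟩ := Finset.mem_image.1 hu0
    obtain ⟨v, hv, e⟩ := Finset.mem_image.1 hu'
    rw [hinj _ _ e] at hv
    exact H.disj s u hu hv
  · intro s u hu0 Y hY
    obtain ⟨u, hu, rfl⟩ := Finset.mem_image.1 hu0
    obtain ⟨v, hv, h⟩ := H.cov s u hu _ ((hin _ _).1 hY)
    exact ⟨_, Finset.mem_image_of_mem _ hv, (hin _ _).2 h⟩
  · intro s u hu0 v hv0 hns
    obtain ⟨u, hu, rfl⟩ := Finset.mem_image.1 hu0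
    obtain ⟨v, hv, rfl⟩ := Finset.mem_image.1 hv0
    rw [hsep] at hns
    refine le_trans (le_of_eq ?_) (H.dist s u hu v hv hns)
    rw [Finset.card_filter, Finset.card_filter]
    exact Equiv.sum_comp σ (fun i => if u i ≠ v i then 1 else 0)
  · intro s
    exact Finset.card_image_le.trans (H.card s)

theorem dispatch : ∀ a0 : Fin 5, ∀ a1 : Fin 5, a0 ≤ a1 → ∀ a2 : Fin 5, a1 ≤ a2 → ∀ a3 : Fin 5,
    a2 ≤ a3 → ∀ a4 : Fin 5, a3 ≤ a4 → ∀ a5 : Fin 5, a4 ≤ a5 →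
    let f : (Fin 5 → Bool) → ℕ := fun p =>
      (p a0).toNat + (p a1).toNat + (p a2).toNat + (p a3).toNat + (p a4).toNat + (p a5).toNat
    let cv := f (fun a => a == 0 || a == 1)
    let cw := f (fun a => a == 1 || a == 2)
    cv % 2 = 1 → cw % 2 = 1 → 3 ≤ cv → 3 ≤ cw → cw ≤ cv →
    (f (fun a => a != 4), a0.1, a1.1, a2.1, a3.1, a4.1, a5.1) ∈
      [(3, 1, 1, 1, 4, 4, 4), (4, 1, 1, 1, 3, 4, 4), (5, 1, 1, 1, 3, 3, 4), (6, 1, 1, 1, 3, 3, 3),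
       (5, 1, 1, 1, 1, 1, 4), (6, 1, 1, 1, 1, 1, 3), (4, 0, 1, 1, 2, 4, 4), (5, 0, 1, 1, 2, 3, 4),
       (6, 0, 1, 1, 2, 3, 3), (6, 0, 1, 1, 1, 1, 2), (5, 0, 0, 1, 2, 2, 4), (6, 0, 0, 1, 2, 2, 3),
       (5, 0, 0, 1, 1, 1, 4), (6, 0, 0, 1, 1, 1, 3), (6, 0, 0, 0, 2, 2, 2),
       (6, 0, 0, 0, 1, 1, 2)] := by
  decide +kernel

theorem sum_toNat (g : Fin 6 → Fin 5) (p : Fin 5 → Bool) (s : Finset (Fin 6))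
    (σ : Equiv.Perm (Fin 6)) (h : ∀ i, i ∈ s ↔ p (g i) = true) :
    (p (g (σ 0))).toNat + (p (g (σ 1))).toNat + (p (g (σ 2))).toNat + (p (g (σ 3))).toNat +
      (p (g (σ 4))).toNat + (p (g (σ 5))).toNat = s.card := by
  have : s = Finset.univ.filter fun i => p (g i) = true := by ext i; simp [h]
  rw [this, Finset.card_filter]
  rw [← Equiv.sum_comp σ, Fin.sum_univ_six]
  have e : ∀ b : Bool, b.toNat = if b = true then 1 else 0 := by decide
  simp only [e]

theorem root_real {F : Bool → Finset Wd} {v w v' w' : Wd} {e e' : Finset (Fin 6)}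
    (hv : v ∈ F false) (hw : w ∈ F true) (hv' : v' ∈ F false) (hw' : w' ∈ F true)
    (hvw : ∀ i, w i ≠ v i → (w i).1 ≠ (v i).1)
    (h1 : ∀ i, v' i = if i ∈ e then fl (v i) else v i)
    (h2 : ∀ i, w' i = if i ∈ e' then fl (w i) else w i)
    (hne : e.Nonempty) (hne' : e'.Nonempty)
    (g : Fin 6 → Fin 5)
    (g1 : ∀ i, i ∈ e ↔ (g i == 0 || g i == 1) = true)
    (g2 : ∀ i, i ∈ e' ↔ (g i == 1 || g i == 2) = true)
    (g3 : ∀ i, w i ≠ v i ↔ (g i != 4) = true) :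
    ∃ φ, Rlz F (rootSt ⟨g 0, g 1, g 2, g 3, g 4, g 5⟩) φ := by
  let φ : Fin 6 → ℕ → Lt := fun i p => if p = 0 then w i else v i
  let gg : W6 := ⟨g 0, g 1, g 2, g 3, g 4, g 5⟩
  have hget : ∀ (f : ℕ → ℕ) i, (gg.map f).get i = f (g i) := by
    intro f i; fin_cases i <;> rfl
  have hz : ∀ i, (⟨0, 0, 0, 0, 0, 0⟩ : W6).get i = 0 := by
    intro i; fin_cases i <;> rfl
  have c1 : ∀ x : Fin 5, rV x / 2 < rN x ∧ rV' x / 2 < rN x ∧ rW' x / 2 < rN x ∧ 0 < rN x := by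
    decide
  have n1 : gg.map rV' ≠ gg.map rV := by
    intro h
    obtain ⟨i, hi⟩ := hne
    have := congrArg (fun k => k.get i) h
    simp only [hget] at this
    have c : ∀ x : Fin 5, (x == 0 || x == 1) = true → rV' x ≠ rV x := by decide
    exact c _ ((g1 i).1 hi) this
  have n2 : gg.map rW' ≠ ⟨0, 0, 0, 0, 0, 0⟩ := by
    intro h
    obtain ⟨i, hi⟩ := hne'
    have := congrArg (fun k => k.get i) h
    simp only [hget, hz] at this
    have c : ∀ x : Fin 5, (x == 1 || x == 2) = true → rW' x ≠ 0 := by decide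
    exact c _ ((g2 i).1 hi) this
  have r1 : rhoW φ (gg.map rV) = v := by
    funext i
    simp only [rhoW, hget]
    by_cases h : w i ≠ v i
    · have c : ∀ x : Fin 5, (x != 4) = true → rV x = 2 := by decide
      rw [c _ ((g3 i).1 h)]; rfl
    · have h' := h
      rw [g3 i] at h'
      have c : ∀ x : Fin 5, ¬ (x != 4) = true → rV x = 0 := by decide
      rw [c _ h']
      exact not_not.1 h
  have r2 : rhoW φ ⟨0, 0, 0, 0, 0, 0⟩ = w := by
    funext i
    simp only [rhoW, hz]; rfl
  have r3 : rhoW φ (gg.map rV') = v' := by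
    funext i
    rw [h1 i]
    have r := congrFun r1 i
    simp only [rhoW, hget] at r ⊢
    by_cases h : i ∈ e
    · rw [if_pos h]
      have c : ∀ x : Fin 5, (x == 0 || x == 1) = true → rV' x = Nat.xor (rV x) 1 := by decide
      rw [c _ ((g1 i).1 h), rho_xor, r]
    · rw [if_neg h]
      rw [g1 i] at h
      have c : ∀ x : Fin 5, ¬ (x == 0 || x == 1) = true → rV' x = rV x := by decide
      rw [c _ h, r]
  have r4 : rhoW φ (gg.map rW') = w' := by
    funext i
    rw [h2 i]
    have r := congrFun r2 i
    simp only [rhoW, hz] at r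
    simp only [rhoW, hget]
    by_cases h : i ∈ e'
    · rw [if_pos h]
      have c : ∀ x : Fin 5, (x == 1 || x == 2) = true → rW' x = Nat.xor 0 1 := by decide
      rw [c _ ((g2 i).1 h), rho_xor, r]
    · rw [if_neg h]
      rw [g2 i] at h
      have c : ∀ x : Fin 5, ¬ (x == 1 || x == 2) = true → rW' x = 0 := by decide
      rw [c _ h, r]
  refine ⟨φ, ?_, ?_, ?_, ?_, ?_, ?_⟩
  · intro i p q hp hq hpq
    change p < (gg.map rN).get i at hp
    change q < (gg.map rN).get i at hq
    rw [hget] at hp hq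
    by_cases h : w i ≠ v i
    · have c : ∀ x : Fin 5, rN x ≤ 2 := by decide
      have := c (g i)
      have hh := hvw i h
      by_cases p0 : p = 0 <;> by_cases q0 : q = 0
      · omega
      · simp only [φ, if_pos p0, if_neg q0] at hpq; exact absurd hpq hh
      · simp only [φ, if_neg p0, if_pos q0] at hpq; exact absurd hpq.symm hh
      · omega
    · rw [g3 i] at h
      have c : ∀ x : Fin 5, ¬ (x != 4) = true → rN x = 1 := by decide
      rw [c _ h] at hp hq
      omega
  · intro s k hk i
    change _ < (gg.map rN).get i
    rw [hget]
    have := c1 (g i)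
    cases s
    · change k ∈ [gg.map rV', gg.map rV] at hk
      simp only [List.mem_cons, List.not_mem_nil, or_false] at hk
      rcases hk with rfl | rfl <;> rw [hget]
      · exact this.2.1
      · exact this.1
    · change k ∈ [gg.map rW', ⟨0, 0, 0, 0, 0, 0⟩] at hk
      simp only [List.mem_cons, List.not_mem_nil, or_false] at hk
      rcases hk with rfl | rfl
      · rw [hget]; exact this.2.2.1
      · rw [hz]; exact this.2.2.2
  · intro s k hk
    cases s
    · change k ∈ [gg.map rV', gg.map rV] at hk
      simp only [List.mem_cons, List.not_mem_nil, or_false] at hk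
      rcases hk with rfl | rfl
      · rw [r3]; exact hv'
      · rw [r1]; exact hv
    · change k ∈ [gg.map rW', ⟨0, 0, 0, 0, 0, 0⟩] at hk
      simp only [List.mem_cons, List.not_mem_nil, or_false] at hk
      rcases hk with rfl | rfl
      · rw [r4]; exact hw'
      · rw [r2]; exact hw
  · intro s
    cases s
    · change [gg.map rV', gg.map rV].Nodup
      simpa using n1
    · change [gg.map rW', ⟨0, 0, 0, 0, 0, 0⟩].Nodup
      simpa using n2
  · intro c hc
    exact absurd hc (List.not_mem_nil)
  · intro c hc
    exact absurd hc (List.not_mem_nil)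

end KD7

set_option maxRecDepth 100000

namespace KD7

def cert0300 : List ℕ :=
  [4, 1, 0, 4, 1, 1, 4, 1, 2, 4, 0, 0, 4, 0, 1, 4, 0, 2, 5, 1, 0, 5, 1, 1, 3, 0, 2, 2, 3, 0, 0, 0,
  3, 1, 0, 0, 1, 0, 0, 0, 3, 1, 0, 0, 1, 0, 0, 2, 3, 1, 0, 0, 1, 0, 2, 0, 3, 1, 0, 0, 1, 2, 0, 0,
  3, 0, 2, 3, 3, 0, 0, 2, 3, 1, 0, 1, 0, 0, 0, 2, 3, 0, 2, 3, 3, 0, 2, 0, 3, 1, 0, 1, 0, 0, 2, 0,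
  3, 0, 2, 2, 3, 2, 0, 0, 3, 1, 1, 0, 1, 2, 0, 0, 3, 1, 0, 5, 1, 0, 0, 0, 3, 1, 1, 0, 1, 0, 0, 0,
  3, 1, 1, 0, 1, 0, 0, 2, 3, 1, 0, 0, 1, 0, 2, 0, 3, 1, 1, 0, 1, 2, 0, 0, 3, 0, 3, 2, 3, 0, 0, 2,
  3, 1, 1, 0, 1, 0, 0, 0, 3, 0, 3, 2, 3, 0, 2, 0, 3, 1, 1, 0, 0, 0, 2, 0, 3, 0, 3, 2, 3, 2, 0, 0,
  3, 1, 1, 0, 1, 2, 0, 0, 3, 0, 6, 2, 3, 0, 0, 0]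

theorem ok0300 : rootOk 3 ⟨1, 1, 1, 4, 4, 4⟩ cert0300 = true := by
  decide +kernel

def cert0301 : List ℕ :=
  [4, 1, 3, 4, 1, 0, 4, 1, 1, 4, 1, 2, 4, 1, 3, 4, 0, 1, 4, 0, 2, 5, 1, 0, 5, 1, 1, 5, 1, 2, 5, 1,
  3, 5, 0, 0, 5, 0, 1, 5, 0, 2, 5, 0, 3, 4, 1, 0, 4, 3, 1, 4, 3, 2, 2, 0, 1, 1, 1, 2, 0, 0, 0, 3,
  0, 3, 0, 3, 0, 3, 0, 3, 0, 3, 0, 3, 0, 3, 0, 1, 4, 0, 3, 5, 1, 3, 5, 0, 3, 4, 0, 0, 4, 2, 1, 4,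
  2, 2, 0, 2, 4, 1, 1, 4, 1, 2, 4, 0, 0, 4, 0, 2, 5, 1, 0, 5, 1, 1, 5, 1, 2, 5, 0, 0, 5, 0, 1, 5,
  0, 2, 4, 1, 1, 4, 3, 2, 2, 0, 1, 1, 1, 2, 0, 0, 0, 3, 0, 3, 0, 3, 0, 3, 0, 3, 0, 3, 0, 3, 0, 3,
  0, 1, 4, 1, 2, 4, 1, 1, 4, 0, 0, 4, 0, 1, 5, 1, 0, 5, 1, 1, 5, 1, 2, 5, 0, 0, 5, 0, 1, 5, 0, 2,
  4, 1, 2, 2, 1, 2, 2, 2, 2, 0, 0, 0, 4, 0, 4, 0, 4, 0, 4, 0, 4, 0, 4, 0, 4, 0, 4, 0, 1, 4, 0, 1,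
  0, 2, 4, 0, 2, 0, 2, 5, 1, 0, 5, 1, 1, 5, 1, 2, 5, 0, 1, 5, 0, 2, 5, 1, 0, 5, 3, 1, 5, 3, 2, 3,
  0, 3, 3, 3, 1, 0, 0, 1, 4, 0, 0, 0, 0, 1, 4, 1, 4, 0, 0, 0, 0, 1, 4, 1, 1, 5, 0, 0, 5, 2, 1, 5,
  2, 2, 1, 2, 5, 1, 1, 5, 1, 2, 5, 0, 0, 5, 0, 2, 5, 1, 1, 5, 3, 2, 3, 0, 2, 2, 2, 1, 0, 0, 1, 3,
  0, 0, 0, 0, 1, 3, 1, 3, 0, 0, 0, 0, 1, 3, 1, 1, 5, 1, 2, 5, 1, 1, 5, 0, 0, 5, 0, 1, 5, 1, 2, 3,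
  1, 0, 0, 0, 1, 0, 0, 1, 3, 0, 1, 0, 1, 1, 3, 1, 3, 0, 1, 0, 1, 1, 3, 1, 1, 5, 0, 1, 1, 2, 5, 0,
  2, 1, 2, 3, 1, 1, 0, 1, 0, 0, 0, 1, 2, 0, 1, 0, 1, 1, 2, 3, 0, 3, 2, 3, 0, 0, 0, 0, 0, 0, 0, 3,
  0, 3, 3, 3, 1, 0, 0, 1, 4, 0, 0, 0, 0, 1, 4, 1, 4, 0, 0, 0, 0, 1, 4, 0, 0, 0, 0, 0, 0, 1, 4, 0,
  0, 0, 0, 1, 4, 1, 4, 0, 0, 0, 0, 1, 4, 0, 0, 0, 0, 0, 0, 3, 0, 3, 2, 3, 5, 0, 0, 0, 0, 0, 0, 0,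
  0, 0, 0, 0, 1, 0, 1, 3, 1, 0, 0, 0, 1, 0, 0, 1, 2, 0, 1, 0, 1, 1, 2, 1, 2, 0, 1, 0, 1, 1, 2, 0,
  1, 0, 1, 0, 1, 1, 2, 0, 1, 0, 1, 1, 2, 1, 2, 0, 1, 0, 1, 1, 2, 0, 1, 0, 1, 0, 1, 3, 1, 1, 0, 0,
  4, 0, 0, 1, 2, 0, 1, 0, 1, 3, 0, 3, 2, 7, 4, 0, 0, 3, 0, 3, 2, 2, 4, 0, 0, 0, 0, 0, 0, 0, 1, 0,
  1, 3, 0, 3, 7, 2, 4, 0, 0, 0, 1, 0, 1, 3, 1, 1, 0, 5, 0, 0, 0, 3, 1, 0, 0, 4, 1, 0, 0, 1, 3, 0,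
  1, 0, 1, 1, 3, 1, 3, 1, 3, 0, 1, 0, 1, 1, 3, 0, 1, 0, 1, 0, 1, 1, 3, 0, 1, 0, 1, 1, 3, 0, 1, 0,
  1, 1, 3, 1, 3, 0, 1, 0, 1, 1, 3, 1, 3, 0, 1, 0, 1, 3, 0, 3, 2, 6, 5, 0, 0, 5, 0, 2, 3, 1, 0, 0,
  0, 1, 0, 0, 1, 2, 0, 1, 0, 1, 1, 2, 1, 2, 1, 2, 0, 1, 0, 1, 1, 2, 0, 1, 0, 1, 0, 1, 1, 2, 0, 1,
  0, 1, 1, 2, 0, 1, 0, 1, 1, 2, 1, 2, 0, 1, 0, 1, 1, 2, 1, 2, 0, 1, 0, 1, 3, 1, 1, 0, 5, 0, 0, 0,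
  3, 1, 1, 0, 0, 5, 0, 0, 3, 0, 3, 2, 2, 4, 0, 0, 0, 1, 0, 1, 3, 0, 3, 2, 3, 13, 0, 0, 5, 0, 3, 1,
  2, 1, 3, 2, 1, 0, 0, 1, 2, 0, 0, 0, 1, 0, 1, 3, 0, 3, 2, 3, 0, 0, 0, 0, 0, 0, 0, 3, 0, 3, 3, 3,
  1, 0, 0, 1, 4, 0, 0, 0, 0, 1, 4, 1, 4, 0, 0, 0, 0, 1, 4, 0, 0, 0, 0, 0, 0, 1, 4, 0, 0, 0, 0, 1,
  4, 1, 4, 0, 0, 0, 0, 1, 4, 0, 0, 0, 0, 0, 0, 3, 0, 2, 2, 3, 5, 0, 0, 0, 0, 0, 0, 0, 0, 0, 0, 0,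
  1, 0, 1, 3, 1, 0, 0, 0, 1, 0, 0, 1, 2, 0, 1, 0, 1, 1, 2, 1, 2, 0, 1, 0, 1, 1, 2, 0, 1, 0, 1, 0,
  1, 1, 2, 0, 1, 0, 1, 1, 2, 1, 2, 0, 1, 0, 1, 1, 2, 0, 1, 0, 1, 0, 1, 3, 1, 1, 0, 1, 5, 0, 0, 1,
  3, 3, 0, 2, 2, 3, 0, 0, 0, 0, 0, 0, 0, 0, 1, 0, 1, 5, 0, 2, 3, 0, 3, 2, 6, 4, 0, 0, 0, 1, 0, 1,
  3, 1, 4, 0, 1, 5, 0, 0, 0, 1, 0, 1, 5, 0, 0, 5, 1, 3, 2, 0, 4, 2, 3, 0, 0, 0, 4, 0, 3, 2, 0, 7,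
  0, 3, 0, 0, 0, 4, 0, 3, 2, 0, 6, 2, 1, 0, 0, 0, 2, 0, 5, 2, 1, 0, 0, 0, 5, 0, 3, 3, 0, 5, 2, 1,
  2, 0, 0, 1, 3, 1, 3, 2, 3, 2, 2, 0, 0, 0, 0, 2, 1, 3, 0, 1, 2, 0, 0, 0, 5, 0, 5, 0, 5, 0, 5, 0,
  5, 1, 3, 1, 3, 2, 1, 3, 2, 1, 4, 0, 0, 2, 0, 7, 2, 1, 5, 0, 0, 2, 2, 11, 3, 1, 0, 0, 0, 1, 2, 1,
  2, 2, 1, 2, 0, 7, 0, 0, 0, 1, 3, 1, 3, 4, 0, 3, 2, 0, 6, 2, 1, 0, 0, 0, 4, 0, 3, 2, 2, 5, 1, 3,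
  0, 0, 0, 2, 0, 4, 0, 3, 0, 0, 0, 3, 0, 7, 0, 3, 2, 0, 0, 1, 3, 1, 3, 2, 1, 3, 0, 3, 0, 0, 0, 2,
  2, 1, 3, 3, 2, 0, 0, 0, 6, 0, 6, 0, 6, 0, 6, 0, 6, 1, 3, 1, 3, 2, 1, 1, 0, 3, 4, 0, 0, 2, 0, 7,
  0, 3, 4, 0, 0, 2, 2, 13, 1, 3, 0, 0, 0, 1, 3, 1, 3, 2, 1, 3, 6, 1, 0, 0, 0, 1, 2, 1, 2, 2, 3, 0,
  2, 4, 0, 0, 0, 2, 2, 5, 5, 3, 0, 0, 0, 5, 0, 3, 3, 0, 7, 2, 3, 0, 0, 0, 3, 0, 6, 2, 2, 1, 0, 0,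
  1, 3, 0, 0, 0, 0, 1, 3, 1, 3, 0, 0, 0, 0, 1, 3, 0, 0, 0, 0, 0, 0, 1, 3, 0, 0, 0, 0, 1, 3, 1, 3,
  0, 0, 0, 0, 1, 3, 1, 3, 1, 3, 0, 0, 0, 0, 1, 3, 0, 1, 0, 1, 3, 0, 6, 2, 3, 4, 0, 0, 5, 0, 0, 3,
  0, 2, 2, 2, 1, 0, 0, 1, 2, 0, 0, 0, 0, 1, 2, 1, 2, 0, 0, 0, 0, 1, 2, 0, 0, 0, 0, 0, 0, 1, 2, 0,
  0, 0, 0, 1, 2, 1, 2, 0, 0, 0, 0, 1, 2, 1, 2, 1, 2, 0, 0, 0, 0, 1, 2, 0, 1, 0, 1, 3, 0, 6, 2, 3,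
  0, 0, 0, 3, 0, 2, 2, 3, 5, 0, 0, 3, 0, 3, 2, 3, 5, 0, 0, 0, 1, 0, 1, 3, 1, 0, 0, 1, 13, 0, 0]

theorem ok0301 : rootOk 4 ⟨1, 1, 1, 3, 4, 4⟩ cert0301 = true := by
  decide +kernel

def cert0302 : List ℕ :=
  [4, 1, 3, 4, 2, 4, 5, 1, 0, 5, 1, 1, 5, 1, 2, 5, 1, 3, 1, 1, 4, 1, 4, 5, 1, 0, 5, 1, 1, 5, 1, 2,
  5, 1, 4, 1, 1, 4, 0, 3, 4, 1, 4, 5, 1, 0, 5, 1, 1, 5, 1, 2, 5, 1, 3, 1, 1, 4, 0, 4, 5, 1, 0, 5,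
  1, 1, 5, 1, 2, 5, 1, 4, 1, 1, 5, 1, 3, 4, 1, 0, 4, 1, 1, 0, 1, 5, 1, 4, 4, 1, 0, 4, 1, 1, 0, 1,
  5, 0, 3, 4, 1, 0, 4, 1, 1, 0, 1, 4, 1, 0, 4, 1, 1, 4, 1, 3, 4, 0, 4, 5, 1, 0, 5, 1, 1, 1, 1, 4,
  1, 3, 4, 0, 0, 5, 1, 0, 5, 1, 1, 1, 1, 0, 1, 4, 1, 1, 4, 1, 4, 4, 0, 3, 5, 1, 0, 5, 1, 1, 1, 1,
  4, 1, 4, 4, 0, 0, 5, 1, 0, 5, 1, 1, 1, 1, 0, 1, 4, 0, 1, 4, 0, 2, 5, 1, 0, 5, 1, 1, 1, 1, 4, 0,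
  0, 0, 2, 0, 2, 0, 2, 4, 1, 1, 0, 1, 0, 1, 0, 1, 0, 1]

theorem ok0302 : rootOk 5 ⟨1, 1, 1, 3, 3, 4⟩ cert0302 = true := by
  decide +kernel

def cert0303 : List ℕ :=
  [4, 1, 3, 5, 1, 4, 5, 1, 0, 4, 2, 4, 4, 2, 5, 4, 1, 4, 4, 0, 4, 5, 1, 1, 5, 1, 2, 1, 1, 5, 1, 1,
  4, 2, 4, 4, 2, 5, 4, 1, 4, 4, 0, 4, 5, 1, 0, 5, 1, 2, 1, 1, 1, 1, 5, 1, 5, 5, 1, 0, 4, 2, 4, 4,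
  2, 5, 4, 1, 5, 4, 0, 5, 5, 1, 1, 5, 1, 2, 1, 1, 5, 1, 1, 4, 2, 4, 4, 2, 5, 4, 1, 5, 4, 0, 5, 5,
  1, 0, 5, 1, 2, 1, 1, 1, 1, 5, 1, 0, 5, 1, 1, 5, 1, 2, 1, 1, 4, 1, 4, 5, 1, 3, 5, 1, 0, 4, 2, 5,
  4, 1, 3, 4, 0, 3, 5, 1, 1, 5, 1, 2, 1, 1, 5, 1, 1, 4, 2, 5, 4, 1, 3, 4, 0, 3, 5, 1, 0, 5, 1, 2,
  1, 1, 1, 1, 5, 1, 5, 5, 1, 0, 4, 2, 5, 4, 1, 5, 4, 0, 5, 5, 1, 1, 5, 1, 2, 1, 1, 5, 1, 1, 4, 2,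
  5, 4, 1, 5, 4, 0, 5, 5, 1, 0, 5, 1, 2, 1, 1, 1, 1, 5, 1, 0, 5, 1, 1, 5, 1, 2, 1, 1, 4, 0, 3, 0,
  2, 0, 2, 0, 2, 4, 0, 4, 0, 2, 0, 2, 0, 2, 4, 1, 5, 0, 1, 0, 1, 0, 1, 0, 1]

theorem ok0303 : rootOk 6 ⟨1, 1, 1, 3, 3, 3⟩ cert0303 = true := by
  decide +kernel

def cert0500 : List ℕ :=
  [4, 1, 0, 4, 1, 1, 4, 1, 2, 4, 1, 3, 0, 1]

theorem ok0500 : rootOk 5 ⟨1, 1, 1, 1, 1, 4⟩ cert0500 = true := by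
  decide +kernel

def cert0501 : List ℕ :=
  [4, 1, 5, 4, 1, 0, 4, 1, 5, 4, 0, 1, 4, 0, 2, 4, 0, 3, 4, 0, 4, 0, 0, 4, 1, 1, 4, 1, 5, 4, 0, 0,
  4, 0, 2, 4, 0, 3, 4, 0, 4, 0, 0, 0, 1]

theorem ok0501 : rootOk 6 ⟨1, 1, 1, 1, 1, 3⟩ cert0501 = true := by
  decide +kernel

def cert1210 : List ℕ :=
  [4, 1, 0, 4, 0, 0, 5, 1, 0, 4, 1, 1, 4, 1, 2, 4, 0, 1, 4, 0, 2, 5, 2, 3, 5, 1, 3, 5, 0, 1, 5, 0,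
  2, 4, 1, 3, 4, 0, 1, 4, 0, 2, 5, 2, 1, 5, 2, 2, 5, 1, 1, 5, 1, 2, 4, 1, 3, 4, 0, 1, 4, 0, 2, 5,
  1, 0, 2, 2, 0, 3, 3, 1, 0, 0, 2, 1, 1, 0, 2, 1, 0, 0, 1, 3, 1, 3, 1, 2, 1, 2, 2, 1, 1, 2, 0, 0,
  0, 0, 1, 3, 1, 3, 1, 2, 1, 2, 2, 3, 0, 2, 6, 0, 0, 0, 2, 1, 1, 4, 2, 0, 0, 0, 1, 1, 0, 1, 3, 0,
  2, 2, 2, 1, 0, 0, 3, 1, 0, 0, 0, 1, 0, 0, 0, 1, 0, 1, 5, 0, 5, 4, 0, 3, 0, 2, 0, 0, 3, 0, 2, 2,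
  2, 1, 2, 0, 3, 1, 0, 0, 1, 1, 0, 0, 3, 0, 2, 2, 6, 1, 0, 0, 3, 1, 0, 1, 0, 1, 0, 0, 0, 1, 0, 1,
  3, 0, 2, 2, 2, 1, 0, 2, 3, 1, 0, 0, 0, 1, 0, 0, 5, 0, 4, 3, 0, 2, 2, 2, 1, 2, 0, 3, 1, 0, 0, 0,
  1, 2, 0, 3, 1, 0, 5, 0, 1, 0, 0, 5, 1, 3, 5, 0, 3, 4, 0, 3, 4, 0, 1, 4, 0, 2, 5, 1, 1, 5, 1, 2,
  5, 0, 1, 5, 0, 0, 1, 2, 5, 0, 2, 4, 2, 3, 4, 0, 1, 2, 0, 2, 1, 1, 1, 0, 0, 2, 1, 2, 2, 0, 0, 0,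
  0, 1, 1, 1, 1, 1, 0, 1, 0, 2, 1, 2, 0, 0, 0, 0, 0, 1, 1, 1, 1, 1, 0, 1, 0, 2, 1, 2, 0, 6, 0, 0,
  0, 2, 0, 2, 5, 1, 1, 0, 0, 2, 1, 0, 2, 2, 0, 0, 0, 2, 0, 0, 3, 3, 1, 0, 0, 1, 0, 1, 0, 1, 1, 1,
  1, 2, 0, 0, 3, 3, 1, 0, 0, 1, 0, 1, 0, 1, 1, 1, 1, 2, 0, 0, 3, 7, 1, 0, 0, 2, 0, 0, 7, 3, 1, 0,
  0, 4, 0, 1, 4, 0, 3, 5, 0, 0, 5, 1, 1, 4, 2, 3, 4, 2, 1, 2, 0, 2, 1, 0, 0, 0, 0, 4, 1, 2, 2, 0,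
  2, 1, 0, 0, 0, 0, 5, 2, 2, 3, 0, 2, 0, 2, 1, 0, 0, 5, 1, 1, 3, 0, 2, 1, 3, 0, 0, 0, 3, 0, 2, 0,
  2, 1, 0, 0, 2, 0, 0, 2, 3, 1, 0, 0, 2, 2, 0, 1, 1, 3, 0, 0, 4, 1, 2, 5, 1, 0, 2, 2, 2, 3, 1, 3,
  0, 0, 3, 1, 2, 0, 1, 3, 0, 0, 3, 2, 1, 2, 1, 1, 0, 0, 3, 0, 6, 2, 1, 3, 0, 0, 2, 2, 2, 1, 1, 1,
  0, 0, 2, 2, 0, 1, 3, 3, 0, 2, 2, 2, 0, 1, 3, 3, 2, 0, 4, 1, 2, 4, 0, 0, 5, 1, 0, 2, 3, 0, 2, 2,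
  0, 0, 0, 4, 1, 2, 0, 5, 3, 6, 0, 0, 1, 1, 0, 0, 5, 0, 0, 2, 1, 2, 1, 0, 0, 0, 0, 3, 0, 2, 1, 0,
  2, 0, 0, 4, 0, 3, 2, 1, 2, 3, 0, 0, 0, 2, 3, 0, 2, 3, 0, 2, 0, 0, 4, 0, 3, 2, 1, 2, 3, 0, 0, 2,
  0, 3, 0, 2, 1, 0, 2, 0, 0, 0, 2, 0, 2, 0, 2, 3, 0, 2, 3, 0, 3, 0, 0, 5, 1, 3, 3, 0, 2, 1, 0, 2,
  0, 0, 4, 0, 4, 4, 0, 3, 2, 2, 2, 3, 1, 1, 2, 0, 0, 0, 0, 2, 2, 0, 4, 0, 3, 3, 0, 0, 5, 1, 0, 4,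
  0, 5, 2, 3, 0, 2, 2, 0, 0, 2, 2, 2, 0, 3, 3, 1, 0, 2, 2, 2, 0, 3, 3, 1, 2, 0, 2, 3, 0, 2, 2, 0,
  0, 0, 2, 0, 0, 2, 3, 5, 0, 0, 2, 3, 0, 2, 2, 0, 0, 0, 3, 0, 0, 3, 2, 3, 0, 0, 2, 1, 0, 3, 4, 0,
  0, 0, 3, 1, 2, 2, 2, 1, 0, 2, 3, 0, 2, 0, 2, 1, 2, 0, 3, 0, 2, 0, 7, 1, 0, 0, 4, 2, 3, 4, 0, 1,
  4, 0, 2, 5, 1, 2, 5, 0, 1, 5, 0, 2, 2, 1, 2, 0, 0, 0, 0, 0, 2, 0, 2, 3, 1, 1, 0, 0, 1, 0, 1, 0,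
  1, 1, 1, 1, 2, 1, 2, 4, 0, 0, 0, 0, 4, 2, 1, 5, 1, 2, 2, 0, 2, 0, 1, 0, 0, 0, 2, 1, 0, 2, 2, 0,
  0, 0, 2, 0, 0, 3, 3, 1, 0, 0, 4, 2, 3, 2, 0, 0, 3, 3, 3, 0, 2, 4, 2, 3, 4, 0, 4, 2, 0, 0, 3, 3,
  3, 2, 0, 1, 1, 1, 1, 2, 1, 0, 2, 2, 4, 0, 0, 4, 1, 2, 4, 0, 3, 2, 1, 0, 2, 2, 0, 0, 0, 2, 0, 0,
  3, 3, 1, 0, 0, 0, 5, 0, 5, 2, 1, 0, 2, 2, 0, 0, 2, 2, 1, 0, 2, 2, 0, 2, 0, 2, 1, 0, 2, 2, 6, 0,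
  0, 5, 1, 2, 5, 0, 0, 3, 1, 2, 3, 3, 0, 0, 0, 2, 3, 2, 0, 0, 0, 0, 0, 2, 1, 0, 2, 3, 0, 0, 0, 3,
  0, 0, 2, 3, 2, 0, 0, 2, 1, 0, 2, 1, 0, 0, 2, 2, 1, 0, 2, 1, 0, 2, 0, 2, 3, 0, 2, 0, 0, 0, 0, 2,
  3, 0, 0, 2, 2, 0, 0, 5, 2, 2, 3, 6, 0, 1, 1, 0, 0, 0, 3, 0, 2, 1, 0, 2, 0, 0, 3, 1, 5, 3, 0, 0,
  0, 0, 2, 0, 0, 1, 2, 2, 0, 2, 2, 3, 0, 0, 0, 2, 2, 0, 4, 0, 2, 0, 6, 0, 6, 3, 0, 0, 1, 1, 2, 0,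
  0, 4, 0, 0, 0, 0, 2, 3, 4, 0, 2, 2, 0, 0, 4, 0, 5, 2, 3, 0, 2, 0, 0, 0, 2, 2, 3, 0, 2, 0, 0, 2,
  0, 2, 0, 0, 3, 2, 6, 0, 0, 2, 1, 0, 2, 3, 5, 0, 0, 2, 3, 0, 2, 6, 0, 0, 0, 4, 0, 5, 2, 1, 2, 0,
  1, 0, 0, 2, 2, 1, 2, 0, 1, 0, 2, 0, 2, 1, 2, 6, 1, 0, 0, 0, 3, 1, 2, 3, 3, 0, 0, 2, 3, 1, 2, 3,
  3, 0, 2, 0, 3, 0, 2, 1, 6, 0, 0, 0, 3, 1, 2, 3, 2, 0, 0, 0, 5, 1, 1, 3, 0, 2, 1, 3, 0, 0, 0, 3,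
  0, 2, 0, 2, 1, 0, 0, 3, 0, 2, 0, 3, 0, 0, 0, 5, 1, 0, 1, 5, 3, 1, 2, 2, 3, 0, 0, 0, 3, 1, 2, 2,
  3, 0, 0, 2, 3, 1, 2, 2, 3, 0, 2, 0, 3, 1, 2, 3, 3, 0, 0, 0, 5, 3, 0, 5, 0, 5, 1, 6, 2, 1, 2, 0,
  1, 0, 0, 2, 2, 3, 2, 3, 0, 0, 0, 2, 2, 3, 2, 1, 0, 0, 0, 0, 4, 0, 5, 2, 0, 2, 3, 1, 0, 0, 5, 1,
  5, 1, 5, 0, 2, 0, 2, 2, 3, 2, 7, 0, 0, 0, 2, 3, 1, 2, 3, 3, 0, 2, 0, 1, 6, 0, 1, 1, 6, 3, 1, 3,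
  2, 3, 1, 0, 0, 1, 6, 1, 6, 1, 6, 1, 6, 1, 6, 1, 6, 0, 1, 1, 6, 1, 6, 1, 6, 5, 0, 5, 3, 1, 2, 2,
  3, 0, 0, 2, 1, 6, 0, 1, 1, 6, 3, 1, 2, 3, 3, 0, 2, 0, 1, 6, 0, 1, 1, 6, 0, 1, 3, 1, 7, 3, 3, 0,
  0, 0, 1, 6, 1, 6, 3, 1, 7, 3, 3, 0, 0, 0, 1, 6, 1, 6, 0, 1, 3, 1, 7, 2, 3, 0, 0, 0, 1, 6, 0, 1,
  1, 6, 3, 0, 0, 1, 3, 0, 0, 2, 3, 0, 2, 1, 3, 0, 0, 2, 3, 2, 4, 0, 1, 0, 0, 2, 3, 0, 2, 0, 3, 0,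
  2, 0, 3, 0, 0, 0, 3, 0, 2, 0, 3, 0, 4, 1, 3, 0, 2, 0, 3, 0, 2, 4, 3, 0, 0, 0, 2, 0, 3, 0, 3, 0,
  0, 0, 4, 0, 0, 2, 0, 3, 1, 3, 0, 0, 0, 2, 0, 3, 0, 3, 0, 0, 0, 2, 0, 1, 1, 3, 0, 0, 0, 2, 0, 3,
  1, 3, 0, 0, 0, 2, 0, 3, 0, 3, 0, 0, 0, 3, 0, 2, 0, 2, 1, 0, 2, 3, 1, 2, 2, 2, 1, 2, 0, 3, 0, 2,
  0, 6, 1, 0, 0, 5, 0, 0, 3, 0, 2, 1, 2, 0, 0, 2, 3, 2, 0, 1, 1, 0, 0, 2, 1, 4, 0, 2, 1, 4, 5, 0,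
  0, 3, 1, 2, 3, 2, 0, 2, 0, 4, 1, 4, 0, 3, 0, 3, 0, 3, 0, 1, 3, 0, 2, 1, 2, 5, 0, 0, 5, 1, 2, 5,
  1, 1, 5, 0, 0, 2, 1, 0, 3, 2, 0, 0, 0, 4, 0, 2, 2, 2, 0, 3, 1, 1, 0, 0, 3, 0, 0, 3, 1, 0, 0, 0,
  3, 4, 1, 0, 0, 0, 0, 0, 4, 0, 3, 5, 0, 3, 2, 5, 0, 0, 2, 2, 0, 0, 3, 0, 2, 1, 0, 2, 0, 0, 4, 0,
  0, 4, 0, 2, 3, 2, 1, 3, 2, 0, 0, 0, 1, 5, 0, 4, 0, 4, 2, 0, 1, 2, 2, 1, 0, 0, 0, 5, 0, 5, 0, 4,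
  0, 4, 2, 0, 1, 2, 2, 3, 0, 0, 0, 5, 0, 5, 0, 4, 0, 4, 2, 1, 4, 1, 0, 2, 0, 0, 2, 0, 1, 2, 0, 1,
  0, 0, 2, 0, 1, 2, 0, 1, 0, 0, 3, 1, 0, 3, 0, 0, 0, 2, 3, 4, 0, 1, 0, 0, 2, 0, 3, 4, 5, 1, 1, 0,
  0, 0, 1, 3, 1, 3, 2, 0, 0, 2, 3, 1, 0, 0, 2, 1, 0, 3, 2, 6, 0, 0, 3, 0, 0, 2, 3, 2, 0, 0, 3, 0,
  0, 2, 3, 2, 0, 0, 2, 2, 0, 3, 7, 1, 0, 0, 3, 0, 2, 0, 3, 0, 0, 0, 3, 0, 2, 1, 2, 1, 0, 0, 5, 2,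
  0, 1, 4, 2, 3, 0, 3, 2, 0, 0, 0, 2, 0, 1, 2, 3, 0, 0, 0, 2, 0, 1, 2, 6, 0, 0, 0, 5, 1, 0, 3, 2,
  0, 1, 1, 0, 0, 0, 3, 2, 0, 1, 0, 0, 0, 2, 1, 6, 0, 2, 1, 6, 3, 2, 0, 1, 0, 0, 2, 0, 1, 6, 0, 2,
  1, 6, 3, 2, 1, 0, 1, 0, 0, 0, 1, 5, 1, 5, 1, 5, 1, 5, 1, 5, 1, 5, 0, 2, 1, 5, 1, 5, 1, 5, 3, 2,
  0, 1, 0, 0, 0, 2, 1, 6, 0, 2, 1, 6, 3, 2, 0, 1, 0, 0, 2, 0, 1, 6, 0, 2, 1, 6, 0, 2, 3, 2, 5, 1,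
  1, 0, 0, 0, 1, 6, 1, 6, 3, 2, 0, 1, 1, 0, 0, 2, 1, 6, 1, 6, 0, 2, 1, 6, 3, 2, 0, 1, 1, 0, 2, 0,
  1, 6, 1, 6, 0, 2, 1, 6, 3, 0, 0, 0, 2, 1, 0, 2, 3, 0, 2, 0, 2, 1, 0, 2, 3, 0, 6, 1, 2, 1, 0, 2,
  3, 0, 2, 0, 2, 1, 2, 0, 3, 2, 0, 1, 0, 1, 2, 0, 3, 0, 6, 0, 2, 1, 2, 0, 3, 0, 2, 4, 2, 1, 0, 0,
  2, 0, 3, 0, 2, 1, 0, 0, 2, 0, 3, 0, 2, 1, 0, 0, 2, 0, 3, 1, 2, 1, 0, 0, 2, 0, 3, 1, 2, 1, 0, 0,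
  4, 0, 0, 5, 1, 0, 5, 0, 0, 3, 0, 2, 0, 2, 1, 0, 2, 2, 0, 3, 0, 2, 1, 0, 0, 2, 0, 1, 0, 2, 1, 0,
  0, 3, 0, 2, 0, 3, 0, 0, 2, 3, 1, 2, 2, 3, 0, 2, 0, 3, 0, 2, 0, 3, 5, 0, 0, 5, 1, 2, 5, 0, 5, 3,
  0, 2, 1, 2, 0, 0, 2, 3, 2, 0, 1, 1, 0, 0, 0, 1, 4, 0, 2, 1, 4, 5, 1, 2, 5, 0, 4, 3, 0, 2, 1, 2,
  0, 2, 0, 3, 2, 0, 1, 0, 0, 0, 0, 1, 4, 0, 2, 1, 4, 3, 0, 2, 1, 7, 0, 0, 0, 4, 0, 2, 4, 0, 3, 5,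
  0, 0, 4, 2, 3, 4, 0, 1, 4, 0, 2, 5, 1, 1, 5, 1, 2, 5, 0, 1, 5, 0, 2, 2, 0, 2, 1, 1, 1, 0, 0, 2,
  1, 2, 0, 2, 0, 0, 0, 1, 1, 1, 1, 1, 0, 1, 0, 2, 0, 2, 1, 5, 1, 0, 0, 5, 1, 1, 4, 2, 2, 2, 0, 0,
  3, 2, 0, 0, 0, 5, 2, 2, 3, 0, 2, 2, 0, 1, 0, 0, 5, 0, 0, 2, 0, 2, 1, 0, 0, 0, 0, 3, 1, 2, 3, 1,
  0, 0, 0, 2, 0, 0, 3, 3, 0, 0, 0, 3, 0, 0, 1, 2, 2, 0, 0, 2, 1, 0, 1, 2, 0, 0, 2, 2, 1, 0, 1, 2,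
  0, 2, 0, 2, 0, 0, 2, 3, 0, 0, 0, 2, 0, 0, 2, 1, 2, 0, 0, 3, 1, 0, 0, 3, 0, 0, 0, 3, 0, 2, 0, 1,
  2, 0, 0, 3, 1, 4, 0, 3, 0, 0, 0, 2, 3, 0, 0, 0, 2, 0, 2, 2, 3, 0, 0, 0, 2, 2, 0, 4, 0, 1, 0, 6,
  0, 6, 3, 2, 0, 0, 3, 2, 0, 0, 4, 0, 0, 0, 0, 2, 3, 6, 2, 0, 2, 0, 0, 2, 3, 0, 2, 2, 0, 0, 2, 2,
  3, 0, 0, 2, 0, 2, 0, 2, 3, 0, 0, 2, 6, 0, 0, 2, 0, 0, 3, 3, 4, 0, 0, 2, 1, 0, 7, 2, 0, 0, 0, 3,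
  1, 2, 3, 1, 0, 0, 2, 3, 2, 2, 3, 3, 0, 2, 0, 3, 1, 2, 6, 1, 0, 0, 0, 2, 0, 2, 1, 0, 0, 0, 2, 4,
  0, 4, 2, 2, 2, 0, 2, 0, 2, 0, 2, 0, 2, 1, 0, 0, 2, 0, 2, 0, 2, 1, 6, 0, 0, 0, 4, 2, 2, 4, 0, 3,
  5, 1, 2, 2, 0, 0, 2, 3, 0, 0, 0, 2, 1, 2, 0, 0, 0, 0, 0, 2, 0, 2, 1, 1, 1, 0, 0, 0, 4, 0, 4, 1,
  1, 1, 1, 4, 0, 3, 2, 0, 2, 1, 1, 5, 0, 0, 5, 1, 2, 5, 1, 2, 3, 1, 2, 2, 2, 1, 0, 0, 2, 0, 0, 2,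
  3, 0, 0, 0, 3, 0, 0, 0, 2, 1, 0, 0, 3, 1, 2, 3, 0, 1, 0, 0, 3, 1, 2, 7, 0, 1, 0, 0, 3, 1, 2, 2,
  0, 1, 0, 0, 5, 1, 0, 3, 1, 2, 3, 0, 1, 0, 0, 2, 1, 0, 1, 2, 1, 0, 0, 3, 1, 1, 0, 3, 1, 0, 0, 4,
  1, 3, 5, 0, 3, 2, 1, 0, 3, 0, 3, 0, 0, 5, 2, 0, 2, 4, 2, 3, 3, 3, 0, 0, 3, 0, 2, 1, 2, 3, 0, 0,
  4, 0, 0, 4, 0, 1, 3, 4, 3, 3, 2, 1, 0, 0, 1, 6, 0, 4, 0, 4, 2, 0, 1, 3, 3, 0, 0, 0, 0, 5, 0, 5,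
  0, 4, 0, 4, 2, 0, 1, 3, 3, 2, 0, 0, 0, 5, 0, 5, 0, 4, 0, 4, 2, 2, 5, 1, 0, 3, 0, 0, 4, 0, 3, 3,
  1, 1, 0, 2, 0, 0, 0, 2, 1, 1, 1, 3, 0, 0, 0, 2, 0, 1, 1, 3, 0, 0, 0, 2, 1, 0, 1, 2, 1, 0, 2, 2,
  3, 0, 1, 3, 1, 2, 0, 2, 0, 0, 3, 2, 5, 0, 0, 3, 3, 0, 0, 0, 1, 0, 2, 3, 3, 0, 0, 0, 1, 2, 0, 3,
  0, 1, 2, 3, 1, 0, 0, 3, 3, 4, 1, 0, 1, 0, 0, 2, 0, 0, 2, 3, 0, 0, 2, 2, 0, 0, 2, 3, 0, 2, 0, 2,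
  0, 0, 6, 3, 0, 0, 0, 5, 0, 2, 5, 0, 0, 3, 1, 2, 3, 3, 0, 0, 0, 5, 2, 1, 2, 3, 0, 2, 2, 0, 0, 0,
  4, 0, 1, 2, 1, 0, 3, 2, 1, 0, 0, 3, 1, 0, 0, 3, 2, 0, 0, 2, 0, 0, 0, 1, 2, 0, 0, 3, 0, 2, 0, 1,
  2, 0, 0, 4, 0, 0, 5, 1, 0, 3, 2, 1, 0, 2, 0, 0, 0, 4, 1, 3, 4, 0, 1, 3, 2, 1, 2, 2, 0, 0, 0, 1,
  5, 0, 4, 0, 4, 2, 0, 1, 2, 2, 1, 0, 0, 0, 5, 0, 5, 0, 4, 0, 4, 3, 4, 3, 3, 3, 5, 0, 0, 0, 4, 0,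
  4, 0, 4, 0, 4, 4, 2, 3, 2, 0, 1, 0, 2, 1, 0, 0, 3, 1, 1, 1, 2, 5, 0, 0, 2, 4, 4, 0, 0, 2, 0, 0,
  3, 0, 0, 1, 3, 0, 0, 2, 3, 4, 0, 0, 1, 0, 2, 0, 3, 4, 4, 0, 1, 0, 0, 0, 1, 3, 1, 3, 2, 1, 0, 3,
  2, 1, 0, 0, 2, 3, 0, 2, 2, 6, 0, 0, 2, 2, 0, 3, 3, 3, 0, 0, 2, 0, 0, 3, 1, 2, 0, 0, 2, 1, 0, 5,
  2, 1, 0, 0, 3, 1, 2, 3, 3, 0, 0, 2, 3, 0, 2, 3, 1, 0, 2, 0, 3, 0, 2, 6, 1, 0, 0, 0, 3, 1, 2, 2,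
  3, 0, 0, 0, 5, 0, 0, 3, 0, 2, 3, 1, 0, 0, 0, 5, 0, 0, 1, 4, 5, 0, 3, 3, 0, 2, 3, 0, 1, 0, 0, 2,
  3, 2, 0, 1, 0, 0, 0, 4, 0, 2, 3, 0, 2, 0, 3, 2, 0, 0, 1, 5, 1, 5, 2, 3, 2, 0, 1, 0, 0, 2, 2, 2,
  2, 1, 1, 0, 2, 0, 4, 0, 3, 2, 1, 3, 1, 0, 0, 0, 0, 3, 3, 2, 3, 2, 0, 0, 0, 3, 0, 3, 0, 2, 0, 0,
  0, 1, 6, 1, 6, 1, 6, 3, 0, 2, 1, 2, 2, 0, 2, 3, 0, 2, 1, 2, 0, 2, 0, 3, 0, 7, 1, 2, 0, 0, 0, 1,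
  5, 1, 5, 2, 1, 3, 1, 0, 4, 0, 0, 2, 2, 2, 1, 1, 4, 0, 0, 3, 1, 2, 0, 3, 2, 0, 0, 2, 5, 2, 0, 6,
  0, 0, 0, 3, 0, 2, 0, 1, 2, 0, 0, 3, 0, 2, 0, 1, 2, 0, 0, 4, 0, 2, 3, 0, 2, 0, 1, 2, 0, 0, 2, 1,
  3, 0, 5, 0, 0, 0, 2, 3, 2, 0, 7, 1, 0, 0, 2, 5, 2, 0, 4, 4, 0, 0, 4, 0, 2, 3, 0, 2, 0, 1, 2, 0,
  0, 3, 0, 2, 2, 0, 1, 0, 2, 3, 0, 2, 2, 0, 1, 2, 0, 3, 0, 2, 6, 0, 1, 0, 0, 2, 0, 3, 0, 1, 0, 0,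
  0, 2, 1, 2, 1, 0, 0, 0, 0, 2, 4, 2, 0, 6, 0, 0, 0, 3, 0, 2, 2, 0, 1, 0, 0, 3, 1, 2, 3, 2, 0, 0,
  0, 3, 1, 2, 3, 3, 0, 0, 2, 1, 6, 0, 1, 1, 6, 5, 0, 4, 1, 6, 3, 1, 2, 3, 2, 0, 2, 0, 1, 6, 0, 1,
  1, 6, 3, 1, 3, 3, 3, 1, 0, 0, 1, 6, 1, 6, 1, 6, 1, 6, 1, 6, 1, 6, 0, 1, 1, 6, 1, 6, 1, 6, 3, 1,
  2, 3, 2, 0, 0, 2, 1, 6, 0, 1, 1, 6, 5, 0, 4, 3, 1, 2, 3, 3, 0, 2, 0, 1, 6, 0, 1, 1, 6, 0, 1, 3,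
  1, 6, 3, 3, 0, 0, 0, 1, 6, 1, 6, 3, 1, 7, 3, 3, 0, 0, 0, 1, 6, 1, 6, 0, 1, 3, 1, 6, 3, 3, 0, 0,
  0, 1, 6, 0, 1, 1, 6, 3, 0, 2, 3, 0, 1, 0, 2, 3, 0, 2, 2, 0, 1, 2, 0, 3, 0, 2, 7, 0, 1, 0, 0, 3,
  0, 2, 3, 1, 0, 0, 2, 2, 0, 3, 3, 0, 0, 0, 2, 2, 0, 3, 3, 0, 0, 0, 2, 3, 0, 0, 3, 1, 0, 2, 0, 3,
  0, 2, 3, 1, 0, 2, 0, 3, 2, 4, 1, 1, 0, 2, 0, 3, 0, 2, 3, 5, 0, 0, 0, 2, 0, 3, 3, 1, 0, 0, 0, 2,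
  0, 3, 3, 0, 0, 0, 0, 5, 0, 0, 2, 0, 1, 3, 0, 0, 2, 0, 4, 0, 0, 2, 0, 3, 3, 1, 0, 0, 0, 4, 0, 0,
  2, 0, 3, 3, 0, 0, 0, 0, 5, 0, 5, 2, 0, 3, 3, 0, 0, 0, 0, 2, 0, 1, 3, 0, 0, 0, 0, 3, 1, 2, 2, 3,
  0, 0, 2, 3, 2, 0, 1, 1, 0, 0, 2, 1, 4, 0, 2, 1, 4, 5, 0, 0, 3, 0, 2, 2, 1, 0, 2, 0, 3, 2, 0, 0,
  1, 0, 2, 0, 1, 4, 0, 2, 1, 4, 3, 0, 2, 2, 1, 5, 0, 0, 5, 1, 1, 3, 1, 2, 3, 2, 0, 0, 0, 3, 0, 2,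
  2, 0, 1, 0, 0, 5, 2, 0, 1, 4, 2, 2, 0, 3, 2, 0, 0, 0, 2, 0, 1, 2, 2, 0, 0, 0, 2, 3, 0, 7, 3, 0,
  0, 0, 3, 2, 0, 1, 1, 0, 0, 0, 5, 2, 0, 3, 2, 0, 0, 1, 0, 0, 2, 1, 6, 0, 2, 1, 6, 3, 2, 0, 1, 1,
  0, 2, 0, 1, 6, 0, 2, 1, 6, 3, 2, 1, 0, 0, 0, 0, 0, 1, 5, 1, 5, 1, 5, 1, 5, 1, 5, 1, 5, 0, 2, 1,
  5, 1, 5, 1, 5, 3, 2, 0, 1, 1, 0, 0, 2, 1, 6, 0, 2, 1, 6, 3, 2, 0, 0, 1, 0, 2, 0, 1, 6, 0, 2, 1,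
  6, 0, 2, 3, 2, 5, 1, 1, 0, 0, 0, 1, 6, 1, 6, 3, 2, 4, 1, 1, 0, 0, 0, 1, 6, 1, 6, 0, 2, 3, 2, 5,
  0, 1, 0, 0, 0, 1, 6, 0, 2, 1, 6, 3, 0, 2, 2, 0, 1, 0, 2, 3, 0, 0, 2, 0, 1, 0, 2, 3, 0, 6, 2, 0,
  1, 0, 2, 3, 0, 2, 2, 0, 1, 2, 0, 3, 0, 0, 2, 0, 1, 2, 0, 3, 2, 5, 0, 1, 1, 2, 0, 3, 0, 2, 2, 5,
  1, 0, 0, 2, 0, 3, 2, 1, 1, 0, 0, 4, 0, 0, 5, 1, 0, 5, 0, 5, 3, 0, 0, 2, 0, 1, 0, 0, 2, 0, 3, 2,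
  1, 1, 0, 0, 2, 0, 3, 2, 0, 1, 0, 0, 2, 0, 1, 2, 0, 1, 0, 0, 5, 0, 5, 2, 0, 1, 2, 1, 1, 0, 0, 2,
  0, 1, 2, 0, 1, 0, 0, 3, 1, 2, 3, 2, 0, 0, 2, 3, 0, 2, 3, 0, 0, 2, 0, 3, 0, 2, 3, 0, 4, 0, 0, 5,
  1, 1, 3, 0, 2, 2, 1, 0, 0, 2, 3, 2, 0, 1, 1, 0, 0, 0, 1, 4, 0, 2, 1, 4, 5, 0, 4, 3, 1, 2, 2, 3,
  0, 2, 0, 4, 1, 4, 0, 3, 0, 3, 0, 3, 0, 1, 3, 0, 2, 7, 1, 0, 0, 0, 4, 1, 3, 0, 1, 4, 1, 1, 4, 0,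
  3, 5, 0, 0, 4, 2, 2, 2, 1, 2, 0, 0, 0, 0, 0, 0, 3, 0, 3, 0, 3, 0, 3, 5, 1, 1, 5, 2, 2, 3, 2, 0,
  1, 1, 0, 0, 0, 5, 1, 1, 3, 0, 0, 2, 0, 1, 0, 0, 2, 2, 2, 0, 0, 0, 0, 0, 5, 0, 0, 3, 3, 0, 0, 0,
  1, 0, 0, 2, 0, 2, 0, 1, 1, 0, 0, 3, 3, 2, 2, 3, 1, 0, 0, 2, 1, 2, 2, 1, 3, 0, 0, 3, 0, 0, 2, 3,
  3, 0, 0, 4, 0, 0, 5, 1, 0, 3, 2, 3, 1, 2, 1, 0, 0, 4, 2, 3, 4, 0, 2, 3, 1, 3, 1, 1, 1, 0, 0, 1,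
  6, 0, 5, 0, 5, 2, 0, 3, 0, 1, 0, 0, 0, 0, 6, 0, 6, 0, 5, 0, 5, 3, 2, 3, 1, 0, 4, 0, 0, 0, 5, 0,
  5, 0, 5, 0, 5, 2, 0, 3, 1, 3, 0, 0, 0, 3, 4, 3, 3, 3, 5, 0, 0, 2, 3, 6, 3, 3, 3, 0, 0, 0, 3, 0,
  3, 3, 0, 7, 0, 3, 3, 0, 0, 2, 2, 2, 1, 3, 1, 0, 2, 2, 0, 2, 0, 1, 1, 2, 0, 2, 0, 2, 0, 1, 5, 0,
  0, 3, 3, 0, 0, 5, 1, 0, 0, 2, 0, 2, 1, 0, 0, 0, 2, 2, 0, 2, 1, 0, 0, 2, 0, 2, 0, 2, 1, 4, 0, 0,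
  0, 5, 1, 2, 5, 0, 0, 2, 0, 0, 2, 3, 0, 0, 0, 4, 0, 3, 0, 3, 3, 0, 0, 0, 0, 3, 0, 0, 3, 2, 0, 2,
  0, 1, 0, 0, 3, 0, 0, 6, 0, 3, 0, 0, 5, 1, 2, 3, 1, 0, 2, 0, 1, 0, 0, 3, 0, 0, 0, 2, 1, 0, 0, 3,
  2, 2, 3, 2, 1, 0, 0, 2, 0, 3, 3, 0, 1, 0, 0, 0, 2, 0, 2, 3, 1, 4, 3, 0, 1, 0, 0, 3, 0, 0, 6, 2,
  1, 0, 0, 3, 0, 0, 2, 2, 1, 0, 0, 2, 1, 0, 1, 2, 1, 0, 0, 2, 3, 0, 1, 1, 3, 0, 0, 0, 4, 0, 4, 0,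
  4, 2, 1, 0, 1, 2, 1, 0, 2, 2, 3, 0, 1, 3, 1, 2, 0, 2, 1, 0, 1, 2, 5, 0, 0, 3, 1, 0, 3, 0, 1, 0,
  2, 3, 1, 0, 3, 0, 1, 2, 0, 3, 1, 4, 2, 0, 1, 0, 0, 5, 0, 5, 5, 0, 1, 2, 0, 1, 3, 0, 1, 0, 0, 3,
  3, 0, 0, 0, 1, 0, 2, 5, 0, 1, 3, 0, 0, 0, 2, 1, 2, 0, 3, 3, 0, 0, 0, 1, 2, 0, 3, 3, 4, 1, 0, 1,
  0, 0, 2, 0, 0, 2, 3, 0, 0, 2, 2, 0, 0, 2, 3, 0, 2, 0, 2, 0, 0, 6, 3, 0, 0, 0, 3, 2, 0, 0, 1, 1,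
  0, 0, 5, 0, 0, 3, 0, 0, 3, 1, 0, 0, 0, 5, 2, 2, 3, 1, 2, 3, 3, 0, 0, 0, 0, 1, 0, 1, 3, 0, 0, 2,
  0, 1, 0, 0, 3, 1, 3, 2, 3, 0, 0, 0, 5, 1, 0, 1, 7, 2, 0, 1, 2, 2, 0, 0, 0, 3, 0, 0, 2, 3, 2, 0,
  0, 1, 6, 1, 6, 1, 6, 1, 6, 5, 1, 1, 3, 0, 1, 0, 3, 1, 0, 0, 1, 8, 1, 1, 2, 1, 0, 2, 2, 5, 0, 0,
  3, 1, 0, 2, 3, 2, 0, 0, 2, 0, 1, 6, 2, 6, 0, 0, 4, 0, 1, 4, 0, 3, 3, 0, 0, 2, 3, 3, 0, 0, 3, 0,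
  0, 2, 3, 2, 0, 0, 3, 0, 0, 2, 3, 3, 0, 0, 4, 0, 1, 3, 0, 0, 0, 3, 2, 0, 0, 2, 0, 1, 6, 2, 0, 0,
  0, 2, 5, 0, 5, 3, 3, 0, 0, 2, 4, 0, 6, 3, 5, 0, 0, 3, 0, 0, 2, 3, 3, 0, 0, 0, 1, 0, 1, 3, 2, 0,
  0, 0, 1, 0, 0, 3, 2, 0, 1, 0, 1, 0, 2, 3, 2, 0, 1, 0, 1, 2, 0, 0, 1, 0, 1, 0, 1, 3, 1, 3, 2, 2,
  4, 0, 0, 0, 1, 0, 1, 0, 1, 0, 1, 0, 1, 0, 1, 3, 2, 0, 4, 0, 1, 0, 0, 4, 0, 0, 2, 0, 1, 2, 0, 1,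
  0, 0, 4, 0, 0, 2, 0, 1, 2, 0, 1, 0, 0, 4, 0, 0, 3, 0, 0, 2, 0, 1, 2, 0, 0, 1, 0, 1, 4, 0, 0, 2,
  0, 1, 2, 0, 1, 0, 0, 0, 1, 0, 1, 0, 1, 0, 1, 0, 1, 3, 1, 6, 3, 2, 0, 0, 0, 0, 1, 0, 1, 0, 1, 0,
  1, 3, 2, 0, 1, 1, 0, 0, 2, 3, 2, 0, 1, 1, 0, 2, 0, 3, 2, 0, 1, 5, 0, 0, 0, 0, 1, 0, 1, 3, 2, 0,
  0, 1, 4, 0, 0, 5, 0, 0, 1, 3, 2, 0, 3, 0, 1, 1, 0, 0, 2, 0, 3, 0, 0, 1, 0, 0, 2, 0, 3, 1, 4, 1,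
  0, 0, 3, 2, 0, 1, 0, 1, 0, 0, 3, 1, 2, 2, 2, 1, 0, 0, 0, 1, 0, 1, 3, 1, 3, 3, 2, 1, 0, 0, 1, 5,
  0, 1, 0, 1, 1, 5, 0, 1, 0, 1, 0, 1, 1, 5, 0, 1, 0, 1, 0, 1, 0, 1, 0, 1, 3, 1, 6, 2, 2, 1, 0, 0,
  0, 1, 0, 1, 0, 1, 0, 1, 0, 1, 0, 1, 3, 2, 0, 1, 0, 4, 0, 0, 3, 2, 0, 0, 1, 1, 0, 2, 0, 1, 3, 0,
  0, 2, 1, 1, 2, 0, 0, 1, 3, 0, 0, 2, 5, 1, 0, 0, 4, 1, 2, 4, 0, 3, 5, 0, 0, 5, 1, 1, 5, 2, 2, 3,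
  0, 0, 1, 3, 0, 0, 0, 3, 0, 0, 1, 3, 0, 0, 0, 5, 2, 1, 2, 1, 0, 3, 2, 0, 0, 0, 3, 1, 0, 0, 3, 1,
  0, 0, 3, 0, 0, 2, 0, 1, 0, 0, 2, 1, 0, 2, 3, 1, 0, 0, 2, 2, 0, 1, 3, 2, 0, 0, 0, 4, 0, 4, 0, 4,
  4, 0, 5, 2, 1, 0, 2, 3, 1, 0, 2, 2, 4, 0, 3, 1, 1, 2, 0, 2, 1, 0, 2, 3, 5, 0, 0, 3, 0, 0, 2, 0,
  1, 0, 2, 3, 3, 0, 0, 0, 1, 2, 0, 3, 3, 4, 0, 0, 1, 0, 0, 3, 0, 0, 2, 6, 1, 0, 0, 2, 0, 1, 0, 2,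
  1, 0, 0, 3, 1, 0, 0, 3, 1, 0, 2, 3, 1, 0, 0, 2, 1, 2, 0, 3, 1, 4, 0, 2, 1, 0, 0, 4, 0, 5, 2, 1,
  0, 3, 2, 0, 0, 2, 2, 1, 0, 3, 2, 0, 2, 0, 2, 3, 0, 2, 4, 0, 0, 0, 3, 2, 0, 1, 1, 0, 0, 2, 3, 0,
  0, 1, 3, 0, 2, 0, 5, 2, 1, 3, 0, 0, 5, 3, 0, 0, 0, 5, 1, 2, 5, 1, 2, 3, 0, 0, 1, 3, 0, 0, 0, 2,
  2, 2, 0, 0, 0, 0, 0, 5, 0, 0, 3, 2, 2, 2, 2, 1, 0, 0, 3, 1, 0, 1, 2, 1, 0, 0, 3, 3, 0, 4, 0, 1,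
  0, 0, 3, 0, 3, 0, 1, 1, 0, 0, 5, 0, 1, 3, 1, 0, 1, 2, 1, 0, 0, 2, 3, 2, 1, 1, 1, 0, 0, 3, 3, 3,
  2, 3, 1, 0, 0, 4, 1, 3, 5, 0, 3, 2, 2, 2, 3, 2, 3, 0, 0, 3, 0, 0, 3, 2, 3, 0, 0, 4, 0, 0, 4, 0,
  1, 3, 2, 3, 0, 0, 1, 0, 0, 1, 6, 0, 5, 0, 5, 2, 0, 3, 1, 0, 0, 0, 0, 0, 6, 0, 6, 0, 5, 0, 5, 3,
  2, 3, 0, 0, 4, 0, 0, 0, 5, 0, 5, 0, 5, 0, 5, 3, 0, 1, 3, 2, 3, 0, 0, 2, 0, 3, 3, 1, 0, 0, 0, 3,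
  1, 3, 2, 1, 5, 0, 0, 2, 1, 3, 3, 0, 1, 0, 2, 2, 0, 2, 1, 0, 1, 2, 0, 2, 3, 2, 1, 1, 7, 0, 0, 0,
  2, 0, 2, 3, 3, 1, 0, 0, 1, 0, 0, 3, 2, 7, 2, 2, 1, 0, 0, 2, 2, 2, 0, 0, 0, 0, 2, 2, 2, 2, 0, 0,
  0, 2, 0, 2, 0, 2, 4, 1, 0, 0, 0, 3, 2, 0, 1, 0, 1, 0, 0, 5, 0, 0, 3, 0, 0, 1, 3, 0, 0, 0, 5, 0,
  0, 3, 2, 1, 1, 1, 1, 0, 0, 1, 5, 1, 5, 1, 5, 1, 5, 1, 5, 0, 2, 1, 5, 1, 5, 1, 5, 2, 0, 3, 1, 1,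
  0, 0, 0, 2, 0, 3, 0, 1, 0, 0, 0, 2, 0, 3, 5, 0, 0, 0, 0, 5, 2, 1, 3, 1, 2, 3, 3, 0, 0, 0, 0, 1,
  0, 1, 3, 0, 0, 0, 2, 1, 0, 0, 3, 2, 0, 0, 1, 1, 0, 0, 3, 2, 0, 0, 1, 1, 0, 2, 1, 7, 0, 2, 1, 7,
  3, 2, 0, 0, 1, 1, 2, 0, 1, 7, 0, 2, 1, 7, 3, 2, 1, 1, 1, 1, 0, 0, 1, 7, 1, 7, 1, 7, 3, 2, 0, 0,
  0, 1, 0, 2, 1, 7, 0, 2, 1, 7, 3, 2, 0, 0, 0, 1, 2, 0, 1, 7, 0, 2, 1, 7, 0, 2, 3, 2, 4, 0, 1, 1,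
  0, 0, 1, 7, 1, 7, 3, 2, 4, 0, 0, 1, 0, 0, 1, 7, 1, 7, 0, 2, 3, 2, 4, 0, 0, 1, 0, 0, 1, 7, 0, 2,
  1, 7, 0, 1, 0, 1, 3, 0, 0, 0, 7, 1, 0, 0, 2, 0, 1, 0, 3, 1, 0, 0, 4, 0, 0, 5, 0, 5, 0, 1, 2, 0,
  1, 0, 2, 1, 0, 0, 4, 0, 0, 5, 0, 4, 0, 1, 2, 0, 1, 0, 3, 1, 0, 0, 4, 0, 0, 2, 0, 1, 0, 2, 1, 0,
  0, 0, 1, 0, 1, 0, 1, 0, 1, 0, 1, 3, 1, 6, 2, 3, 0, 0, 0, 0, 1, 0, 1, 0, 1, 0, 1, 3, 2, 0, 1, 1,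
  0, 0, 2, 3, 2, 0, 1, 1, 0, 2, 0, 3, 2, 0, 5, 1, 0, 0, 0, 0, 1, 0, 1, 3, 2, 0, 1, 0, 4, 0, 0, 5,
  0, 0, 1, 3, 2, 1, 2, 1, 0, 1, 0, 0, 2, 0, 3, 0, 0, 1, 0, 0, 2, 0, 3, 4, 0, 1, 0, 0, 3, 2, 0, 0,
  1, 1, 0, 0, 3, 1, 2, 3, 2, 1, 0, 0, 0, 1, 0, 1, 3, 1, 3, 3, 3, 1, 0, 0, 1, 5, 0, 1, 0, 1, 1, 5,
  0, 1, 0, 1, 0, 1, 1, 5, 0, 1, 0, 1, 0, 1, 0, 1, 0, 1, 3, 1, 7, 2, 2, 1, 0, 0, 0, 1, 0, 1, 0, 1,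
  0, 1, 0, 1, 0, 1, 3, 0, 0, 0, 3, 4, 0, 0, 3, 0, 0, 1, 2, 1, 0, 2, 0, 1, 3, 0, 0, 1, 2, 1, 2, 0,
  0, 1, 3, 2, 0, 4, 0, 1, 0, 0, 5, 0, 0, 5, 0, 1, 5, 0, 2, 3, 1, 0, 1, 1, 0, 0, 0, 3, 0, 2, 3, 2,
  0, 0, 0, 0, 0, 0, 0, 0, 1, 0, 1, 3, 1, 0, 1, 5, 0, 0, 0, 3, 0, 2, 2, 3, 0, 0, 0, 0, 0, 0, 0, 0,
  1, 0, 1, 3, 1, 0, 5, 1, 0, 0, 0, 5, 1, 1, 5, 0, 0, 2, 2, 0, 2, 0, 0, 0, 0, 5, 2, 2, 3, 1, 2, 3,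
  3, 0, 0, 0, 3, 2, 1, 1, 1, 0, 0, 0, 3, 0, 4, 3, 1, 0, 0, 0, 5, 1, 1, 3, 0, 0, 2, 0, 1, 0, 0, 3,
  1, 3, 2, 2, 1, 0, 0, 3, 0, 6, 2, 0, 1, 0, 0, 4, 0, 3, 2, 0, 0, 3, 2, 0, 0, 0, 3, 0, 0, 1, 2, 2,
  0, 0, 5, 0, 3, 3, 0, 0, 1, 2, 2, 0, 0, 3, 0, 0, 1, 2, 2, 0, 0, 4, 0, 3, 0, 3, 0, 4, 3, 1, 0, 1,
  3, 0, 0, 0, 3, 1, 0, 3, 3, 0, 0, 0, 3, 2, 0, 7, 1, 0, 0, 0, 2, 2, 2, 0, 0, 0, 0, 0, 2, 2, 0, 2,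
  2, 0, 0, 0, 2, 2, 2, 2, 2, 2, 0, 0, 0, 6, 0, 6, 0, 6, 0, 6, 0, 6, 0, 6, 0, 6, 0, 6, 0, 6, 0, 6,
  2, 2, 0, 2, 2, 0, 0, 2, 0, 6, 0, 6, 0, 6, 2, 2, 0, 2, 2, 0, 2, 0, 0, 6, 0, 6, 0, 6, 1, 2, 4, 0,
  5, 0, 6, 4, 1, 3, 0, 6, 2, 2, 0, 0, 2, 0, 0, 2, 2, 2, 0, 0, 2, 0, 0, 2, 0, 6, 0, 6, 0, 6, 2, 2,
  0, 2, 2, 0, 2, 0, 0, 6, 0, 6, 0, 6, 2, 2, 0, 0, 2, 6, 0, 0, 0, 6, 0, 6, 4, 1, 3, 0, 6, 4, 0, 3,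
  0, 6, 2, 2, 0, 2, 2, 4, 0, 0, 0, 6, 0, 6, 0, 6, 2, 2, 0, 2, 2, 0, 2, 0, 0, 6, 0, 6, 0, 6, 0, 6,
  2, 0, 2, 1, 2, 0, 0, 2, 2, 0, 2, 1, 2, 0, 2, 0, 2, 0, 2, 1, 6, 0, 0, 0, 2, 0, 0, 3, 2, 1, 0, 2,
  2, 0, 0, 3, 2, 0, 0, 2, 2, 1, 0, 3, 3, 5, 0, 2, 2, 1, 0, 3, 3, 1, 2, 0, 2, 0, 0, 1, 2, 0, 2, 0,
  2, 1, 0, 1, 3, 5, 2, 0, 3, 0, 0, 1, 2, 3, 0, 0, 3, 0, 0, 1, 2, 3, 0, 0, 3, 0, 0, 3, 2, 2, 0, 0,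
  2, 0, 0, 5, 2, 0, 0, 0, 2, 2, 0, 2, 0, 0, 0, 2, 2, 1, 0, 3, 1, 1, 0, 2, 0, 4, 0, 4, 0, 4, 2, 0,
  0, 3, 0, 0, 2, 0, 2, 1, 0, 3, 3, 1, 2, 0, 0, 4, 0, 4, 0, 4, 5, 1, 1, 2, 0, 0, 2, 1, 1, 0, 0, 2,
  0, 0, 2, 1, 1, 0, 2, 4, 0, 4, 2, 2, 0, 3, 3, 1, 2, 0, 4, 0, 3, 0, 2, 3, 0, 0, 0, 0, 3, 0, 0, 3,
  0, 0, 2, 2, 3, 0, 0, 3, 1, 0, 2, 6, 1, 0, 0, 2, 2, 0, 0, 2, 0, 0, 0, 2, 0, 2, 1, 0, 0, 0, 0, 3,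
  0, 2, 3, 0, 2, 0, 0, 5, 0, 3, 3, 0, 2, 1, 0, 2, 0, 0, 3, 0, 2, 3, 0, 2, 0, 0, 5, 2, 2, 3, 0, 2,
  3, 1, 0, 0, 0, 3, 4, 0, 1, 1, 0, 0, 0, 3, 1, 4, 1, 3, 0, 0, 0, 4, 0, 3, 0, 5, 0, 4, 2, 1, 0, 3,
  1, 1, 0, 0, 2, 1, 0, 3, 3, 1, 0, 2, 2, 1, 0, 3, 3, 1, 2, 0, 2, 2, 2, 2, 0, 0, 0, 0, 2, 2, 2, 2,
  2, 2, 0, 0, 0, 6, 0, 6, 0, 6, 0, 6, 0, 6, 0, 6, 0, 6, 0, 6, 0, 6, 0, 6, 2, 2, 2, 2, 0, 0, 0, 2,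
  0, 6, 0, 6, 0, 6, 2, 2, 2, 0, 0, 0, 2, 0, 0, 6, 0, 6, 0, 6, 1, 2, 2, 2, 2, 2, 0, 0, 0, 2, 0, 6,
  0, 6, 0, 6, 2, 2, 2, 0, 0, 0, 2, 0, 0, 6, 0, 6, 0, 6, 2, 2, 2, 2, 0, 6, 0, 0, 0, 6, 0, 6, 2, 2,
  2, 2, 0, 4, 0, 0, 0, 6, 0, 6, 0, 6, 2, 2, 2, 0, 0, 6, 0, 0, 0, 6, 0, 6, 0, 6, 2, 0, 2, 1, 0, 0,
  0, 2, 2, 0, 2, 1, 0, 1, 0, 2, 3, 0, 2, 1, 0, 3, 0, 2, 2, 0, 2, 1, 0, 1, 2, 0, 2, 0, 2, 3, 0, 0,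
  2, 0, 2, 0, 2, 1, 0, 4, 2, 0, 3, 0, 2, 3, 0, 2, 0, 0, 4, 1, 3, 3, 0, 2, 1, 0, 2, 0, 0, 4, 1, 3,
  5, 0, 3, 3, 0, 2, 3, 0, 2, 0, 0, 2, 0, 2, 5, 0, 0, 0, 0, 2, 2, 0, 0, 2, 0, 0, 2, 4, 0, 3, 2, 2,
  0, 0, 2, 0, 2, 0, 2, 0, 4, 1, 2, 0, 0, 0, 4, 0, 5, 2, 2, 0, 2, 0, 0, 0, 2, 2, 1, 0, 3, 3, 1, 0,
  0, 0, 4, 0, 4, 0, 4, 4, 0, 4, 2, 2, 0, 2, 0, 0, 2, 0, 2, 1, 0, 3, 3, 1, 0, 0, 0, 4, 0, 4, 0, 4,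
  2, 0, 0, 3, 6, 0, 0, 0, 2, 0, 6, 3, 0, 0, 0, 0, 5, 1, 2, 2, 2, 0, 0, 2, 0, 0, 0, 4, 0, 3, 5, 0,
  0, 5, 1, 2, 3, 2, 0, 0, 0, 1, 0, 0, 3, 0, 2, 0, 2, 1, 0, 0, 3, 0, 4, 0, 2, 1, 0, 0, 2, 0, 0, 2,
  3, 0, 0, 0, 3, 0, 0, 2, 3, 2, 0, 0, 3, 0, 0, 2, 1, 2, 0, 0, 3, 0, 0, 2, 3, 2, 0, 0, 4, 0, 3, 0,
  3, 0, 4, 3, 0, 0, 1, 1, 2, 0, 0, 3, 0, 0, 1, 3, 2, 0, 0, 3, 4, 0, 1, 4, 0, 0, 0, 2, 0, 2, 0, 1,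
  0, 0, 0, 2, 2, 0, 2, 0, 0, 0, 0, 2, 2, 2, 2, 2, 2, 0, 0, 0, 6, 0, 6, 0, 6, 0, 6, 0, 6, 0, 6, 0,
  6, 0, 6, 0, 6, 0, 6, 2, 2, 0, 2, 2, 0, 0, 2, 0, 6, 0, 6, 0, 6, 4, 1, 3, 0, 6, 2, 2, 0, 2, 0, 0,
  2, 0, 0, 6, 0, 6, 0, 6, 1, 2, 2, 2, 0, 2, 0, 0, 0, 2, 0, 6, 0, 6, 0, 6, 2, 2, 0, 2, 0, 0, 2, 0,
  0, 6, 0, 6, 0, 6, 2, 2, 0, 2, 0, 4, 0, 0, 0, 6, 0, 6, 2, 2, 0, 2, 2, 0, 0, 2, 0, 6, 0, 6, 0, 6,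
  0, 6, 2, 2, 0, 2, 0, 4, 0, 0, 0, 6, 0, 6, 0, 6, 2, 2, 2, 0, 0, 0, 0, 2, 2, 0, 2, 2, 1, 0, 2, 0,
  2, 0, 2, 4, 1, 0, 0, 0, 2, 0, 0, 2, 3, 0, 0, 2, 3, 0, 0, 2, 3, 2, 0, 2, 2, 0, 0, 2, 3, 4, 0, 2,
  2, 0, 0, 2, 3, 1, 2, 0, 2, 0, 0, 2, 3, 0, 2, 0, 3, 0, 0, 2, 3, 2, 2, 0, 3, 0, 0, 2, 1, 3, 0, 0,
  4, 0, 5, 3, 0, 0, 2, 1, 2, 0, 0, 3, 0, 0, 2, 1, 2, 0, 0, 2, 0, 0, 2, 5, 0, 0, 0, 4, 0, 5, 4, 0,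
  3, 2, 0, 0, 0, 3, 0, 0, 2, 2, 1, 0, 3, 3, 1, 0, 2, 0, 4, 0, 4, 0, 4, 5, 0, 0, 2, 0, 0, 0, 3, 0,
  2, 0, 2, 1, 0, 3, 3, 1, 2, 0, 0, 4, 0, 4, 0, 4, 5, 0, 0, 5, 1, 2, 2, 0, 0, 3, 2, 1, 0, 0, 2, 2,
  0, 1, 3, 1, 0, 2, 2, 0, 0, 3, 2, 1, 2, 0, 4, 0, 3, 0, 2, 3, 0, 0, 2, 2, 3, 0, 0, 3, 0, 0, 0, 0,
  3, 0, 0, 3, 0, 0, 6, 2, 3, 0, 0, 2, 0, 2, 0, 3, 1, 0, 0, 3, 0, 2, 0, 3, 3, 0, 0, 4, 0, 5, 3, 0,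
  2, 0, 1, 3, 0, 0, 3, 0, 2, 0, 1, 3, 0, 0, 4, 0, 3, 0, 4, 0, 3, 3, 0, 2, 1, 3, 2, 0, 0, 3, 0, 2,
  3, 1, 2, 0, 0, 3, 0, 2, 1, 7, 2, 0, 0, 2, 0, 2, 2, 1, 0, 0, 0, 2, 2, 2, 0, 0, 0, 0, 0, 2, 2, 0,
  0, 2, 2, 0, 0, 0, 5, 0, 5, 0, 5, 0, 5, 0, 5, 0, 5, 0, 5, 0, 5, 0, 5, 0, 5, 4, 1, 3, 4, 0, 5, 5,
  2, 5, 2, 3, 2, 0, 2, 0, 0, 2, 0, 6, 0, 6, 0, 6, 2, 0, 2, 0, 2, 0, 0, 3, 0, 6, 0, 6, 0, 6, 2, 0,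
  3, 1, 0, 0, 0, 3, 0, 6, 0, 6, 0, 6, 1, 2, 4, 1, 3, 5, 2, 4, 2, 0, 2, 0, 0, 0, 3, 0, 0, 6, 0, 6,
  0, 6, 2, 0, 2, 0, 0, 0, 3, 0, 0, 6, 0, 6, 0, 6, 2, 0, 2, 1, 0, 0, 3, 0, 0, 6, 0, 6, 0, 6, 1, 2,
  1, 2, 2, 2, 2, 0, 2, 0, 0, 2, 0, 6, 0, 6, 0, 6, 4, 0, 4, 0, 6, 2, 2, 2, 0, 2, 0, 2, 0, 0, 6, 0,
  6, 0, 6, 2, 2, 2, 0, 0, 6, 0, 0, 0, 6, 0, 6, 4, 1, 3, 2, 2, 2, 0, 2, 6, 0, 0, 0, 6, 0, 6, 0, 6,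
  4, 1, 3, 2, 2, 2, 0, 2, 4, 0, 0, 0, 6, 0, 6, 0, 6, 2, 0, 0, 2, 1, 0, 0, 2, 2, 2, 2, 2, 0, 0, 2,
  0, 2, 0, 6, 2, 1, 0, 0, 0, 4, 0, 5, 2, 0, 2, 0, 3, 1, 0, 2, 2, 0, 2, 0, 1, 0, 0, 2, 2, 1, 2, 1,
  3, 7, 0, 2, 2, 0, 2, 0, 3, 0, 2, 0, 3, 0, 2, 0, 1, 2, 2, 0, 2, 0, 2, 0, 3, 5, 2, 0, 3, 0, 2, 0,
  1, 3, 0, 0, 3, 0, 2, 0, 1, 3, 0, 0, 3, 0, 2, 0, 3, 3, 0, 0, 0, 3, 5, 0, 3, 3, 0, 2, 0, 1, 3, 0,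
  0, 2, 2, 2, 0, 6, 0, 0, 0, 2, 0, 0, 0, 3, 0, 0, 2, 5, 1, 2, 2, 0, 0, 3, 2, 1, 0, 0, 5, 0, 0, 2,
  1, 0, 1, 3, 1, 0, 0, 0, 4, 0, 4, 0, 4, 5, 0, 0, 4, 0, 4, 2, 0, 0, 0, 3, 0, 2, 0, 2, 1, 0, 3, 3,
  1, 0, 0, 0, 4, 0, 4, 0, 4, 2, 0, 0, 6, 3, 0, 0, 0, 2, 2, 6, 0, 2, 0, 0, 0, 5, 0, 1, 2, 1, 2, 1,
  3, 1, 0, 0, 4, 0, 3, 5, 1, 2, 3, 0, 2, 1, 3, 0, 0, 0, 1, 4, 1, 4, 5, 0, 0, 2, 1, 0, 3, 3, 1, 0,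
  0, 2, 2, 0, 2, 0, 0, 0, 0, 2, 2, 0, 0, 0, 2, 0, 0, 0, 4, 0, 4, 0, 4, 0, 4, 0, 4, 0, 4, 0, 4, 0,
  4, 0, 4, 0, 4, 1, 2, 1, 2, 1, 2, 1, 2, 1, 2, 2, 2, 0, 2, 2, 4, 0, 0, 0, 5, 0, 5, 1, 2, 1, 2, 2,
  1, 0, 3, 3, 1, 0, 2, 4, 0, 4, 2, 0, 0, 2, 3, 1, 2, 0, 2, 0, 0, 2, 5, 1, 0, 0, 1, 2, 1, 2, 5, 0,
  0, 2, 0, 2, 2, 1, 1, 0, 0, 4, 1, 3, 0, 4, 3, 0, 2, 1, 1, 2, 0, 0, 3, 0, 2, 3, 3, 2, 0, 0, 3, 3,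
  2, 3, 6, 0, 0, 0, 2, 2, 2, 0, 2, 0, 0, 0, 2, 2, 2, 2, 0, 2, 0, 0, 0, 5, 0, 5, 0, 5, 0, 5, 0, 5,
  0, 5, 0, 5, 0, 5, 0, 5, 0, 5, 1, 2, 1, 2, 1, 2, 1, 2, 1, 2, 2, 2, 2, 0, 0, 6, 0, 0, 0, 5, 0, 5,
  1, 2, 1, 2, 1, 2, 1, 2, 2, 0, 4, 2, 1, 1, 0, 0, 2, 1, 2, 1, 3, 1, 0, 2, 1, 2, 2, 1, 2, 1, 3, 1,
  2, 0, 1, 2, 2, 0, 2, 0, 7, 1, 0, 0, 2, 0, 6, 0, 3, 1, 0, 0, 5, 0, 2, 2, 0, 2, 3, 0, 1, 0, 0, 4,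
  0, 3, 5, 0, 0, 2, 1, 0, 3, 3, 1, 0, 0, 2, 2, 0, 2, 2, 0, 0, 0, 2, 2, 0, 2, 0, 2, 0, 0, 0, 4, 0,
  4, 0, 4, 0, 4, 0, 4, 0, 4, 0, 4, 0, 4, 0, 4, 0, 4, 1, 2, 1, 2, 1, 2, 1, 2, 1, 2, 2, 2, 0, 2, 2,
  6, 0, 0, 0, 5, 0, 5, 1, 2, 1, 2, 4, 0, 5, 2, 0, 0, 3, 2, 0, 0, 2, 3, 0, 0, 3, 2, 2, 0, 2, 2, 0,
  0, 3, 2, 1, 2, 0, 2, 1, 0, 7, 3, 1, 0, 0, 1, 2, 1, 2, 5, 0, 0, 4, 0, 3, 0, 3, 3, 0, 2, 1, 3, 2,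
  0, 0, 3, 1, 2, 3, 1, 0, 0, 0, 3, 0, 2, 5, 3, 2, 0, 0, 2, 0, 2, 1, 2, 1, 0, 0, 2, 0, 0, 3, 2, 1,
  0, 0, 3, 0, 0, 3, 2, 3, 0, 0, 4, 1, 3, 5, 0, 3, 3, 0, 0, 3, 2, 3, 0, 0, 3, 0, 0, 3, 2, 3, 0, 0,
  2, 2, 2, 2, 0, 0, 0, 0, 2, 2, 2, 0, 2, 2, 0, 0, 0, 6, 0, 6, 0, 6, 0, 6, 0, 6, 0, 6, 0, 6, 0, 6,
  0, 6, 0, 6, 1, 2, 1, 2, 1, 2, 1, 2, 1, 2, 2, 2, 2, 2, 0, 6, 0, 0, 0, 6, 0, 6, 1, 2, 1, 2, 1, 2,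
  1, 2, 3, 0, 0, 3, 2, 2, 0, 0, 1, 2, 1, 2, 2, 1, 0, 3, 5, 1, 0, 0, 1, 2, 1, 2, 2, 0, 6, 1, 2, 1,
  0, 0, 4, 0, 5, 2, 0, 2, 3, 0, 1, 0, 2, 1, 2, 2, 1, 2, 3, 1, 1, 2, 0, 1, 2, 2, 0, 2, 7, 0, 1, 0,
  0, 2, 0, 4, 3, 0, 1, 0, 0, 2, 1, 0, 2, 2, 0, 0, 0, 2, 1, 2, 2, 2, 2, 0, 0, 0, 3, 0, 3, 0, 3, 0,
  3, 0, 3, 0, 3, 0, 3, 0, 3, 0, 3, 0, 3, 0, 3, 0, 3, 0, 3, 0, 3, 0, 3, 0, 3, 0, 3, 0, 3, 0, 3, 1,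
  1, 1, 1, 1, 1, 2, 0, 0, 1, 3, 1, 0, 0, 2, 0, 2, 3, 3, 3, 0, 0, 0, 4, 0, 4, 0, 4, 0, 4, 0, 4, 0,
  4, 0, 4, 0, 4, 0, 4, 0, 4, 0, 4, 0, 4, 0, 4, 0, 4, 0, 4, 0, 4, 0, 4, 0, 4, 0, 4, 1, 0, 1, 0, 1,
  0, 1, 0, 1, 0, 2, 0, 0, 1, 3, 5, 0, 0, 0, 4, 0, 4, 1, 0, 1, 0, 1, 1, 1, 1, 2, 1, 0, 0, 2, 6, 0,
  0, 2, 0, 0, 1, 3, 3, 0, 0, 0, 4, 0, 4, 1, 1, 1, 1, 1, 1, 1, 1, 0, 2, 2, 0, 0, 7, 3, 5, 0, 0, 2,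
  0, 6, 1, 3, 5, 0, 0, 1, 1, 1, 1, 2, 1, 2, 2, 2, 2, 0, 0, 0, 3, 0, 3, 0, 3, 0, 3, 0, 3, 0, 3, 0,
  3, 0, 3, 0, 3, 0, 3, 0, 3, 0, 3, 0, 3, 0, 3, 0, 3, 0, 3, 0, 3, 0, 3, 0, 3, 1, 1, 1, 1, 1, 1, 2,
  0, 0, 3, 1, 1, 0, 0, 2, 0, 0, 1, 1, 3, 0, 0, 0, 3, 0, 3, 0, 3, 0, 3, 0, 3, 0, 3, 0, 3, 0, 3, 0,
  3, 0, 3, 0, 3, 0, 3, 0, 3, 0, 3, 0, 3, 0, 3, 0, 3, 0, 3, 0, 3, 1, 0, 1, 0, 1, 0, 1, 0, 1, 0, 2,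
  0, 0, 3, 1, 5, 0, 0, 0, 4, 0, 4, 1, 0, 1, 0, 1, 1, 1, 1, 2, 1, 0, 2, 0, 4, 0, 0, 2, 1, 2, 2, 2,
  2, 0, 0, 0, 4, 0, 4, 0, 4, 0, 4, 1, 1, 1, 1, 1, 1, 1, 1, 0, 2, 2, 1, 0, 2, 4, 4, 0, 0, 2, 1, 6,
  2, 0, 6, 0, 0, 1, 1, 1, 1, 0, 2, 0, 2, 0, 2, 0, 2, 4, 0, 2, 2, 1, 0, 2, 4, 0, 0, 0, 1, 1, 1, 1,
  2, 0, 0, 3, 1, 3, 0, 0, 0, 4, 0, 4, 2, 0, 0, 3, 5, 7, 0, 0, 1, 1, 1, 1, 2, 0, 0, 3, 7, 1, 0, 0,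
  2, 1, 0, 2, 4, 0, 0, 0, 0, 4, 0, 4, 1, 0, 1, 0, 2, 0, 0, 3, 5, 7, 0, 0, 2, 1, 0, 2, 6, 0, 0, 0,
  2, 0, 0, 3, 3, 5, 0, 0, 1, 1, 1, 1, 2, 1, 0, 2, 0, 6, 0, 0, 2, 0, 0, 3, 1, 13, 0, 0, 2, 1, 0, 6,
  2, 0, 0, 0, 1, 1, 1, 1, 2, 0, 0, 1, 3, 3, 0, 0, 0, 4, 0, 4, 2, 1, 0, 4, 2, 6, 0, 0, 1, 1, 1, 1,
  2, 0, 0, 5, 3, 1, 0, 0, 2, 1, 0, 4, 2, 2, 0, 0, 0, 4, 0, 4, 1, 0, 1, 0, 2, 1, 0, 4, 2, 6, 0, 0,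
  2, 0, 0, 5, 3, 1, 0, 0, 2, 0, 0, 3, 3, 5, 0, 0, 1, 0, 1, 0, 2, 1, 0, 2, 2, 6, 0, 0, 2, 0, 0, 7,
  3, 15, 0, 0]

theorem ok1210 : rootOk 4 ⟨0, 1, 1, 2, 4, 4⟩ cert1210 = true := by
  decide +kernel

def cert1211 : List ℕ :=
  [5, 1, 0, 4, 1, 0, 4, 1, 1, 4, 1, 2, 4, 1, 3, 0, 1, 4, 1, 0, 4, 2, 4, 4, 1, 1, 4, 1, 2, 4, 1, 4,
  0, 1, 4, 1, 4, 4, 1, 1, 4, 1, 0, 4, 1, 2, 4, 1, 4, 0, 1, 4, 1, 2, 4, 1, 0, 4, 1, 1, 4, 1, 4, 0,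
  1, 0, 1, 4, 1, 4, 4, 2, 0, 4, 2, 1, 4, 2, 2, 4, 1, 0, 4, 1, 1, 4, 1, 2, 0, 1, 4, 1, 0, 4, 1, 1,
  4, 1, 2, 0, 1, 4, 1, 0, 4, 2, 4, 5, 1, 3, 5, 1, 4, 5, 0, 3, 5, 1, 1, 4, 2, 3, 4, 1, 3, 4, 0, 3,
  5, 1, 4, 5, 0, 0, 5, 2, 2, 4, 1, 1, 3, 1, 2, 1, 1, 0, 0, 0, 3, 0, 2, 1, 3, 0, 0, 0, 4, 1, 0, 4,
  2, 4, 0, 2, 0, 1, 1, 2, 1, 1, 5, 1, 3, 4, 1, 4, 4, 0, 0, 4, 0, 4, 5, 2, 4, 4, 1, 3, 4, 0, 1, 4,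
  0, 2, 4, 0, 4, 5, 1, 1, 5, 1, 2, 5, 1, 4, 1, 1, 4, 1, 1, 4, 0, 3, 4, 0, 4, 5, 1, 0, 5, 0, 0, 4,
  2, 2, 5, 1, 1, 2, 1, 2, 0, 0, 1, 0, 0, 2, 0, 2, 0, 1, 1, 0, 0, 5, 1, 3, 5, 2, 4, 1, 2, 1, 1, 0,
  2, 0, 1, 5, 0, 3, 4, 1, 4, 4, 0, 0, 4, 0, 4, 5, 2, 4, 4, 1, 3, 4, 0, 3, 5, 2, 4, 4, 1, 1, 4, 0,
  3, 4, 0, 4, 5, 2, 0, 5, 1, 0, 5, 0, 0, 4, 2, 2, 2, 3, 2, 0, 0, 0, 0, 0, 0, 3, 0, 3, 0, 2, 0, 1,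
  1, 2, 5, 1, 4, 4, 1, 3, 4, 1, 0, 4, 0, 0, 5, 2, 1, 5, 2, 2, 1, 2, 4, 1, 0, 4, 0, 1, 4, 0, 2, 5,
  2, 1, 5, 2, 2, 1, 2, 4, 0, 0, 4, 1, 1, 4, 0, 4, 5, 1, 0, 5, 1, 4, 5, 1, 0, 4, 1, 3, 5, 3, 1, 1,
  3, 5, 3, 1, 1, 3, 4, 2, 2, 4, 0, 4, 5, 0, 0, 4, 3, 4, 2, 1, 2, 0, 0, 0, 1, 0, 2, 0, 0, 3, 3, 1,
  1, 0, 0, 4, 0, 4, 0, 4, 0, 4, 0, 4, 0, 4, 0, 4, 4, 1, 4, 0, 3, 4, 2, 4, 0, 2, 0, 2, 1, 1, 4, 0,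
  3, 0, 2, 0, 2, 4, 0, 4, 0, 2, 4, 1, 4, 0, 1, 0, 1, 5, 0, 0, 1, 2, 1, 2, 1, 2, 5, 1, 1, 5, 1, 2,
  1, 1, 4, 1, 3, 4, 0, 3, 5, 0, 4, 5, 1, 4, 1, 3, 5, 0, 0, 1, 3, 4, 1, 4, 5, 2, 2, 3, 2, 0, 0, 0,
  1, 0, 0, 1, 3, 1, 3, 1, 3, 1, 3, 1, 3, 1, 3, 1, 3, 1, 2, 4, 1, 1, 4, 1, 0, 4, 1, 2, 0, 1, 4, 0,
  3, 4, 0, 4, 5, 2, 2, 1, 2, 3, 0, 0, 2, 0, 1, 0, 0, 1, 3, 0, 2, 1, 3, 4, 2, 2, 2, 0, 2, 0, 1, 0,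
  0, 0, 0, 2, 1, 2, 5, 2, 2, 3, 0, 0, 2, 0, 1, 0, 0, 1, 2, 0, 1, 4, 1, 3, 4, 1, 4, 4, 0, 0, 4, 0,
  3, 4, 0, 4, 4, 1, 1, 4, 1, 1, 2, 0, 2, 1, 0, 0, 0, 0, 0, 1, 0, 1, 1, 1]

theorem ok1211 : rootOk 5 ⟨0, 1, 1, 2, 3, 4⟩ cert1211 = true := by
  decide +kernel

def cert1212 : List ℕ :=
  [4, 1, 0, 5, 1, 5, 5, 0, 3, 5, 2, 3, 5, 3, 4, 1, 3, 1, 2, 5, 0, 5, 5, 1, 3, 1, 1, 5, 1, 4, 1, 1,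
  1, 1, 5, 1, 4, 5, 0, 3, 5, 2, 3, 5, 3, 5, 1, 3, 1, 2, 5, 0, 4, 5, 1, 3, 1, 1, 5, 1, 5, 1, 1, 1,
  1, 5, 1, 3, 5, 1, 4, 5, 1, 5, 1, 1, 4, 0, 0, 5, 1, 5, 5, 1, 3, 4, 2, 4, 0, 2, 5, 0, 5, 5, 0, 3,
  1, 2, 5, 1, 4, 1, 1, 1, 1, 5, 1, 4, 5, 1, 3, 4, 2, 5, 0, 2, 5, 0, 4, 5, 0, 3, 1, 2, 5, 1, 5, 1,
  1, 1, 1, 5, 1, 3, 5, 1, 4, 5, 1, 5, 1, 1, 4, 1, 4, 5, 1, 1, 4, 1, 3, 0, 1, 5, 1, 2, 4, 1, 3, 0,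
  1, 5, 1, 3, 1, 1, 4, 2, 5, 0, 2, 0, 2, 0, 2, 4, 1, 4, 0, 3, 0, 3, 0, 3, 0, 1, 5, 1, 1, 4, 1, 3,
  0, 1, 5, 1, 2, 4, 1, 3, 0, 1, 5, 1, 3, 1, 1, 4, 0, 4, 0, 2, 0, 2, 0, 2, 4, 1, 5, 0, 1, 0, 1, 0,
  1, 0, 1]

theorem ok1212 : rootOk 6 ⟨0, 1, 1, 2, 3, 3⟩ cert1212 = true := by
  decide +kernel

def cert1410 : List ℕ :=
  [4, 1, 0, 4, 1, 1, 4, 1, 0, 4, 0, 2, 4, 0, 3, 4, 0, 4, 4, 0, 5, 0, 0, 4, 1, 2, 4, 1, 0, 4, 0, 1,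
  4, 0, 3, 4, 0, 4, 4, 0, 5, 0, 0, 0, 1]

theorem ok1410 : rootOk 6 ⟨0, 1, 1, 1, 1, 2⟩ cert1410 = true := by
  decide +kernel

def cert2120 : List ℕ :=
  [4, 1, 0, 4, 2, 1, 5, 1, 1, 5, 1, 3, 4, 2, 4, 4, 1, 4, 4, 0, 4, 5, 2, 4, 5, 1, 1, 5, 0, 1, 4, 1,
  0, 4, 3, 3, 4, 2, 3, 2, 2, 0, 2, 0, 0, 0, 0, 4, 0, 2, 2, 0, 2, 0, 2, 1, 0, 0, 4, 3, 1, 4, 1, 4,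
  4, 0, 1, 4, 0, 4, 0, 0, 2, 0, 0, 2, 0, 1, 0, 0, 2, 0, 2, 0, 2, 1, 0, 0, 0, 4, 0, 4, 0, 4, 0, 4,
  0, 4, 0, 4, 0, 4, 4, 1, 1, 4, 0, 4, 5, 2, 0, 5, 0, 0, 5, 1, 0, 5, 1, 3, 5, 2, 4, 5, 0, 0, 3, 1,
  2, 0, 0, 0, 1, 0, 1, 3, 1, 3, 5, 1, 4, 4, 3, 3, 4, 2, 3, 4, 1, 3, 4, 0, 3, 5, 0, 0, 5, 0, 1, 3,
  1, 3, 0, 1, 1, 0, 0, 1, 4, 0, 3, 1, 4, 0, 3, 1, 4, 0, 3, 1, 3, 0, 3, 3, 1, 2, 0, 1, 0, 1, 0, 3,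
  2, 2, 2, 2, 0, 1, 0, 0, 2, 3, 0, 2, 1, 2, 0, 1, 0, 1, 7, 1, 7, 1, 7, 1, 7, 1, 7, 0, 2, 3, 2, 2,
  7, 3, 0, 1, 0, 0, 2, 0, 2, 3, 2, 3, 3, 2, 1, 1, 0, 1, 7, 0, 2, 1, 7, 0, 2, 1, 7, 0, 2, 0, 2, 3,
  2, 6, 2, 3, 0, 1, 0, 0, 2, 0, 2, 0, 3, 3, 3, 0, 0, 4, 0, 1, 0, 0, 3, 3, 3, 1, 0, 0, 0, 5, 0, 1,
  4, 0, 3, 0, 3, 3, 1, 3, 0, 1, 5, 5, 0, 0, 3, 0, 3, 0, 3, 1, 3, 0, 3, 3, 3, 1, 0, 0, 4, 0, 0, 1,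
  4, 0, 3, 0, 3, 3, 1, 3, 0, 1, 4, 5, 0, 0, 3, 0, 3, 0, 3, 5, 0, 3, 3, 1, 3, 0, 0, 1, 5, 0, 0, 3,
  5, 0, 4, 3, 1, 3, 0, 0, 4, 0, 0, 0, 3, 3, 1, 2, 0, 0, 4, 5, 0, 1, 1, 0, 3, 1, 1, 0, 3, 1, 1, 4,
  2, 3, 0, 2, 0, 2, 0, 2, 4, 1, 3, 0, 3, 0, 3, 0, 3, 0, 1, 5, 1, 4, 4, 2, 3, 4, 1, 3, 4, 0, 3, 5,
  1, 1, 5, 0, 1, 4, 1, 0, 4, 3, 4, 4, 2, 4, 2, 0, 0, 2, 0, 0, 1, 0, 4, 0, 2, 2, 0, 2, 0, 2, 0, 1,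
  0, 4, 3, 1, 4, 1, 3, 4, 0, 1, 4, 0, 3, 0, 0, 2, 2, 0, 2, 0, 0, 0, 0, 2, 2, 2, 0, 2, 0, 0, 0, 0,
  4, 0, 4, 0, 4, 0, 4, 0, 4, 0, 4, 0, 4, 4, 1, 1, 4, 0, 3, 5, 2, 0, 5, 1, 4, 3, 1, 2, 0, 1, 0, 1,
  0, 1, 4, 1, 4, 5, 1, 0, 5, 0, 0, 5, 1, 3, 4, 3, 4, 4, 2, 4, 4, 1, 4, 4, 0, 4, 5, 0, 0, 5, 0, 1,
  2, 1, 0, 2, 0, 0, 1, 0, 3, 0, 0, 2, 0, 2, 1, 0, 3, 0, 0, 2, 2, 2, 1, 0, 2, 1, 0, 0, 2, 0, 3, 0,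
  0, 4, 0, 4, 0, 4, 0, 4, 0, 4, 0, 4, 2, 1, 0, 2, 0, 0, 1, 2, 3, 0, 0, 2, 0, 2, 3, 2, 1, 3, 1, 3,
  2, 1, 0, 2, 0, 5, 3, 2, 0, 4, 2, 0, 0, 2, 5, 0, 1, 2, 2, 0, 0, 2, 1, 0, 1, 0, 3, 0, 0, 2, 3, 0,
  3, 0, 3, 0, 0, 2, 3, 2, 3, 0, 2, 2, 0, 2, 3, 3, 1, 0, 0, 6, 0, 6, 0, 6, 0, 6, 0, 6, 2, 0, 0, 2,
  1, 0, 1, 2, 0, 6, 0, 6, 0, 6, 0, 6, 3, 0, 0, 2, 1, 0, 3, 0, 5, 0, 4, 1, 0, 1, 2, 2, 2, 0, 2, 3,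
  7, 1, 0, 0, 6, 1, 2, 1, 3, 2, 3, 0, 2, 0, 0, 6, 0, 1, 3, 1, 3, 3, 0, 0, 2, 2, 3, 1, 0, 3, 0, 0,
  2, 2, 3, 3, 0, 0, 3, 0, 3, 3, 0, 0, 2, 3, 0, 3, 0, 3, 0, 0, 2, 2, 2, 3, 0, 4, 0, 2, 4, 0, 3, 4,
  0, 4, 0, 0, 1, 1, 4, 2, 4, 0, 2, 0, 2, 0, 2, 4, 1, 4, 0, 3, 0, 3, 0, 3, 0, 1, 5, 0, 0, 1, 2, 1,
  2, 1, 2, 5, 0, 1, 5, 1, 2, 4, 2, 4, 4, 1, 4, 4, 0, 4, 5, 2, 0, 5, 2, 4, 1, 2, 5, 2, 4, 1, 2, 5,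
  2, 4, 1, 2, 1, 2, 4, 2, 3, 4, 1, 3, 4, 0, 3, 5, 2, 0, 5, 2, 3, 1, 2, 5, 2, 3, 1, 2, 5, 2, 3, 1,
  2, 1, 2, 1, 1, 5, 1, 3, 4, 1, 4, 4, 0, 4, 5, 2, 4, 4, 1, 1, 4, 0, 4, 5, 2, 0, 5, 1, 0, 5, 0, 0,
  4, 1, 0, 4, 2, 1, 4, 0, 4, 5, 2, 1, 5, 1, 1, 5, 1, 3, 3, 1, 0, 2, 1, 1, 0, 0, 1, 4, 1, 4, 5, 0,
  1, 5, 1, 4, 4, 3, 3, 4, 2, 3, 4, 1, 3, 4, 0, 3, 5, 0, 0, 5, 0, 1, 2, 1, 2, 0, 0, 1, 0, 0, 4, 0,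
  4, 3, 0, 2, 0, 2, 3, 2, 0, 5, 1, 4, 1, 1, 2, 1, 0, 0, 0, 3, 0, 0, 0, 4, 0, 4, 0, 4, 0, 4, 0, 4,
  0, 4, 2, 1, 2, 2, 0, 3, 0, 0, 0, 5, 0, 5, 0, 5, 0, 5, 0, 5, 0, 5, 0, 5, 0, 5, 0, 5, 3, 0, 2, 0,
  0, 1, 2, 0, 5, 1, 4, 1, 1, 2, 2, 2, 0, 1, 1, 1, 0, 2, 0, 2, 0, 1, 1, 0, 0, 0, 6, 0, 6, 0, 6, 0,
  6, 0, 6, 1, 2, 2, 0, 2, 0, 3, 0, 0, 0, 0, 6, 0, 6, 0, 6, 0, 6, 0, 6, 1, 2, 1, 2, 2, 0, 2, 0, 3,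
  0, 4, 0, 0, 6, 0, 6, 0, 6, 1, 2, 2, 2, 2, 0, 1, 5, 1, 0, 0, 6, 1, 2, 1, 3, 4, 0, 3, 2, 3, 2, 0,
  2, 6, 0, 0, 1, 3, 1, 3, 0, 3, 0, 3, 3, 0, 2, 0, 2, 3, 2, 0, 3, 0, 2, 0, 0, 1, 2, 0, 4, 0, 2, 4,
  0, 3, 4, 0, 4, 0, 0, 1, 1, 4, 1, 3, 4, 0, 0, 4, 0, 2, 4, 3, 1, 2, 0, 2, 0, 0, 1, 0, 0, 0, 3, 4,
  0, 4, 4, 3, 2, 0, 1, 0, 1, 0, 3, 4, 0, 1, 4, 0, 4, 4, 3, 2, 4, 1, 2, 4, 4, 1, 0, 4, 0, 1, 2, 0,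
  0, 2, 2, 1, 0, 0, 0, 3, 4, 1, 3, 4, 0, 2, 5, 1, 4, 4, 2, 1, 2, 0, 0, 2, 2, 1, 0, 0, 4, 3, 3, 0,
  3, 0, 3, 0, 3, 4, 1, 1, 2, 0, 2, 0, 0, 1, 0, 0, 0, 3, 0, 3, 0, 3, 0, 3, 0, 3, 0, 3, 0, 3, 0, 1,
  4, 1, 2, 4, 1, 1, 4, 0, 4, 5, 2, 1, 5, 1, 1, 4, 1, 3, 0, 3, 0, 3, 0, 3, 4, 2, 3, 0, 2, 0, 2, 0,
  2, 0, 2, 4, 1, 0, 4, 0, 4, 5, 2, 0, 5, 1, 0, 4, 1, 3, 0, 3, 0, 3, 0, 3, 4, 2, 3, 0, 2, 0, 2, 0,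
  2, 0, 2, 0, 1, 4, 1, 1, 5, 1, 0, 5, 1, 4, 4, 2, 3, 4, 1, 3, 4, 0, 3, 5, 1, 0, 5, 0, 0, 4, 1, 0,
  4, 2, 1, 4, 0, 3, 5, 2, 1, 5, 1, 4, 3, 1, 0, 2, 1, 0, 1, 0, 1, 4, 1, 4, 5, 1, 1, 5, 0, 1, 5, 1,
  3, 4, 3, 4, 4, 2, 4, 4, 1, 4, 4, 0, 4, 5, 0, 0, 5, 0, 1, 3, 0, 0, 2, 3, 1, 0, 0, 5, 0, 0, 1, 5,
  1, 4, 2, 1, 2, 0, 3, 1, 0, 0, 2, 0, 3, 0, 2, 1, 0, 0, 2, 0, 3, 0, 6, 1, 0, 0, 3, 1, 0, 2, 0, 1,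
  0, 0, 0, 3, 3, 3, 0, 0, 0, 1, 0, 0, 0, 3, 1, 6, 0, 3, 1, 6, 0, 3, 5, 0, 5, 3, 1, 2, 2, 1, 1, 0,
  2, 0, 3, 0, 3, 1, 6, 1, 6, 1, 6, 1, 6, 3, 3, 0, 5, 0, 1, 0, 0, 0, 3, 0, 3, 2, 0, 1, 2, 0, 1, 0,
  0, 4, 1, 0, 0, 1, 2, 0, 3, 3, 1, 1, 0, 0, 2, 0, 3, 2, 0, 1, 0, 0, 0, 2, 5, 0, 0, 5, 0, 1, 5, 0,
  2, 1, 0, 3, 0, 1, 2, 3, 1, 1, 0, 1, 5, 0, 2, 1, 5, 0, 2, 1, 5, 0, 2, 3, 0, 1, 2, 2, 0, 0, 0, 1,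
  4, 0, 2, 0, 2, 1, 4, 0, 2, 0, 2, 1, 4, 0, 2, 0, 2, 1, 4, 1, 4, 2, 0, 0, 3, 3, 1, 0, 0, 2, 0, 0,
  3, 3, 1, 0, 0, 4, 1, 0, 2, 0, 1, 3, 2, 1, 0, 0, 2, 0, 1, 2, 1, 1, 0, 0, 4, 0, 1, 2, 0, 0, 1, 3,
  1, 0, 0, 2, 0, 1, 1, 3, 1, 0, 0, 3, 0, 4, 2, 3, 1, 0, 0, 0, 2, 0, 2, 1, 1, 4, 2, 4, 4, 0, 0, 4,
  2, 1, 4, 1, 3, 4, 1, 2, 2, 2, 0, 2, 2, 0, 0, 0, 0, 1, 0, 2, 4, 2, 1, 2, 2, 2, 0, 0, 0, 0, 0, 0,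
  2, 4, 2, 1, 2, 0, 2, 0, 0, 0, 1, 0, 0, 2, 4, 1, 4, 0, 3, 0, 3, 0, 3, 4, 1, 1, 2, 0, 0, 2, 2, 0,
  1, 0, 0, 4, 0, 4, 0, 4, 0, 4, 0, 4, 0, 4, 0, 4, 0, 1, 5, 0, 1, 1, 2, 1, 2, 1, 2, 5, 0, 0, 5, 1,
  2, 4, 2, 4, 4, 1, 4, 4, 0, 4, 5, 2, 1, 5, 2, 4, 1, 2, 5, 2, 4, 1, 2, 5, 2, 4, 1, 2, 1, 2, 4, 2,
  3, 4, 1, 3, 4, 0, 3, 5, 2, 1, 5, 2, 3, 1, 2, 5, 2, 3, 1, 2, 5, 2, 3, 1, 2, 1, 2, 1, 1, 5, 1, 2,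
  4, 1, 4, 4, 0, 4, 4, 0, 3, 0, 2, 0, 2, 0, 2, 5, 1, 4, 5, 2, 4, 4, 1, 3, 0, 1, 4, 1, 3, 4, 1, 0,
  4, 2, 1, 0, 2, 0, 1, 4, 1, 0, 4, 2, 1, 0, 2, 0, 1, 4, 1, 0, 4, 2, 1, 0, 2, 0, 1, 0, 1, 4, 1, 3,
  4, 0, 4, 0, 2, 0, 2, 0, 2, 4, 0, 3, 5, 1, 3, 4, 1, 4, 4, 1, 0, 4, 2, 1, 0, 2, 0, 1, 4, 1, 0, 4,
  2, 1, 0, 2, 0, 1, 4, 1, 0, 4, 2, 1, 0, 2, 0, 1, 0, 1, 5, 1, 4, 4, 1, 3, 4, 0, 4, 0, 2, 0, 2, 0,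
  2, 4, 0, 3, 5, 1, 3, 4, 1, 4, 0, 1, 4, 1, 4, 4, 1, 0, 4, 2, 1, 0, 2, 0, 1, 4, 1, 0, 4, 2, 1, 0,
  2, 0, 1, 4, 1, 0, 4, 2, 1, 0, 2, 0, 1, 0, 1, 5, 0, 0, 1, 2, 1, 2, 1, 2, 5, 0, 1, 1, 2, 1, 2, 1,
  2, 4, 1, 2, 5, 1, 1, 1, 1, 5, 1, 0, 1, 1, 5, 0, 3, 4, 1, 4, 0, 1, 5, 0, 4, 4, 1, 3, 0, 1, 1, 0]

theorem ok2120 : rootOk 5 ⟨0, 0, 1, 2, 2, 4⟩ cert2120 = true := by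
  decide +kernel

def cert2121 : List ℕ :=
  [5, 1, 3, 4, 1, 3, 4, 2, 5, 4, 1, 5, 4, 0, 0, 4, 0, 5, 5, 1, 2, 5, 1, 4, 1, 1, 4, 2, 5, 4, 1, 5,
  4, 0, 1, 4, 0, 5, 5, 1, 2, 5, 1, 4, 1, 1, 4, 2, 5, 4, 1, 5, 4, 0, 2, 4, 0, 4, 4, 0, 5, 5, 1, 2,
  5, 1, 4, 1, 1, 4, 1, 5, 4, 1, 0, 4, 2, 1, 0, 2, 0, 1, 4, 1, 4, 4, 0, 4, 5, 2, 4, 4, 1, 5, 4, 1,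
  0, 4, 2, 1, 0, 2, 0, 1, 4, 0, 0, 4, 2, 1, 4, 1, 4, 4, 0, 4, 5, 2, 0, 5, 2, 5, 1, 2, 4, 1, 4, 4,
  0, 4, 5, 2, 0, 5, 2, 5, 1, 2, 0, 2, 4, 0, 4, 5, 2, 1, 5, 1, 1, 5, 1, 5, 1, 3, 1, 3, 1, 3, 5, 2,
  5, 1, 2, 1, 2, 1, 2, 1, 2, 4, 0, 4, 5, 2, 1, 5, 2, 5, 1, 2, 4, 1, 5, 0, 1, 0, 1, 0, 1, 4, 0, 5,
  0, 2, 0, 2, 0, 2, 0, 0, 4, 1, 0, 4, 2, 1, 4, 2, 4, 4, 2, 5, 0, 2, 4, 1, 4, 4, 1, 5, 0, 1, 4, 1,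
  0, 5, 1, 5, 5, 0, 5, 5, 1, 0, 4, 1, 1, 4, 1, 2, 0, 1, 4, 1, 1, 4, 1, 2, 0, 1, 4, 1, 1, 4, 1, 2,
  0, 1, 1, 1, 5, 1, 1, 5, 0, 5, 1, 2, 1, 2, 1, 2, 5, 1, 5, 5, 1, 1, 1, 1, 5, 1, 1, 1, 1, 5, 1, 1,
  1, 1, 1, 1, 5, 1, 1, 5, 1, 5, 1, 1, 4, 1, 1, 5, 1, 5, 4, 2, 5, 5, 1, 0, 1, 1, 5, 1, 4, 4, 2, 3,
  0, 2, 1, 1, 5, 1, 0, 5, 0, 5, 1, 2, 1, 2, 1, 2, 5, 1, 5, 5, 1, 0, 1, 1, 5, 1, 0, 1, 1, 5, 1, 0,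
  1, 1, 1, 1, 5, 1, 0, 5, 1, 5, 1, 1, 4, 0, 3, 0, 2, 0, 2, 0, 2, 0, 2, 0, 2, 0, 2, 0, 2, 4, 0, 5,
  0, 2, 0, 2, 0, 2, 4, 1, 5, 0, 1, 0, 1, 0, 1, 0, 1]

theorem ok2121 : rootOk 6 ⟨0, 0, 1, 2, 2, 3⟩ cert2121 = true := by
  decide +kernel

def cert2300 : List ℕ :=
  [5, 1, 0, 5, 1, 1, 5, 1, 2, 5, 1, 3, 1, 1]

theorem ok2300 : rootOk 5 ⟨0, 0, 1, 1, 1, 4⟩ cert2300 = true := by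
  decide +kernel

def cert2301 : List ℕ :=
  [5, 1, 5, 5, 1, 0, 4, 1, 1, 4, 0, 1, 5, 1, 5, 5, 0, 1, 5, 0, 2, 5, 0, 3, 5, 0, 4, 1, 0, 5, 1, 1,
  4, 1, 0, 4, 0, 0, 5, 1, 5, 5, 0, 0, 5, 0, 2, 5, 0, 3, 5, 0, 4, 1, 0, 1, 1]

theorem ok2301 : rootOk 6 ⟨0, 0, 1, 1, 1, 3⟩ cert2301 = true := by
  decide +kernel

def cert3030 : List ℕ :=
  [5, 1, 3, 4, 1, 5, 4, 0, 5, 5, 2, 5, 4, 1, 4, 4, 0, 4, 5, 3, 4, 2, 4, 0, 0, 0, 0, 0, 2, 4, 1, 0,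
  4, 2, 2, 4, 1, 4, 4, 1, 5, 4, 0, 4, 4, 0, 5, 5, 3, 1, 5, 3, 2, 1, 3, 0, 2, 4, 2, 1, 4, 1, 4, 4,
  1, 5, 4, 0, 4, 4, 0, 5, 5, 3, 1, 5, 3, 2, 1, 3, 0, 2, 0, 1, 4, 1, 0, 4, 0, 5, 5, 2, 2, 5, 1, 2,
  5, 0, 2, 4, 2, 2, 5, 2, 1, 1, 2, 4, 2, 1, 4, 2, 2, 4, 0, 5, 5, 2, 4, 4, 3, 3, 0, 3, 0, 3, 0, 3,
  0, 3, 0, 3, 0, 3, 3, 4, 0, 0, 0, 1, 1, 0, 0, 3, 4, 3, 3, 0, 3, 1, 2, 5, 2, 0, 1, 2, 0, 2, 4, 0,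
  5, 5, 2, 1, 5, 1, 1, 5, 0, 1, 4, 2, 1, 5, 2, 2, 1, 2, 4, 2, 2, 4, 2, 1, 4, 0, 5, 5, 2, 4, 4, 3,
  4, 0, 3, 0, 3, 0, 3, 0, 3, 0, 3, 0, 3, 3, 0, 0, 0, 0, 1, 3, 0, 0, 3, 4, 3, 3, 0, 3, 1, 2, 5, 2,
  0, 1, 2, 0, 2, 4, 1, 1, 4, 2, 2, 4, 1, 5, 4, 0, 5, 5, 2, 0, 5, 2, 2, 1, 2, 0, 2, 4, 0, 5, 5, 2,
  0, 5, 1, 0, 5, 0, 0, 4, 2, 2, 5, 2, 1, 1, 2, 4, 2, 0, 4, 0, 5, 5, 2, 4, 4, 3, 3, 0, 3, 0, 3, 0,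
  3, 0, 3, 0, 3, 0, 3, 3, 0, 0, 0, 0, 2, 0, 1, 0, 3, 4, 3, 3, 0, 3, 1, 2, 0, 2, 0, 1, 4, 1, 4, 4,
  0, 4, 5, 2, 4, 4, 1, 5, 4, 0, 5, 5, 3, 5, 2, 2, 0, 0, 0, 3, 0, 0, 4, 1, 0, 4, 2, 2, 4, 1, 4, 4,
  1, 5, 4, 0, 4, 4, 0, 5, 5, 3, 1, 5, 3, 2, 1, 3, 0, 2, 4, 2, 1, 4, 1, 4, 4, 1, 5, 4, 0, 4, 4, 0,
  5, 5, 3, 1, 5, 3, 2, 1, 3, 0, 2, 0, 1, 4, 1, 0, 4, 0, 4, 5, 2, 2, 5, 1, 2, 5, 0, 2, 4, 2, 2, 5,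
  2, 1, 1, 2, 4, 2, 1, 4, 2, 2, 4, 0, 4, 5, 2, 5, 4, 3, 3, 0, 3, 0, 3, 0, 3, 0, 3, 0, 3, 0, 3, 3,
  0, 0, 0, 0, 2, 1, 0, 0, 3, 4, 3, 3, 0, 3, 1, 2, 5, 2, 0, 1, 2, 0, 2, 4, 0, 4, 5, 2, 1, 5, 1, 1,
  5, 0, 1, 4, 2, 1, 5, 2, 2, 1, 2, 4, 2, 2, 4, 2, 1, 4, 0, 4, 5, 2, 5, 4, 3, 5, 0, 3, 0, 3, 0, 3,
  0, 3, 0, 3, 0, 3, 4, 0, 3, 3, 0, 0, 0, 0, 0, 1, 2, 0, 3, 4, 3, 3, 0, 3, 1, 2, 5, 2, 0, 1, 2, 0,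
  2, 4, 1, 1, 4, 2, 2, 4, 1, 4, 4, 0, 4, 5, 2, 0, 5, 2, 2, 1, 2, 0, 2, 4, 0, 4, 5, 2, 0, 5, 1, 0,
  5, 0, 0, 4, 2, 2, 5, 2, 1, 1, 2, 4, 2, 0, 4, 0, 4, 5, 2, 5, 4, 3, 5, 0, 3, 0, 3, 0, 3, 0, 3, 0,
  3, 0, 3, 3, 0, 0, 0, 0, 1, 0, 3, 0, 3, 4, 3, 3, 0, 3, 1, 2, 0, 2, 0, 1, 4, 1, 0, 5, 1, 2, 5, 0,
  2, 4, 2, 2, 5, 1, 1, 1, 1, 5, 1, 4, 5, 2, 5, 4, 2, 3, 4, 2, 5, 0, 2, 1, 2, 4, 2, 3, 4, 1, 3, 4,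
  0, 3, 5, 0, 2, 4, 2, 1, 4, 2, 2, 4, 0, 3, 5, 2, 5, 4, 3, 4, 0, 3, 4, 3, 4, 0, 3, 0, 3, 0, 3, 0,
  3, 0, 3, 0, 3, 4, 0, 3, 3, 4, 0, 0, 0, 1, 0, 0, 0, 3, 1, 2, 5, 2, 0, 1, 2, 0, 2, 1, 1, 5, 1, 1,
  5, 0, 1, 4, 2, 1, 5, 1, 2, 1, 1, 5, 1, 4, 5, 2, 5, 4, 2, 3, 4, 2, 5, 0, 2, 1, 2, 4, 2, 3, 4, 1,
  3, 4, 0, 3, 5, 0, 1, 4, 2, 2, 4, 2, 1, 4, 0, 3, 5, 2, 5, 4, 3, 4, 0, 3, 4, 3, 4, 0, 3, 0, 3, 0,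
  3, 0, 3, 0, 3, 0, 3, 4, 0, 3, 3, 0, 0, 0, 0, 1, 2, 0, 0, 3, 1, 2, 5, 2, 0, 1, 2, 0, 2, 1, 1, 5,
  1, 4, 4, 1, 5, 5, 2, 5, 4, 1, 3, 0, 1, 4, 1, 1, 5, 2, 2, 1, 2, 5, 2, 0, 1, 2, 0, 1, 4, 1, 3, 4,
  0, 3, 4, 1, 1, 4, 2, 2, 4, 1, 3, 4, 0, 3, 5, 2, 0, 5, 2, 2, 1, 2, 0, 2, 4, 0, 3, 5, 2, 0, 5, 1,
  0, 5, 0, 0, 4, 2, 2, 5, 2, 1, 1, 2, 4, 2, 0, 4, 0, 3, 5, 2, 5, 4, 3, 4, 0, 3, 4, 3, 4, 0, 3, 0,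
  3, 0, 3, 0, 3, 0, 3, 0, 3, 3, 0, 0, 0, 0, 1, 2, 0, 0, 3, 1, 2, 0, 2, 0, 1, 4, 1, 1, 5, 1, 2, 1,
  1, 5, 1, 0, 1, 1, 4, 1, 2, 5, 1, 1, 1, 1, 5, 1, 0, 1, 1, 0, 1]

theorem ok3030 : rootOk 6 ⟨0, 0, 0, 2, 2, 2⟩ cert3030 = true := by
  decide +kernel

def cert3210 : List ℕ :=
  [5, 1, 5, 5, 1, 0, 5, 1, 5, 5, 0, 1, 5, 0, 2, 5, 0, 3, 5, 0, 4, 1, 0, 5, 1, 1, 5, 1, 5, 5, 0, 0,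
  5, 0, 2, 5, 0, 3, 5, 0, 4, 1, 0, 1, 1]

theorem ok3210 : rootOk 6 ⟨0, 0, 0, 1, 1, 2⟩ cert3210 = true := by
  decide +kernel

end KD7

namespace KD7

theorem root_false {F : Bool → Finset Wd} {d : ℕ} (H : Hyp F d) (a0 a1 a2 a3 a4 a5 : ℕ)
    (h : (d, a0, a1, a2, a3, a4, a5) ∈
      [(3, 1, 1, 1, 4, 4, 4), (4, 1, 1, 1, 3, 4, 4), (5, 1, 1, 1, 3, 3, 4), (6, 1, 1, 1, 3, 3, 3),
       (5, 1, 1, 1, 1, 1, 4), (6, 1, 1, 1, 1, 1, 3), (4, 0, 1, 1, 2, 4, 4), (5, 0, 1, 1, 2, 3, 4),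
       (6, 0, 1, 1, 2, 3, 3), (6, 0, 1, 1, 1, 1, 2), (5, 0, 0, 1, 2, 2, 4), (6, 0, 0, 1, 2, 2, 3),
       (5, 0, 0, 1, 1, 1, 4), (6, 0, 0, 1, 1, 1, 3), (6, 0, 0, 0, 2, 2, 2),
       (6, 0, 0, 0, 1, 1, 2)])
    (φ : Fin 6 → ℕ → Lt) : ¬ Rlz F (rootSt ⟨a0, a1, a2, a3, a4, a5⟩) φ := by
  simp only [List.mem_cons, List.not_mem_nil, or_false, Prod.mk.injEq] at h
  rcases h with ⟨rfl, rfl, rfl, rfl, rfl, rfl, rfl⟩ | ⟨rfl, rfl, rfl, rfl, rfl, rfl, rfl⟩ |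
    ⟨rfl, rfl, rfl, rfl, rfl, rfl, rfl⟩ | ⟨rfl, rfl, rfl, rfl, rfl, rfl, rfl⟩ |
    ⟨rfl, rfl, rfl, rfl, rfl, rfl, rfl⟩ | ⟨rfl, rfl, rfl, rfl, rfl, rfl, rfl⟩ |
    ⟨rfl, rfl, rfl, rfl, rfl, rfl, rfl⟩ | ⟨rfl, rfl, rfl, rfl, rfl, rfl, rfl⟩ |
    ⟨rfl, rfl, rfl, rfl, rfl, rfl, rfl⟩ | ⟨rfl, rfl, rfl, rfl, rfl, rfl, rfl⟩ |
    ⟨rfl, rfl, rfl, rfl, rfl, rfl, rfl⟩ | ⟨rfl, rfl, rfl, rfl, rfl, rfl, rfl⟩ |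
    ⟨rfl, rfl, rfl, rfl, rfl, rfl, rfl⟩ | ⟨rfl, rfl, rfl, rfl, rfl, rfl, rfl⟩ |
    ⟨rfl, rfl, rfl, rfl, rfl, rfl, rfl⟩ | ⟨rfl, rfl, rfl, rfl, rfl, rfl, rfl⟩
  · exact rootOk_sound H _ _ ok0300 φ
  · exact rootOk_sound H _ _ ok0301 φ
  · exact rootOk_sound H _ _ ok0302 φ
  · exact rootOk_sound H _ _ ok0303 φ
  · exact rootOk_sound H _ _ ok0500 φ
  · exact rootOk_sound H _ _ ok0501 φ
  · exact rootOk_sound H _ _ ok1210 φ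
  · exact rootOk_sound H _ _ ok1211 φ
  · exact rootOk_sound H _ _ ok1212 φ
  · exact rootOk_sound H _ _ ok1410 φ
  · exact rootOk_sound H _ _ ok2120 φ
  · exact rootOk_sound H _ _ ok2121 φ
  · exact rootOk_sound H _ _ ok2300 φ
  · exact rootOk_sound H _ _ ok2301 φ
  · exact rootOk_sound H _ _ ok3030 φ
  · exact rootOk_sound H _ _ ok3210 φ

theorem no_pair_aux {F : Bool → Finset Wd} {d : ℕ} (H : Hyp F d) {v w v' w' : Wd}
    {e e' : Finset (Fin 6)}
    (hv : v ∈ F false) (hw : w ∈ F true) (hv' : v' ∈ F false) (hw' : w' ∈ F true)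
    (hs : ¬ Sep w v)
    (hd : (Finset.univ.filter fun i => w i ≠ v i).card = d)
    (h1 : ∀ i, v' i = if i ∈ e then fl (v i) else v i)
    (h2 : ∀ i, w' i = if i ∈ e' then fl (w i) else w i)
    (eD : ∀ i ∈ e, w i ≠ v i) (eD' : ∀ i ∈ e', w i ≠ v i)
    (ho : Odd e.card) (ho' : Odd e'.card) (h3 : 3 ≤ e.card) (h3' : 3 ≤ e'.card)
    (hle : e'.card ≤ e.card) : False := by
  classical
  let g : Fin 6 → Fin 5 := fun i =>
    if i ∈ e then (if i ∈ e' then 1 else 0) else if i ∈ e' then 2 else if w i ≠ v i then 3 else 4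
  have g1 : ∀ i, i ∈ e ↔ (g i == 0 || g i == 1) = true := by
    intro i
    by_cases a : i ∈ e <;> by_cases b : i ∈ e' <;> by_cases c : w i = v i <;> simp [g, a, b, c]
  have g2 : ∀ i, i ∈ e' ↔ (g i == 1 || g i == 2) = true := by
    intro i
    by_cases a : i ∈ e <;> by_cases b : i ∈ e' <;> by_cases c : w i = v i <;> simp [g, a, b, c]
  have g3 : ∀ i, w i ≠ v i ↔ (g i != 4) = true := by
    intro i
    by_cases a : i ∈ e <;> by_cases b : i ∈ e' <;> by_cases c : w i = v i <;>
      first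
      | (exact absurd c (eD i a))
      | (exact absurd c (eD' i b))
      | simp [g, a, b, c]
  set σ := Tuple.sort g with hσ
  have hm : Monotone (g ∘ σ) := Tuple.monotone_sort g
  have s1 := sum_toNat g (fun a => a == 0 || a == 1) e σ g1
  have s2 := sum_toNat g (fun a => a == 1 || a == 2) e' σ g2
  have s3 := sum_toNat g (fun a => a != 4) (Finset.univ.filter fun i => w i ≠ v i) σ
    (fun i => by rw [← g3 i]; simp)
  have hdis := dispatch (g (σ 0)) (g (σ 1)) (hm (by decide)) (g (σ 2)) (hm (by decide))
    (g (σ 3)) (hm (by decide)) (g (σ 4)) (hm (by decide)) (g (σ 5)) (hm (by decide))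
  dsimp only at hdis s1 s2 s3
  rw [s1, s2, s3, hd] at hdis
  have hdis := hdis (Nat.odd_iff.1 ho) (Nat.odd_iff.1 ho') h3 h3' hle
  have H' := H.perm σ
  obtain ⟨φ, R⟩ := root_real (F := fun b => (F b).image fun u => u ∘ σ) (v := v ∘ σ) (w := w ∘ σ)
    (v' := v' ∘ σ) (w' := w' ∘ σ) (e := Finset.univ.filter fun i => σ i ∈ e)
    (e' := Finset.univ.filter fun i => σ i ∈ e')
    (Finset.mem_image_of_mem _ hv) (Finset.mem_image_of_mem _ hw) (Finset.mem_image_of_mem _ hv')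
    (Finset.mem_image_of_mem _ hw')
    (fun i hi h => hs ⟨σ i, h, fun h2 => hi (Prod.ext h h2)⟩)
    (fun i => by simpa using h1 (σ i)) (fun i => by simpa using h2 (σ i))
    (by
      obtain ⟨i, hi⟩ := Finset.card_pos.1 (show 0 < e.card by omega)
      exact ⟨σ.symm i, by simpa using hi⟩)
    (by
      obtain ⟨i, hi⟩ := Finset.card_pos.1 (show 0 < e'.card by omega)
      exact ⟨σ.symm i, by simpa using hi⟩)
    (g ∘ σ)
    (fun i => by rw [Finset.mem_filter]; simpa using g1 (σ i))
    (fun i => by rw [Finset.mem_filter]; simpa using g2 (σ i))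
    (fun i => g3 (σ i))
  exact root_false H' _ _ _ _ _ _ hdis φ R

theorem no_pair (F : Bool → Finset Wd)
    (sep : ∀ s, ∀ u ∈ F s, ∀ v ∈ F s, u ≠ v → Sep u v)
    (notwin : ∀ s, ∀ u ∈ F s, ∀ v ∈ F s, ∀ i, opp (u i) (v i) → ∃ j, j ≠ i ∧ u j ≠ v j)
    (disj : ∀ s, ∀ u ∈ F s, u ∉ F (!s))
    (cov : ∀ s, ∀ u ∈ F (!s), ∀ Y, inW Y u → ∃ v ∈ F s, inW Y v)
    (card : ∀ s, (F s).card ≤ 10) (hne : (F true).Nonempty) : False := by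
  classical
  let P : Finset (Wd × Wd) := ((F true) ×ˢ (F false)).filter fun p => ¬ Sep p.1 p.2
  have hnsep : ∀ (Y : Fin 6 → ℝ → Bool) u v, inW Y u → inW Y v → ¬ Sep u v := by
    rintro Y u v hu hv ⟨i, h1, h2⟩
    apply h2
    rw [← hu i, ← hv i, h1]
  have hP : P.Nonempty := by
    obtain ⟨w, hw⟩ := hne
    have hY : inW (fun i _ => (w i).2) w := fun i => rfl
    obtain ⟨v, hv, hYv⟩ := cov false w hw _ hY
    exact ⟨(w, v), Finset.mem_filter.2 ⟨Finset.mem_product.2 ⟨hw, hv⟩, hnsep _ _ _ hY hYv⟩⟩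
  obtain ⟨⟨w, v⟩, hp, hmax⟩ := Finset.exists_max_image P
    (fun p => (Finset.univ.filter fun i => p.1 i ≠ p.2 i).card) hP
  obtain ⟨hwv, hs⟩ := Finset.mem_filter.1 hp
  obtain ⟨hw, hv⟩ := Finset.mem_product.1 hwv
  dsimp only at hs hw hv hmax
  set d := (Finset.univ.filter fun i => w i ≠ v i).card with hd
  have hcomm : ∀ u v : Wd, (Finset.univ.filter fun i => u i ≠ v i) =
      (Finset.univ.filter fun i => v i ≠ u i) := by
    intro u v; ext i; simp [eq_comm]
  have H : Hyp F d := by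
    refine ⟨sep, notwin, disj, cov, ?_, card⟩
    intro s u hu v hv hns
    cases s
    · exact hmax (u, v) (Finset.mem_filter.2 ⟨Finset.mem_product.2 ⟨hu, hv⟩, hns⟩)
    · rw [hcomm]
      exact hmax (v, u) (Finset.mem_filter.2
        ⟨Finset.mem_product.2 ⟨hv, hu⟩, fun h => hns h.symm⟩)
  obtain ⟨v', hv', e, eD, ho, h3, h1⟩ := exists_odd H (s := false) hv hw hs hd.symm
  have hd2 : (Finset.univ.filter fun i => v i ≠ w i).card = d := by rw [hcomm]
  obtain ⟨w', hw', e', eD', ho', h3', h2⟩ := exists_odd H (s := true) hw hv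
    (fun h => hs h.symm) hd2
  rcases le_total e'.card e.card with hle | hle
  · exact no_pair_aux H hv hw hv' hw' hs hd.symm h1 h2 eD (fun i hi => (eD' i hi).symm) ho ho' h3
      h3' hle
  · exact no_pair_aux (H.swap true) (v := w) (w := v) (v' := w') (w' := v') hw hv hw' hv'
      (fun h => hs h.symm) hd2 h2 h1 eD' (fun i hi => (eD i hi).symm) ho' ho h3' h3 hle

end KD7

namespace KD7

/-! ### From real thresholds to arbitrary sign functions -/

theorem lin_one (S : Finset Wd) (c : Wd → ℤ) (j : Fin 6) (K : ℤ)
    (hf : ∀ u ∈ S, 0 < (u j).1 ∧ (u j).1 < 1)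
    (h : ∀ z : ℝ, 0 ≤ z → z < 1 →
      ∑ u ∈ S, (if decide (z < (u j).1) = (u j).2 then c u else 0) = K)
    (Y : ℝ → Bool) : ∑ u ∈ S, (if Y (u j).1 = (u j).2 then c u else 0) = K := by
  classical
  let D : ℝ → ℤ := fun q => ∑ u ∈ S with (u j).1 = q, (if (u j).2 = true then c u else - c u)
  have hD : ∀ q, 0 < q → q < 1 → D q = 0 := by
    intro q hq0 hq1
    let M : Finset ℝ := insert 0 ((S.image fun u => (u j).1).filter fun r => r < q)
    have hM : M.Nonempty := ⟨0, Finset.mem_insert_self _ _⟩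
    set r := M.max' hM with hr
    have hr0 : 0 ≤ r := Finset.le_max' _ _ (Finset.mem_insert_self _ _)
    have hrq : r < q := by
      have := Finset.max'_mem M hM
      rw [← hr] at this
      rcases Finset.mem_insert.1 this with h | h
      · rw [h]; exact hq0
      · exact (Finset.mem_filter.1 h).2
    have hlt : ∀ u ∈ S, r < (u j).1 → q ≤ (u j).1 := by
      intro u hu h
      by_contra h'
      push Not at h'
      have hmem : (u j).1 ∈ M := Finset.mem_insert_of_mem (Finset.mem_filter.2
        ⟨Finset.mem_image_of_mem (fun u : Wd => (u j).1) hu, h'⟩)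
      have : (u j).1 ≤ r := Finset.le_max' M _ hmem
      linarith
    have e1 := h r hr0 (hrq.trans hq1)
    have e2 := h q hq0.le hq1
    have e3 : D q = ∑ u ∈ S, (if decide (r < (u j).1) = (u j).2 then c u else 0) -
        ∑ u ∈ S, (if decide (q < (u j).1) = (u j).2 then c u else 0) := by
      rw [← Finset.sum_sub_distrib]
      simp only [D]
      rw [Finset.sum_filter]
      apply Finset.sum_congr rfl
      intro u hu
      rcases lt_trichotomy (u j).1 q with h1 | h1 | h1
      · have a1 : ¬ r < (u j).1 := fun h' => by linarith [hlt u hu h']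
        have a2 : ¬ q < (u j).1 := by linarith
        simp [a1, a2, h1.ne]
      · have a1 : r < (u j).1 := by linarith
        have a2 : ¬ q < (u j).1 := by linarith
        cases hb : (u j).2 <;> simp [a1, a2, h1, hrq]
      · have a1 : r < (u j).1 := by linarith
        simp [a1, h1, h1.ne']
    rw [e3, e1, e2, sub_self]
  have h0 := h 0 le_rfl zero_lt_one
  rw [← h0, ← sub_eq_zero, ← Finset.sum_sub_distrib]
  have : ∀ u ∈ S, ((if Y (u j).1 = (u j).2 then c u else 0) -
      (if decide (0 < (u j).1) = (u j).2 then c u else 0)) =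
      if Y (u j).1 = false then - (if (u j).2 = true then c u else - c u) else 0 := by
    intro u hu
    have := (hf u hu).1
    cases hb : (u j).2 <;> cases hY : Y (u j).1 <;> simp [this]
  rw [Finset.sum_congr rfl this, ← Finset.sum_fiberwise_of_maps_to
    (t := S.image fun u => (u j).1) (g := fun u => (u j).1)
    (fun u hu => Finset.mem_image_of_mem _ hu)]
  apply Finset.sum_eq_zero
  intro q hq
  obtain ⟨u0, hu0, rfl⟩ := Finset.mem_image.1 hq
  have hDq := hD _ (hf u0 hu0).1 (hf u0 hu0).2
  cases hY : Y (u0 j).1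
  · have : ∀ u ∈ S.filter (fun u => (u j).1 = (u0 j).1),
        (if Y (u j).1 = false then - (if (u j).2 = true then c u else - c u) else 0) =
        - (if (u j).2 = true then c u else - c u) := by
      intro u hu
      rw [(Finset.mem_filter.1 hu).2, hY, if_pos rfl]
    rw [Finset.sum_congr rfl this, Finset.sum_neg_distrib]
    simp only [D] at hDq
    rw [hDq, neg_zero]
  · apply Finset.sum_eq_zero
    intro u hu
    rw [(Finset.mem_filter.1 hu).2, hY, if_neg (by decide)]

noncomputable def Yz (z : Fin 6 → ℝ) : Fin 6 → ℝ → Bool := fun j q => decide (z j < q)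

open Classical in
theorem lin_all (S : Finset Wd) (c : Wd → ℤ) (K : ℤ)
    (hf : ∀ u ∈ S, ∀ j, 0 < (u j).1 ∧ (u j).1 < 1)
    (h : ∀ z : Fin 6 → ℝ, (∀ j, 0 ≤ z j ∧ z j < 1) →
      ∑ u ∈ S, (if inW (Yz z) u then c u else 0) = K)
    (Y : Fin 6 → ℝ → Bool) : ∑ u ∈ S, (if inW Y u then c u else 0) = K := by
  have key : ∀ J : Finset (Fin 6), ∀ Y : Fin 6 → ℝ → Bool,
      (∀ j, j ∉ J → ∃ z : ℝ, 0 ≤ z ∧ z < 1 ∧ Y j = fun q => decide (z < q)) →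
      ∑ u ∈ S, (if inW Y u then c u else 0) = K := by
    intro J
    induction J using Finset.induction_on with
    | empty =>
      intro Y hY
      choose z hz0 hz1 hz using fun j => hY j (Finset.notMem_empty j)
      have : Y = Yz z := by funext j; exact hz j
      rw [this]
      exact h z fun j => ⟨hz0 j, hz1 j⟩
    | insert j J hj ih =>
      intro Y hY
      have split : ∀ (y : ℝ → Bool) (u : Wd), inW (Function.update Y j y) u ↔
          (y (u j).1 = (u j).2 ∧ ∀ k, k ≠ j → Y k (u k).1 = (u k).2) := by
        intro y u
        constructor
        · intro hu
          refine ⟨by simpa using hu j, fun k hk => ?_⟩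
          have := hu k
          rwa [Function.update_of_ne hk] at this
        · rintro ⟨h1, h2⟩ k
          by_cases hk : k = j
          · subst hk; simpa using h1
          · rw [Function.update_of_ne hk]; exact h2 k hk
      have := lin_one S (fun u => if (∀ k, k ≠ j → Y k (u k).1 = (u k).2) then c u else 0) j K
        (fun u hu => hf u hu j) (fun z hz0 hz1 => by
          have := ih (Function.update Y j fun q => decide (z < q)) (fun k hk => by
            by_cases e : k = j
            · subst e; exact ⟨z, hz0, hz1, by simp⟩
            · obtain ⟨z', h1, h2, h3⟩ := hY k (by simp [e, hk])
              exact ⟨z', h1, h2, by rw [Function.update_of_ne e, h3]⟩)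
          rw [← this]
          apply Finset.sum_congr rfl
          intro u _
          simp only [split, ite_and]) (Y j)
      rw [← this]
      apply Finset.sum_congr rfl
      intro u _
      have s := split (Y j) u
      rw [Function.update_eq_self] at s
      simp only [s, ite_and]
  exact key Finset.univ Y fun j hj => absurd (Finset.mem_univ j) hj

/-! ### Encoding of coordinates -/

open Classical in
noncomputable def enc (y r : ℝ) : Lt := if r < y then (r - y + 1, true) else (r - y, false)

theorem enc_mem {y r : ℝ} (h : |r - y| < 1) (hne : r ≠ y) : 0 < (enc y r).1 ∧ (enc y r).1 < 1 := by
  rw [abs_lt] at h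
  unfold enc
  split
  · constructor <;> dsimp only <;> linarith
  · rename_i h'
    have : y < r := lt_of_le_of_ne (not_lt.1 h') hne.symm
    constructor <;> dsimp only <;> linarith

theorem enc_in {y r : ℝ} (h : |r - y| < 1) {z : ℝ} (h0 : 0 ≤ z) (h1 : z < 1) :
    decide (z < (enc y r).1) = (enc y r).2 ↔ (r ≤ y + z ∧ y + z < r + 1) := by
  rw [abs_lt] at h
  unfold enc
  split
  · rename_i h'
    simp only [decide_eq_true_eq]
    constructor
    · intro h; constructor <;> linarith
    · intro h; linarith
  · rename_i h'
    simp only [decide_eq_false_iff_not]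
    constructor
    · intro h; constructor <;> linarith
    · intro h; linarith

theorem enc_inj {y r r' : ℝ} (e : enc y r = enc y r') : r = r' := by
  unfold enc at e
  split at e <;> split at e <;> simp at e
  · exact e
  · exact e

theorem enc_opp {y r r' : ℝ} (e : opp (enc y r) (enc y r')) : |r - r'| = 1 := by
  obtain ⟨e1, e2⟩ := e
  unfold enc at e1 e2
  split at e1 <;> split at e1 <;> rename_i h1 h2
  · simp [h1, h2] at e2
  · dsimp only at e1
    have : r - r' = -1 := by linarith
    rw [this]; norm_num
  · dsimp only at e1
    have : r - r' = 1 := by linarith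
    rw [this]; norm_num
  · simp [h1, h2] at e2

noncomputable def encW (y u : Fin 6 → ℝ) : Wd := fun j => enc (y j) (u j)

theorem encW_inj {y u v : Fin 6 → ℝ} (e : encW y u = encW y v) : u = v := by
  funext j; exact enc_inj (congrFun e j)

theorem encW_in {y u : Fin 6 → ℝ} (h : ∀ j, |u j - y j| < 1) {z : Fin 6 → ℝ}
    (hz : ∀ j, 0 ≤ z j ∧ z j < 1) : inW (Yz z) (encW y u) ↔ y + z ∈ cube u :=
  forall_congr' fun j => enc_in (h j) (hz j).1 (hz j).2

theorem near_of_common {y u p : Fin 6 → ℝ} (h1 : p ∈ cube u) (h2 : p ∈ cube y) (j : Fin 6) :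
    |u j - y j| < 1 := by
  have := h1 j
  have := h2 j
  rw [abs_lt]; constructor <;> linarith

/-! ### The abstract contradiction in terms of real cubes -/

open Classical in
theorem partition_all (y : Fin 6 → ℝ) (Q : Finset (Fin 6 → ℝ)) (hn : ∀ u ∈ Q, ∀ j, |u j - y j| < 1)
    (hne : ∀ u ∈ Q, ∀ j, u j ≠ y j)
    (hun : ∀ u ∈ Q, ∀ v ∈ Q, ∀ p, p ∈ cube u → p ∈ cube v → u = v)
    (hcov : ∀ p ∈ cube y, ∃ u ∈ Q, p ∈ cube u) :
    ∀ u ∈ Q, ∀ v ∈ Q, u ≠ v → Sep (encW y u) (encW y v) := by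
  intro u hu v hv huv
  by_contra hs
  have hsum := lin_all (Q.image (encW y)) (fun _ => 1) 1 (by
    intro w hw j
    obtain ⟨w, hw0, rfl⟩ := Finset.mem_image.1 hw
    exact enc_mem (hn w hw0 j) (hne w hw0 j)) (by
    intro z hz
    have hp : y + z ∈ cube y := fun j => by
      have := hz j
      simp only [Pi.add_apply]
      constructor <;> linarith
    obtain ⟨u0, hu0, hpu⟩ := hcov _ hp
    rw [Finset.sum_eq_single (encW y u0)]
    · rw [if_pos ((encW_in (hn u0 hu0) hz).2 hpu)]
    · intro w hw hwne
      obtain ⟨w, hw0, rfl⟩ := Finset.mem_image.1 hw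
      rw [if_neg]
      intro h
      have := (encW_in (hn w hw0) hz).1 h
      apply hwne
      rw [hun w hw0 u0 hu0 _ this hpu]
    · intro h
      exact absurd (Finset.mem_image_of_mem _ hu0) h)
    (fun j q => if q = (encW y u j).1 then (encW y u j).2 else (encW y v j).2)
  rw [← Finset.sum_filter, Finset.sum_const] at hsum
  have h1 : 1 < (Finset.filter (fun w => inW (fun j q => if q = (encW y u j).1 then
      (encW y u j).2 else (encW y v j).2) w) (Q.image (encW y))).card := by
    apply Finset.one_lt_card.2
    refine ⟨encW y u, Finset.mem_filter.2 ⟨Finset.mem_image_of_mem _ hu, fun j => by simp⟩,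
      encW y v, Finset.mem_filter.2 ⟨Finset.mem_image_of_mem _ hv, fun j => ?_⟩,
      fun h => huv (encW_inj h)⟩
    by_cases e : (encW y v j).1 = (encW y u j).1
    · dsimp only
      rw [if_pos e]
      by_contra h
      exact hs ⟨j, e.symm, h⟩
    · dsimp only
      rw [if_neg e]
  simp at hsum
  omega

open Classical in
theorem no_real_pair (y : Fin 6 → ℝ) (P : Bool → Finset (Fin 6 → ℝ))
    (hn : ∀ s, ∀ u ∈ P s, ∀ j, |u j - y j| < 1)
    (hne : ∀ s, ∀ u ∈ P s, ∀ j, u j ≠ y j)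
    (hun : ∀ s, ∀ u ∈ P s, ∀ v ∈ P s, ∀ p, p ∈ cube u → p ∈ cube v → u = v)
    (hsep : ∀ s, ∀ u ∈ P s, ∀ v ∈ P s, u ≠ v → Sep (encW y u) (encW y v))
    (hcov : ∀ s, ∀ u ∈ P s, ∀ p ∈ cube y, p ∈ cube u → ∃ v ∈ P (!s), p ∈ cube v)
    (htw : ∀ s, ∀ u ∈ P s, ∀ v ∈ P s, ¬ IsTwinPair u v)
    (hdis : ∀ s, ∀ u ∈ P s, u ∉ P (!s))
    (hcard : (P false).card ≤ 10) (hnon : (P false).Nonempty) : False := by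
  let F : Bool → Finset Wd := fun s => (P s).image (encW y)
  have hdisF : ∀ s, ∀ u ∈ F s, u ∉ F (!s) := by
    intro s u hu hu'
    obtain ⟨u, hu0, rfl⟩ := Finset.mem_image.1 hu
    obtain ⟨v, hv0, e⟩ := Finset.mem_image.1 hu'
    rw [encW_inj e] at hv0
    exact hdis s u hu0 hv0
  have hD : Disjoint (F false) (F true) := Finset.disjoint_left.2 fun u hu => hdisF false u hu
  have hle : ∀ s (z : Fin 6 → ℝ), (∀ j, 0 ≤ z j ∧ z j < 1) →
      ((F s).filter fun u => inW (Yz z) u).card ≤ 1 := by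
    intro s z hz
    rw [Finset.card_le_one]
    intro u hu v hv
    obtain ⟨hu, hu'⟩ := Finset.mem_filter.1 hu
    obtain ⟨hv, hv'⟩ := Finset.mem_filter.1 hv
    obtain ⟨u, hu0, rfl⟩ := Finset.mem_image.1 hu
    obtain ⟨v, hv0, rfl⟩ := Finset.mem_image.1 hv
    rw [hun s u hu0 v hv0 _ ((encW_in (hn s u hu0) hz).1 hu') ((encW_in (hn s v hv0) hz).1 hv')]
  have himp : ∀ s (z : Fin 6 → ℝ), (∀ j, 0 ≤ z j ∧ z j < 1) →
      0 < ((F s).filter fun u => inW (Yz z) u).card →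
      0 < ((F (!s)).filter fun u => inW (Yz z) u).card := by
    intro s z hz h
    obtain ⟨u, hu⟩ := Finset.card_pos.1 h
    obtain ⟨hu, hu'⟩ := Finset.mem_filter.1 hu
    obtain ⟨u, hu0, rfl⟩ := Finset.mem_image.1 hu
    have hp : y + z ∈ cube y := fun j => by
      have := hz j
      simp only [Pi.add_apply]
      constructor <;> linarith
    obtain ⟨v, hv, hpv⟩ := hcov s u hu0 _ hp ((encW_in (hn s u hu0) hz).1 hu')
    exact Finset.card_pos.2 ⟨encW y v, Finset.mem_filter.2 ⟨Finset.mem_image_of_mem _ hv,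
      (encW_in (hn _ v hv) hz).2 hpv⟩⟩
  have hsplit : ∀ Y, ∑ u ∈ (F false ∪ F true), (if inW Y u then
      (if u ∈ F false then (1 : ℤ) else -1) else 0) =
      ((F false).filter fun u => inW Y u).card - ((F true).filter fun u => inW Y u).card := by
    intro Y
    rw [Finset.sum_union hD, sub_eq_add_neg]
    congr 1
    · rw [Finset.card_filter]
      push_cast
      apply Finset.sum_congr rfl
      intro u hu
      rw [if_pos hu]
    · rw [Finset.card_filter]
      push_cast
      rw [← Finset.sum_neg_distrib]
      apply Finset.sum_congr rfl
      intro u hu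
      rw [if_neg (show u ∉ F false from hdisF true u hu)]
      split <;> simp
  have hall : ∀ Y, ((F false).filter fun u => inW Y u).card =
      ((F true).filter fun u => inW Y u).card := by
    intro Y
    have := lin_all (F false ∪ F true) (fun u => if u ∈ F false then (1 : ℤ) else -1) 0 (by
      intro w hw j
      rcases Finset.mem_union.1 hw with hw | hw
      all_goals
        obtain ⟨w, hw0, rfl⟩ := Finset.mem_image.1 hw
        exact enc_mem (hn _ w hw0 j) (hne _ w hw0 j)) (by
      intro z hz
      rw [hsplit]
      have a1 := hle false z hz
      have a2 := hle true z hz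
      have a3 := himp false z hz
      have a4 := himp true z hz
      change _ → 0 < ((F true).filter fun u => inW (Yz z) u).card at a3
      change _ → 0 < ((F false).filter fun u => inW (Yz z) u).card at a4
      omega) Y
    rw [hsplit] at this
    omega
  have hall' : ∀ s Y, ((F s).filter fun u => inW Y u).card =
      ((F (!s)).filter fun u => inW Y u).card := by
    intro s Y
    cases s
    · exact hall Y
    · exact (hall Y).symm
  have hcards : ∀ s, (F s).card = ∑ e : Fin 6 → Bool,
      ((F s).filter fun u => inW (fun j _ => e j) u).card := by
    intro s
    rw [Finset.card_eq_sum_card_fiberwise (f := fun (u : Wd) (j : Fin 6) => (u j).2)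
      (t := Finset.univ) (fun u _ => Finset.mem_univ _)]
    apply Finset.sum_congr rfl
    intro e _
    congr 1
    ext u
    rw [Finset.mem_filter, Finset.mem_filter]
    refine and_congr_right fun _ => ?_
    rw [funext_iff]
    exact forall_congr' fun j => eq_comm
  have hc0 : (F false).card ≤ 10 := Finset.card_image_le.trans hcard
  have hc1 : (F true).card = (F false).card := by
    rw [hcards, hcards]
    apply Finset.sum_congr rfl
    intro e _
    exact (hall _).symm
  have hcov' : ∀ s, ∀ u ∈ F (!s), ∀ Y, inW Y u → ∃ v ∈ F s, inW Y v := by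
    intro s u hu Y hY
    have h1 : 0 < ((F (!s)).filter fun u => inW Y u).card :=
      Finset.card_pos.2 ⟨u, Finset.mem_filter.2 ⟨hu, hY⟩⟩
    rw [← hall' s Y] at h1
    obtain ⟨v, hv⟩ := Finset.card_pos.1 h1
    exact ⟨v, (Finset.mem_filter.1 hv).1, (Finset.mem_filter.1 hv).2⟩
  have hnonF : (F true).Nonempty := by
    apply Finset.card_pos.1
    rw [hc1]
    exact Finset.card_pos.2 (hnon.image _)
  refine no_pair F ?_ ?_ hdisF hcov' ?_ hnonF
  · intro s u hu v hv huv
    obtain ⟨u, hu0, rfl⟩ := Finset.mem_image.1 hu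
    obtain ⟨v, hv0, rfl⟩ := Finset.mem_image.1 hv
    exact hsep s u hu0 v hv0 (by rintro rfl; exact huv rfl)
  · intro s u hu v hv i hi
    obtain ⟨u, hu0, rfl⟩ := Finset.mem_image.1 hu
    obtain ⟨v, hv0, rfl⟩ := Finset.mem_image.1 hv
    by_contra hcon
    push Not at hcon
    exact htw s u hu0 v hv0 ⟨i, enc_opp hi, fun j hj => enc_inj (hcon j hj)⟩
  · intro s
    cases s
    · exact hc0
    · rw [hc1]; exact hc0

end KD7

namespace KD7

def ins (i : Fin 7) (a : ℝ) (u : Fin 6 → ℝ) : Fin 7 → ℝ :=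
  Fin.insertNth (α := fun _ => ℝ) i a u

theorem ins_same (i : Fin 7) (a : ℝ) (u : Fin 6 → ℝ) : ins i a u i = a :=
  Fin.insertNth_apply_same (α := fun _ => ℝ) i a u

theorem ins_succ (i : Fin 7) (a : ℝ) (u : Fin 6 → ℝ) (j : Fin 6) :
    ins i a u (i.succAbove j) = u j :=
  Fin.insertNth_apply_succAbove (α := fun _ => ℝ) i a u j

theorem ins_eta (i : Fin 7) (t : Fin 7 → ℝ) : ins i (t i) (fun j => t (i.succAbove j)) = t := by
  funext k
  rcases Fin.eq_self_or_eq_succAbove i k with rfl | ⟨j, rfl⟩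
  · rw [ins_same]
  · rw [ins_succ]

theorem ins_inj {i : Fin 7} {a b : ℝ} {u v : Fin 6 → ℝ} (h : ins i a u = ins i b v) :
    a = b ∧ u = v := by
  constructor
  · have := congrFun h i
    rwa [ins_same, ins_same] at this
  · funext j
    have := congrFun h (i.succAbove j)
    rwa [ins_succ, ins_succ] at this

theorem mem_cube_ins (i : Fin 7) (a h : ℝ) (u p : Fin 6 → ℝ) :
    ins i h p ∈ cube (ins i a u) ↔ (a ≤ h ∧ h < a + 1) ∧ p ∈ cube u := by
  constructor
  · intro H
    refine ⟨?_, fun j => ?_⟩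
    · have := H i
      rwa [ins_same, ins_same] at this
    · have := H (i.succAbove j)
      rwa [ins_succ, ins_succ] at this
  · rintro ⟨h1, h2⟩ k
    rcases Fin.eq_self_or_eq_succAbove i k with rfl | ⟨j, rfl⟩
    · rwa [ins_same, ins_same]
    · rw [ins_succ, ins_succ]; exact h2 j

section

theorem tile_unique {T : Set (Fin 7 → ℝ)} (hT : IsCubeTiling T) {t s p : Fin 7 → ℝ} (ht : t ∈ T) (hs : s ∈ T) (h1 : p ∈ cube t)
    (h2 : p ∈ cube s) : t = s := by
  by_contra h
  exact Set.disjoint_left.1 (hT.2 ht hs h) h1 h2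

theorem tile_exists {T : Set (Fin 7 → ℝ)} (hT : IsCubeTiling T) (i : Fin 7) (h : ℝ) (p : Fin 6 → ℝ) :
    ∃ b u, ins i b u ∈ T ∧ (b ≤ h ∧ h < b + 1) ∧ p ∈ cube u := by
  have : ins i h p ∈ ⋃ t ∈ T, cube t := by rw [hT.1]; trivial
  simp only [Set.mem_iUnion] at this
  obtain ⟨t, ht, hp⟩ := this
  rw [← ins_eta i t] at ht hp
  exact ⟨_, _, ht, (mem_cube_ins _ _ _ _ _).1 hp⟩

theorem ins_unique {T : Set (Fin 7 → ℝ)} (hT : IsCubeTiling T) (i : Fin 7) {h a b : ℝ} {u v p : Fin 6 → ℝ} (hu : ins i a u ∈ T) (hv : ins i b v ∈ T)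
    (h1 : a ≤ h ∧ h < a + 1) (h2 : b ≤ h ∧ h < b + 1) (hp : p ∈ cube u) (hq : p ∈ cube v) :
    a = b ∧ u = v :=
  ins_inj (tile_unique hT hu hv ((mem_cube_ins i a h u p).2 ⟨h1, hp⟩)
    ((mem_cube_ins i b h v p).2 ⟨h2, hq⟩))

theorem col_up {T : Set (Fin 7 → ℝ)} (hT : IsCubeTiling T) (i : Fin 7) {a : ℝ} {u p : Fin 6 → ℝ} (hu : ins i a u ∈ T) (hp : p ∈ cube u) :
    ∃ v, ins i (a + 1) v ∈ T ∧ p ∈ cube v := by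
  obtain ⟨b, v, hv, hb, hpv⟩ := tile_exists hT i (a + 1) p
  rcases hb.1.lt_or_eq with h | h
  · exfalso
    have := (ins_unique hT i (h := b) hu hv ⟨by linarith, h⟩ ⟨le_rfl, by linarith⟩ hp hpv).1
    linarith
  · subst h; exact ⟨v, hv, hpv⟩

theorem col_down {T : Set (Fin 7 → ℝ)} (hT : IsCubeTiling T) (i : Fin 7) {a : ℝ} {u p : Fin 6 → ℝ} (hu : ins i (a + 1) u ∈ T) (hp : p ∈ cube u) :
    ∃ v, ins i a v ∈ T ∧ p ∈ cube v := by
  obtain ⟨b, v, hv, hb, hpv⟩ := tile_exists hT i a p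
  rcases hb.1.lt_or_eq with h | h
  · exfalso
    obtain ⟨w, hw, hpw⟩ := col_up hT i hv hpv
    have := (ins_unique hT i (h := a + 1) hu hw ⟨by linarith, by linarith⟩
      ⟨by linarith, by linarith⟩ hp hpw).1
    linarith
  · subst h; exact ⟨v, hv, hpv⟩

/-- cubes of the tiling meeting the cylinder over `y` at height `h` -/
def Qs (T : Set (Fin 7 → ℝ)) (i : Fin 7) (y : Fin 6 → ℝ) (h : ℝ) : Set (Fin 6 → ℝ) :=
  {u | (∃ b, ins i b u ∈ T ∧ b ≤ h ∧ h < b + 1) ∧ ∀ j, |u j - y j| < 1}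

def Ps (T : Set (Fin 7 → ℝ)) (i : Fin 7) (y : Fin 6 → ℝ) (h : ℝ) : Set (Fin 6 → ℝ) :=
  {u | ins i h u ∈ T ∧ ∀ j, |u j - y j| < 1}

theorem Qs_inj {T : Set (Fin 7 → ℝ)} (hT : IsCubeTiling T) (i : Fin 7) (y : Fin 6 → ℝ) (h : ℝ) :
    Set.InjOn (fun (u : Fin 6 → ℝ) (j : Fin 6) => decide (y j < u j)) (Qs T i y h) := by
  rintro u ⟨⟨a, hu, ha⟩, hnu⟩ v ⟨⟨b, hv, hb⟩, hnv⟩ e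
  have key : ∀ w : Fin 6 → ℝ, (∀ j, |w j - y j| < 1) → (∀ j, decide (y j < u j) = decide (y j < w j)) →
      (fun j => if y j < u j then y j + 1 else y j) ∈ cube w := by
    intro w hw hd j
    have h1 := abs_lt.1 (hw j)
    have h2 := hd j
    rw [decide_eq_decide] at h2
    dsimp only
    split
    · rename_i h3
      rw [h2] at h3
      constructor <;> linarith
    · rename_i h3
      rw [h2] at h3
      constructor <;> linarith
  exact (ins_unique hT i hu hv ha hb (key u hnu fun j => rfl) (key v hnv (congrFun e))).2

theorem Qs_finite {T : Set (Fin 7 → ℝ)} (hT : IsCubeTiling T) (i : Fin 7) (y : Fin 6 → ℝ) (h : ℝ) : (Qs T i y h).Finite :=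
  Set.Finite.of_finite_image (Set.toFinite _) (Qs_inj hT i y h)

theorem Ps_sub {T : Set (Fin 7 → ℝ)} (i : Fin 7) (y : Fin 6 → ℝ) {a h : ℝ} (h1 : a ≤ h) (h2 : h < a + 1) :
    Ps T i y a ⊆ Qs T i y h := fun _ hu => ⟨⟨a, hu.1, h1, h2⟩, hu.2⟩

theorem Ps_finite {T : Set (Fin 7 → ℝ)} (hT : IsCubeTiling T) (i : Fin 7) (y : Fin 6 → ℝ) (h : ℝ) : (Ps T i y h).Finite :=
  (Qs_finite hT i y h).subset (Ps_sub i y le_rfl (by linarith))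

theorem level_false {T : Set (Fin 7 → ℝ)} (hT : IsCubeTiling T) (i : Fin 7) (htw : ∀ t ∈ T, ∀ s ∈ T, ¬ IsTwinPair t s) (y : Fin 6 → ℝ)
    (hgen : ∀ t ∈ T, ∀ j, t (i.succAbove j) ≠ y j) (a : ℝ)
    (hne : (Ps T i y a).Nonempty) (hcard : (Ps T i y a).ncard ≤ 10) : False := by
  let c : Bool → ℝ := fun s => if s then a + 1 else a
  let P : Bool → Finset (Fin 6 → ℝ) := fun s => (Ps_finite hT i y (c s)).toFinset
  have memP : ∀ s u, u ∈ P s ↔ u ∈ Ps T i y (c s) := fun s u => Set.Finite.mem_toFinset _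
  have hgen' : ∀ b u, ins i b u ∈ T → ∀ j, u j ≠ y j := by
    intro b u hu j
    have := hgen _ hu j
    rwa [ins_succ] at this
  refine no_real_pair y P ?_ ?_ ?_ ?_ ?_ ?_ ?_ ?_ ?_
  · intro s u hu
    exact ((memP s u).1 hu).2
  · intro s u hu
    exact hgen' _ _ ((memP s u).1 hu).1
  · intro s u hu v hv p hp hq
    rw [memP] at hu hv
    exact (ins_unique hT i (h := c s) hu.1 hv.1 ⟨le_rfl, by linarith⟩ ⟨le_rfl, by linarith⟩ hp hq).2
  · intro s u hu v hv huv
    rw [memP] at hu hv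
    refine partition_all y (Qs_finite hT i y (c s)).toFinset ?_ ?_ ?_ ?_ u ?_ v ?_ huv
    · intro w hw
      rw [Set.Finite.mem_toFinset] at hw
      exact hw.2
    · intro w hw
      rw [Set.Finite.mem_toFinset] at hw
      obtain ⟨⟨b, hb, _⟩, _⟩ := hw
      exact hgen' _ _ hb
    · intro w hw x hx p hp hq
      rw [Set.Finite.mem_toFinset] at hw hx
      obtain ⟨⟨b, hb, hb'⟩, _⟩ := hw
      obtain ⟨⟨b2, hb2, hb2'⟩, _⟩ := hx
      exact (ins_unique hT i hb hb2 hb' hb2' hp hq).2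
    · intro p hp
      obtain ⟨b, w, hw, hb, hpw⟩ := tile_exists hT i (c s) p
      refine ⟨w, ?_, hpw⟩
      rw [Set.Finite.mem_toFinset]
      exact ⟨⟨b, hw, hb⟩, near_of_common hpw hp⟩
    · rw [Set.Finite.mem_toFinset]
      exact Ps_sub i y le_rfl (by linarith) hu
    · rw [Set.Finite.mem_toFinset]
      exact Ps_sub i y le_rfl (by linarith) hv
  · intro s u hu p hp hpu
    rw [memP] at hu
    cases s
    · obtain ⟨v, hv, hpv⟩ := col_up hT i (a := a) hu.1 hpu
      exact ⟨v, (memP _ _).2 ⟨hv, near_of_common hpv hp⟩, hpv⟩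
    · obtain ⟨v, hv, hpv⟩ := col_down hT i (a := a) hu.1 hpu
      exact ⟨v, (memP _ _).2 ⟨hv, near_of_common hpv hp⟩, hpv⟩
  · intro s u hu v hv h
    rw [memP] at hu hv
    obtain ⟨j, h1, h2⟩ := h
    refine htw _ hu.1 _ hv.1 ⟨i.succAbove j, ?_, ?_⟩
    · rw [ins_succ, ins_succ]; exact h1
    · intro k hk
      rcases Fin.eq_self_or_eq_succAbove i k with rfl | ⟨l, rfl⟩
      · rw [ins_same, ins_same]
      · rw [ins_succ, ins_succ]
        exact h2 l (by rintro rfl; exact hk rfl)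
  · have main : ∀ u, u ∈ P false → u ∈ P true → False := by
      intro u hu hv
      rw [memP] at hu hv
      refine htw _ hu.1 _ hv.1 ⟨i, ?_, ?_⟩
      · rw [ins_same, ins_same]
        have : c false - c true = -1 := by simp [c]
        rw [this]; norm_num
      · intro k hk
        rcases Fin.eq_self_or_eq_succAbove i k with rfl | ⟨l, rfl⟩
        · exact absurd rfl hk
        · rw [ins_succ, ins_succ]
    intro s u hu hu'
    cases s
    · exact main u hu hu'
    · exact main u hu' hu
  · rw [← Set.ncard_eq_toFinset_card _ (Ps_finite hT i y (c false))]
    exact hcard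
  · obtain ⟨u, hu⟩ := hne
    exact ⟨u, (memP _ _).2 hu⟩

theorem generic_false {T : Set (Fin 7 → ℝ)} (hT : IsCubeTiling T) (i : Fin 7) (htw : ∀ t ∈ T, ∀ s ∈ T, ¬ IsTwinPair t s) (y : Fin 6 → ℝ) (h : ℝ)
    (hgen : ∀ t ∈ T, ∀ j, t (i.succAbove j) ≠ y j) (S : Finset ℝ) (hS : 6 ≤ S.card)
    (hSm : ∀ a ∈ S, (a ≤ h ∧ h < a + 1) ∧ (Ps T i y a).Nonempty) : False := by
  classical
  have h11 : ∀ a ∈ S, 11 ≤ (Ps T i y a).ncard := by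
    intro a ha
    by_contra hlt
    exact level_false hT i htw y hgen a (hSm a ha).2 (by omega)
  let A : ℝ → Finset (Fin 6 → ℝ) := fun a => (Ps_finite hT i y a).toFinset
  have hdisj : (S : Set ℝ).PairwiseDisjoint A := by
    intro a ha b hb hab
    rw [Function.onFun, Finset.disjoint_left]
    intro u hu hv
    simp only [A, Set.Finite.mem_toFinset] at hu hv
    apply hab
    have hp : u ∈ cube u := fun j => ⟨le_rfl, by linarith⟩
    exact (ins_unique hT i hu.1 hv.1 (hSm a ha).1 (hSm b hb).1 hp hp).1
  have h1 : (S.biUnion A).card = ∑ a ∈ S, (A a).card := Finset.card_biUnion hdisj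
  have h2 : S.card * 11 ≤ ∑ a ∈ S, (A a).card := by
    rw [← smul_eq_mul]
    apply Finset.card_nsmul_le_sum
    intro a ha
    have := h11 a ha
    rwa [Set.ncard_eq_toFinset_card _ (Ps_finite hT i y a)] at this
  have h3 : (S.biUnion A).card ≤ (Finset.univ : Finset (Fin 6 → Bool)).card := by
    apply Finset.card_le_card_of_injOn (fun (u : Fin 6 → ℝ) (j : Fin 6) => decide (y j < u j))
    · intro u _
      exact Finset.mem_coe.2 (Finset.mem_univ _)
    · apply (Qs_inj hT i y h).mono
      intro u hu
      rw [Finset.mem_coe, Finset.mem_biUnion] at hu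
      obtain ⟨a, ha, hu⟩ := hu
      simp only [A, Set.Finite.mem_toFinset] at hu
      exact Ps_sub i y (hSm a ha).1.1 (hSm a ha).1.2 hu
  have h4 : (Finset.univ : Finset (Fin 6 → Bool)).card = 64 := by simp
  omega

theorem T_countable {T : Set (Fin 7 → ℝ)} (hT : IsCubeTiling T) : T.Countable := by
  apply Set.PairwiseDisjoint.countable_of_nonempty_interior (s := fun t => cube t) (a := T)
  · exact fun t ht s hs hne => hT.2 ht hs hne
  · intro t ht
    have ho : IsOpen (Set.pi Set.univ fun k => Set.Ioo (t k) (t k + 1)) :=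
      isOpen_set_pi Set.finite_univ fun k _ => isOpen_Ioo
    have hsub : (Set.pi Set.univ fun k => Set.Ioo (t k) (t k + 1)) ⊆ cube t := by
      intro p hp k
      have := hp k (Set.mem_univ k)
      exact ⟨this.1.le, this.2⟩
    refine ⟨fun k => t k + 1 / 2, interior_maximal hsub ho ?_⟩
    intro k _
    constructor <;> linarith

end

theorem main_thm (T : Set (Fin 7 → ℝ)) (hT : IsCubeTiling T) (h : 6 ≤ rplus T) :
    ∃ t ∈ T, ∃ s ∈ T, IsTwinPair t s := by
  by_contra hcon
  have htw : ∀ t ∈ T, ∀ s ∈ T, ¬ IsTwinPair t s := fun t ht s hs h => hcon ⟨t, ht, s, hs, h⟩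
  have h5 : 5 < rplus T := h
  obtain ⟨x, hx⟩ := exists_lt_of_lt_ciSup h5
  obtain ⟨i, hi⟩ := exists_lt_of_lt_ciSup hx
  have hfin : (L T x i).Finite := Set.finite_of_ncard_pos (by omega)
  let S := hfin.toFinset
  have hS : 6 ≤ S.card := by
    rw [Set.ncard_eq_toFinset_card _ hfin] at hi
    exact hi
  have hmem : ∀ a : S, ∃ u, ins i a u ∈ T ∧ (∀ j, |u j - x (i.succAbove j)| < 1) ∧
      a.1 ≤ x i ∧ x i < a.1 + 1 := by
    rintro ⟨a, ha⟩
    obtain ⟨t, ht, hta, ⟨p, hp1, hp2⟩, hle⟩ := (Set.Finite.mem_toFinset _).1 ha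
    refine ⟨fun j => t (i.succAbove j), ?_, ?_, ?_, ?_⟩
    · dsimp only
      rw [← hta, ins_eta]; exact ht
    · intro j
      have := hp1 (i.succAbove j)
      have := hp2 (i.succAbove j)
      rw [abs_lt]; constructor <;> linarith
    · dsimp only; linarith
    · have := hp1 i
      have := hp2 i
      dsimp only; linarith
  choose u hu1 hu2 hu3 hu4 using hmem
  -- the room for the perturbation
  have hroom : ∃ ε : ℝ, 0 < ε ∧ ∀ a : S, ∀ j, ε < u a j - x (i.succAbove j) + 1 := by
    have hne : (Finset.univ : Finset (S × Fin 6)).Nonempty := by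
      obtain ⟨a, ha⟩ := Finset.card_pos.1 (show 0 < S.card by omega)
      exact ⟨(⟨a, ha⟩, 0), Finset.mem_univ _⟩
    obtain ⟨⟨a0, j0⟩, _, hmin⟩ := Finset.exists_min_image Finset.univ
      (fun p : S × Fin 6 => u p.1 p.2 - x (i.succAbove p.2) + 1) hne
    have hpos := (abs_lt.1 (hu2 a0 j0)).1
    refine ⟨(u a0 j0 - x (i.succAbove j0) + 1) / 2, by linarith, fun a j => ?_⟩
    have := hmin (a, j) (Finset.mem_univ _)
    dsimp only at this
    linarith
  obtain ⟨ε, hε, hεu⟩ := hroom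
  have hbad : (⋃ t ∈ T, ⋃ j : Fin 6, ({t (i.succAbove j) - x (i.succAbove j)} : Set ℝ)).Countable :=
    (T_countable hT).biUnion fun t _ => Set.countable_iUnion fun j => Set.countable_singleton _
  obtain ⟨δ, hδ, hδ'⟩ : ∃ δ ∈ Set.Ioo 0 ε, δ ∉
      (⋃ t ∈ T, ⋃ j : Fin 6, ({t (i.succAbove j) - x (i.succAbove j)} : Set ℝ)) := by
    by_contra hno
    push Not at hno
    have hc : (Set.Ioo 0 ε).Countable := hbad.mono hno
    have := Cardinal.mk_Ioo_real hε
    rw [← Cardinal.le_aleph0_iff_set_countable, this] at hc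
    exact absurd hc (not_le.2 Cardinal.aleph0_lt_continuum)
  refine generic_false hT i htw (fun j => x (i.succAbove j) + δ) (x i) ?_ S hS ?_
  · intro t ht j he
    apply hδ'
    simp only [Set.mem_iUnion, Set.mem_singleton_iff]
    exact ⟨t, ht, j, by linarith⟩
  · intro a ha
    refine ⟨⟨hu3 ⟨a, ha⟩, hu4 ⟨a, ha⟩⟩, u ⟨a, ha⟩, hu1 ⟨a, ha⟩, fun j => ?_⟩
    have h1 := abs_lt.1 (hu2 ⟨a, ha⟩ j)
    have h2 := hεu ⟨a, ha⟩ j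
    have h3 := hδ.1
    have h4 := hδ.2
    dsimp only
    rw [abs_lt]; constructor <;> linarith

end KD7

/-- Every cube tiling `[0,1)^7 + T` of `ℝ^7` with `r⁺(T) ≥ 6` contains a twin pair. -/
theorem keller_dim7_of_rplus_ge_six (T : Set (Fin 7 → ℝ))
    (hT : IsCubeTiling T) (h : 6 ≤ rplus T) :
    ∃ t ∈ T, ∃ s ∈ T, IsTwinPair t s := by
  exact KD7.main_thm T hT h
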